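/- arXiv:2508.07113 — 8 statements merged into one kernel-verified Lean document; each statement's English description precedes it below -/
import Mathlib

section
/- Let p be a prime, 𝔽_{p^4} the field with p^4 elements, β ∈ 𝔽_{p^4} with β^p ≠ β, and v a positive divisor of p − 1. Then the polynomial F(x) = (x^{p²} + (1 + (β^{p³} − β^{p²})^{p−1})·x^p − ((β^p − β)^{p−1})^{−1}·x)^v ∈ 𝔽_{p^4}[x] is an MVSP with #V_F = (p² − 1)/v + 1. -/
open Polynomial

/-- The value set of a polynomial over a finite field. -/
def valueSet {F : Type*} [Field F] [Fintype F] [DecidableEq F] (f : F[X]) : Finset F :=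
  Finset.image (fun a => f.eval a) Finset.univ

/-- A minimal value set polynomial (MVSP): a nonconstant polynomial whose value set has
the minimal possible size `⌊(q-1)/deg f⌋ + 1`. -/
def IsMVSP {F : Type*} [Field F] [Fintype F] [DecidableEq F] (f : F[X]) : Prop :=
  0 < f.natDegree ∧ (valueSet f).card = (Fintype.card F - 1) / f.natDegree + 1

/-- `MVSPset S` is the set `𝒫(S, q)` of all MVSPs with value set `S`. -/
def MVSPset {F : Type*} [Field F] [Fintype F] [DecidableEq F] (S : Finset F) : Set F[X] :=
  {f | IsMVSP f ∧ valueSet f = S}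

/-- `U` is a subspace over the subfield `{c : c ^ r = c}` (with `r = p ^ k`):
an additive subgroup closed under multiplication by elements of that subfield. -/
def IsSubspaceOver {F : Type*} [Field F] (r : ℕ) (U : Set F) : Prop :=
  (0 : F) ∈ U ∧ (∀ x ∈ U, ∀ y ∈ U, x + y ∈ U) ∧ (∀ x ∈ U, -x ∈ U) ∧
    (∀ c : F, c ^ r = c → ∀ x ∈ U, c * x ∈ U)

/-- An `r`-linearized polynomial (with `r = q` or `r = p ^ k`): of the form `Σ aᵢ x ^ (r ^ i)`. -/
def IsLinearized {F : Type*} [Field F] (r : ℕ) (M : F[X]) : Prop :=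
  ∃ (s : ℕ) (a : ℕ → F), M = ∑ i ∈ Finset.range (s + 1), C (a i) * X ^ r ^ i


lemma aux_deg {K : Type*} [Field K] (p : ℕ) (hp : p.Prime) (a b : K) :
    (X ^ p ^ 2 + (C a * X ^ p + C b * X) : K[X]).Monic ∧
    (X ^ p ^ 2 + (C a * X ^ p + C b * X) : K[X]).natDegree = p ^ 2 := by
  have h2 := hp.two_le
  have h : (C a * X ^ p + C b * X : K[X]).degree < ((p ^ 2 : ℕ) : WithBot ℕ) := by
    refine lt_of_le_of_lt (degree_add_le _ _) (max_lt ?_ ?_)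
    · refine lt_of_le_of_lt (degree_C_mul_X_pow_le _ _) ?_
      exact_mod_cast (by nlinarith : p < p ^ 2)
    · refine lt_of_le_of_lt (degree_C_mul_X_le _) ?_
      exact_mod_cast (by nlinarith : 1 < p ^ 2)
  exact ⟨monic_X_pow_add h, by
    rw [natDegree_add_eq_left_of_degree_lt (by rwa [degree_X_pow]), natDegree_X_pow]⟩

lemma aux_roots {K : Type*} [Field K] (p : ℕ) (hp : p.Prime) (a b : K) (S : Finset K)
    (hS : ∀ x ∈ S, x ^ p ^ 2 + a * x ^ p + b * x = 0) : S.card ≤ p ^ 2 := by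
  obtain ⟨hm, hd⟩ := aux_deg p hp a b
  rw [← hd]
  refine card_le_degree_of_subset_roots (fun x hx => ?_)
  rw [mem_roots hm.ne_zero]
  simp only [IsRoot, eval_add, eval_pow, eval_X, eval_mul, eval_C]
  rw [← add_assoc]; exact hS x hx

lemma aux_pow {K : Type*} [Field K] [Fintype K] [DecidableEq K] (v n : ℕ) (hv : 0 < v)
    (hvd : v ∣ Fintype.card K - 1) (S : Finset K) (h0 : 0 ∈ S) (hc : S.card = n + 1)
    (hS : ∀ c : K, c ^ v = 1 → ∀ x ∈ S, c * x ∈ S) :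
    (S.image (fun x => x ^ v)).card = n / v + 1 := by
  obtain ⟨g, hg⟩ := IsCyclic.exists_ofOrder_eq_natCard (α := Kˣ)
  rw [Nat.card_eq_fintype_card, Fintype.card_units] at hg
  obtain ⟨k, hk⟩ := hvd
  have hcp : 0 < Fintype.card K - 1 := by
    have := Fintype.one_lt_card (α := K); omega
  have hprim : IsPrimitiveRoot ((g : K) ^ k) v := by
    have h1 : IsPrimitiveRoot (g : K) (Fintype.card K - 1) := by
      rw [IsPrimitiveRoot.coe_units_iff, ← hg]; exact IsPrimitiveRoot.orderOf g
    exact h1.pow hcp (by rw [hk, mul_comm])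
  have hfib : ∀ y ∈ (S.erase 0).image (fun x => x ^ v),
      ((S.erase 0).filter (fun x => x ^ v = y)).card = v := by
    intro y hy
    obtain ⟨z, hz, rfl⟩ := Finset.mem_image.1 hy
    obtain ⟨hz0, hzS⟩ := Finset.mem_erase.1 hz
    have : (S.erase 0).filter (fun x => x ^ v = z ^ v)
        = (nthRootsFinset v (1 : K)).image (fun c => c * z) := by
      ext x
      simp only [Finset.mem_filter, Finset.mem_erase, Finset.mem_image, mem_nthRootsFinset hv]
      constructor
      · rintro ⟨⟨hx0, hxS⟩, hx⟩
        refine ⟨x / z, ?_, by field_simp⟩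
        rw [div_pow, hx, div_self (pow_ne_zero _ hz0)]
      · rintro ⟨c, hc1, rfl⟩
        refine ⟨⟨mul_ne_zero ?_ hz0, hS c hc1 z hzS⟩, by rw [mul_pow, hc1, one_mul]⟩
        rintro rfl
        rw [zero_pow hv.ne'] at hc1
        exact zero_ne_one hc1
    rw [this, Finset.card_image_of_injective _ (mul_left_injective₀ hz0),
      hprim.card_nthRootsFinset]
  have hsum := Finset.card_eq_sum_card_image (fun x : K => x ^ v) (S.erase 0)
  rw [Finset.sum_congr rfl hfib, Finset.sum_const, smul_eq_mul, Finset.card_erase_of_mem h0, hc,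
    Nat.add_sub_cancel] at hsum
  have hins : S.image (fun x => x ^ v) = insert 0 ((S.erase 0).image (fun x => x ^ v)) := by
    conv_lhs => rw [← Finset.insert_erase h0]
    rw [Finset.image_insert, zero_pow hv.ne']
  rw [hins, Finset.card_insert_of_notMem, hsum, Nat.mul_div_cancel _ hv]
  intro h
  obtain ⟨z, hz, hz'⟩ := Finset.mem_image.1 h
  exact (Finset.mem_erase.1 hz).1 (pow_eq_zero_iff hv.ne' |>.1 hz')

/-- the polynomial `(x^{p²} + (1 + (β^{p³} - β^{p²})^{p-1})x^p
- ((β^p - β)^{p-1})⁻¹ x)^v` over `𝔽_{p^4}` is an MVSP with `#V_F = (p² - 1)/v + 1`. -/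
theorem stmt_10 (p v : ℕ) (hp : p.Prime) (hv : 0 < v) (hvd : v ∣ p - 1)
    (K : Type) [Field K] [Fintype K] [DecidableEq K]
    (hcard : Fintype.card K = p ^ 4)
    (β : K) (hβ : β ^ p ≠ β) :
    ∀ G : K[X],
      G = (X ^ p ^ 2 + C (1 + (β ^ p ^ 3 - β ^ p ^ 2) ^ (p - 1)) * X ^ p
        - C (((β ^ p - β) ^ (p - 1))⁻¹) * X) ^ v →
      IsMVSP G ∧ (valueSet G).card = (p ^ 2 - 1) / v + 1 := by
  rintro G rfl
  have : Fact p.Prime := ⟨hp⟩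
  have : CharP K p := charP_of_card_eq_prime_pow hcard
  have hp2 := hp.two_le
  set d : K := β ^ p - β with hd
  have hd0 : d ≠ 0 := sub_ne_zero.2 hβ
  have hβ4 : β ^ p ^ 4 = β := by rw [← hcard]; exact FiniteField.pow_card β
  have hx4 : ∀ x : K, x ^ p ^ 4 = x := fun x => by rw [← hcard]; exact FiniteField.pow_card x
  set d1 := d ^ p with hd1
  set d2 := d1 ^ p with hd2
  set d3 := d2 ^ p with hd3
  have e1 : d1 = β ^ p ^ 2 - β ^ p := by
    rw [hd1, hd, sub_pow_char, ← pow_mul]; ring_nf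
  have e2 : d2 = β ^ p ^ 3 - β ^ p ^ 2 := by
    rw [hd2, e1, sub_pow_char, ← pow_mul, ← pow_mul]; ring_nf
  have e3 : d3 = β - β ^ p ^ 3 := by
    rw [hd3, e2, sub_pow_char, ← pow_mul, ← pow_mul, ← pow_succ, ← pow_succ, hβ4]
  have e4 : d3 ^ p = d := by
    rw [e3, sub_pow_char, ← pow_mul, ← pow_succ, hβ4]
  have htr : d + d1 + d2 + d3 = 0 := by rw [e1, e2, e3, hd]; ring
  have h1 : d1 ≠ 0 := pow_ne_zero _ hd0
  have h2 : d2 ≠ 0 := pow_ne_zero _ h1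
  have h3 : d3 ≠ 0 := pow_ne_zero _ h2
  have hpm : ∀ z : K, z ≠ 0 → z ^ (p - 1) = z ^ p / z := fun z hz => by
    rw [eq_div_iff hz, ← pow_succ, Nat.sub_add_cancel hp.one_le]
  rw [← e2, hpm d2 h2, hpm d hd0, ← hd3, ← hd1, inv_div]
  set A : K := 1 + d3 / d2 with hA
  set B : K := d / d1 with hB
  have hpoly : (X ^ p ^ 2 + C A * X ^ p - C B * X : K[X])
      = X ^ p ^ 2 + (C A * X ^ p + C (-B) * X) := by rw [C_neg]; ring
  obtain ⟨-, hdeg⟩ := aux_deg p hp A (-B)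
  rw [← hpoly] at hdeg
  have hA1 : A ^ p = 1 + d / d3 := by
    rw [hA, add_pow_char, one_pow, div_pow, e4, ← hd3]
  have hA2 : A ^ p ^ 2 = 1 + d1 / d := by
    rw [pow_two, pow_mul, hA1, add_pow_char, one_pow, div_pow, e4, ← hd1]
  have hB1 : B ^ p = d1 / d2 := by rw [hB, div_pow]
  have hB2 : B ^ p ^ 2 = d2 / d3 := by rw [pow_two, pow_mul, hB1, div_pow]
  let L : K →+ K :=
    { toFun := fun x => x ^ p ^ 2 + A * x ^ p - B * x
      map_zero' := by simp [hp.ne_zero]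
      map_add' := fun x y => by
        rw [add_pow_char_pow, add_pow_char]; ring }
  have hL : ∀ x, L x = x ^ p ^ 2 + A * x ^ p - B * x := fun _ => rfl
  have hM : ∀ x, (L x) ^ p ^ 2 + (-A ^ p ^ 2) * (L x) ^ p + (1 / B) * L x = 0 := by
    intro x
    have q1 : (L x) ^ p = x ^ p ^ 3 + A ^ p * x ^ p ^ 2 - B ^ p * x ^ p := by
      rw [hL, sub_pow_char, add_pow_char, mul_pow, mul_pow, ← pow_mul, ← pow_mul, ← pow_succ,
        ← pow_two]
    have q2 : (L x) ^ p ^ 2 = x + A ^ p ^ 2 * x ^ p ^ 3 - B ^ p ^ 2 * x ^ p ^ 2 := by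
      rw [pow_two p, pow_mul, q1, sub_pow_char, add_pow_char, mul_pow, mul_pow, ← pow_mul,
        ← pow_mul x (p ^ 2), ← pow_mul x p, ← pow_succ, hx4, ← pow_mul, ← pow_mul, ← pow_succ,
        ← pow_two]
    have c1 : -B ^ p ^ 2 - A ^ p ^ 2 * A ^ p + 1 / B = 0 := by
      rw [hA2, hA1, hB2, hB]
      field_simp
      linear_combination (-d) * htr
    have c2 : A ^ p ^ 2 * B ^ p + A / B = 0 := by
      rw [hA2, hB1, hB, hA]
      field_simp
      linear_combination d1 * htr
    have hBne : B ≠ 0 := div_ne_zero hd0 h1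
    have c3 : 1 / B * B = 1 := by field_simp
    rw [q1, q2, hL]
    linear_combination x ^ p ^ 2 * c1 + x ^ p * c2 - x * c3
  classical
  have hker : Nat.card L.ker ≤ p ^ 2 := by
    have := aux_roots p hp A (-B) (Finset.univ.filter (fun x => L x = 0)) (fun x hx => by
      have := (Finset.mem_filter.1 hx).2
      rw [hL] at this
      linear_combination this)
    rw [← Fintype.card_subtype] at this
    rw [Nat.card_eq_fintype_card]
    exact (Fintype.card_congr (Equiv.subtypeEquivRight (fun x => L.mem_ker))).trans_le this
  have hvs : ∀ y, y ∈ Finset.univ.image L ↔ y ∈ L.range := fun y => by simp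
  have hrg : (Finset.univ.image L).card ≤ p ^ 2 := by
    refine aux_roots p hp (-A ^ p ^ 2) (1 / B) _ (fun y hy => ?_)
    obtain ⟨x, -, rfl⟩ := Finset.mem_image.1 hy
    exact hM x
  have hrc : Nat.card L.range = (Finset.univ.image L).card := by
    rw [← Nat.card_eq_finsetCard]
    exact Nat.card_congr (Equiv.subtypeEquivRight (fun y => (hvs y).symm))
  have hprod : Nat.card L.ker * Nat.card L.range = p ^ 4 := by
    rw [← AddSubgroup.index_ker, AddSubgroup.card_mul_index, Nat.card_eq_fintype_card, hcard]
  rw [hrc] at hprod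
  have hpp : 0 < p ^ 2 := by positivity
  have himg : (Finset.univ.image L).card = p ^ 2 := by
    refine le_antisymm hrg ?_
    by_contra! hlt
    have : p ^ 4 = p ^ 2 * p ^ 2 := by ring
    have := Nat.mul_le_mul_right (Finset.univ.image L).card hker
    nlinarith
  have hvq : v ∣ Fintype.card K - 1 := by
    rw [hcard]
    exact hvd.trans (by simpa using Nat.sub_dvd_pow_sub_pow p 1 4)
  have hcardV := aux_pow v (p ^ 2 - 1) hv hvq (Finset.univ.image L)
    (Finset.mem_image.2 ⟨0, Finset.mem_univ _, map_zero L⟩) (by omega) (by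
      intro c hc y hy
      obtain ⟨x, -, rfl⟩ := Finset.mem_image.1 hy
      refine Finset.mem_image.2 ⟨c * x, Finset.mem_univ _, ?_⟩
      have hcp : c ^ p = c := by
        obtain ⟨k, hk⟩ := hvd
        have : p = v * k + 1 := by have := hp.one_le; omega
        rw [this, pow_succ, pow_mul, hc, one_pow, one_mul]
      have hcp2 : c ^ p ^ 2 = c := by rw [pow_two, pow_mul, hcp, hcp]
      rw [hL, hL, mul_pow, mul_pow, hcp, hcp2]; ring)
  have hV : valueSet ((X ^ p ^ 2 + C A * X ^ p - C B * X : K[X]) ^ v)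
      = (Finset.univ.image L).image (fun x => x ^ v) := by
    rw [Finset.image_image, valueSet]
    refine Finset.image_congr (fun x _ => ?_)
    simp [hL]
  have hfin : (valueSet ((X ^ p ^ 2 + C A * X ^ p - C B * X : K[X]) ^ v)).card
      = (p ^ 2 - 1) / v + 1 := by rw [hV, hcardV]
  refine ⟨⟨?_, ?_⟩, hfin⟩
  · rw [natDegree_pow, hdeg]; positivity
  · rw [hfin, natDegree_pow, hdeg, hcard, mul_comm v, ← Nat.div_div_eq_div_mul]
    congr 2
    symm
    have : p ^ 4 = p ^ 2 * p ^ 2 := by ring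
    obtain ⟨m, hm⟩ : ∃ m, p ^ 2 = m + 1 := ⟨p ^ 2 - 1, by omega⟩
    rw [this, hm]
    refine Nat.div_eq_of_lt_le ?_ ?_
    · simp only [Nat.add_sub_cancel]
      have : (m + 1) * (m + 1) = m * (m + 1) + (m + 1) := by ring
      omega
    · simp only [Nat.add_sub_cancel]
      have : 0 < (m + 1) * (m + 1) := by positivity
      omega
end

section
/- Let K be a field of characteristic p > 0 and let β ∈ K satisfy β^p ≠ β. Identifying 𝔽_p with the prime subfield of K, the following identity holds in K[x]: ∏_{i ∈ 𝔽_p} ∏_{j ∈ 𝔽_p} (x − i − j·β) = x^{p²} − (1 + (β^p − β)^{p−1})·x^p + (β^p − β)^{p−1}·x. -/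
open Polynomial

theorem aux_prod (p : ℕ) [Fact p.Prime] {A : Type*} [CommRing A] (f : ZMod p →+* A) (y : A) :
    ∏ i : ZMod p, (y - f i) = y ^ p - y := by
  have hp : 1 < p := (Fact.out : p.Prime).one_lt
  have hr := FiniteField.roots_X_pow_card_sub_X (ZMod p)
  rw [ZMod.card] at hr
  have hd : (X ^ p - X : (ZMod p)[X]).natDegree = p :=
    FiniteField.X_pow_card_sub_X_natDegree_eq _ hp
  have hm : (X ^ p - X : (ZMod p)[X]).Monic := by
    apply monic_X_pow_sub
    rw [degree_X]
    exact_mod_cast hp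
  have h := prod_multiset_X_sub_C_of_monic_of_roots_card_eq hm
    (by rw [hr, hd]; simp [ZMod.card])
  rw [hr] at h
  have h2 : ∏ i : ZMod p, (X - C i) = (X ^ p - X : (ZMod p)[X]) := h
  have h3 := congrArg (eval₂ f y) h2
  simpa [eval₂_finset_prod] using h3

theorem aux_prod2 (p : ℕ) [Fact p.Prime] {K : Type*} [Field K] (f : ZMod p →+* K)
    (g : K) (hg : g ≠ 0) (Y : K[X]) :
    ∏ j : ZMod p, (Y - C (f j) * C g) = Y ^ p - C (g ^ (p - 1)) * Y := by
  have hp : p ≠ 0 := (Fact.out : p.Prime).ne_zero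
  have hc : C g * C g⁻¹ = (1 : K[X]) := by rw [← C_mul, mul_inv_cancel₀ hg, C_1]
  have h := aux_prod p (C.comp f) (C g⁻¹ * Y)
  have h1 : ∀ j : ZMod p, Y - C (f j) * C g = C g * (C g⁻¹ * Y - (C.comp f) j) := by
    intro j
    rw [RingHom.comp_apply]
    linear_combination (-Y) * hc
  rw [Finset.prod_congr rfl (fun j _ => h1 j), Finset.prod_mul_distrib, h]
  rw [Finset.prod_const, Finset.card_univ, ZMod.card, mul_sub, ← mul_pow, ← mul_assoc, hc, one_mul]
  obtain ⟨n, rfl⟩ := Nat.exists_eq_succ_of_ne_zero hp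
  simp only [Nat.succ_eq_add_one, Nat.add_sub_cancel, pow_succ, C_pow]
  linear_combination (-(C g ^ n) * Y) * hc

/-- in a field of characteristic `p` with `β^p ≠ β`,
`∏_{i,j ∈ 𝔽_p} (x - i - jβ) = x^{p²} - (1 + (β^p - β)^{p-1})x^p + (β^p - β)^{p-1} x`. -/
theorem stmt_11 (p : ℕ) [Fact p.Prime] (K : Type) [Field K] [CharP K p]
    (β : K) (hβ : β ^ p ≠ β) :
    ∏ i : ZMod p, ∏ j : ZMod p,
        (X - C ((ZMod.castHom (dvd_refl p) K) i) - C ((ZMod.castHom (dvd_refl p) K) j) * C β)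
      = X ^ p ^ 2 - C (1 + (β ^ p - β) ^ (p - 1)) * X ^ p + C ((β ^ p - β) ^ (p - 1)) * X := by
  set f := ZMod.castHom (dvd_refl p) K with hf
  rw [Finset.prod_comm]
  have h1 : ∀ j : ZMod p, ∏ i : ZMod p, (X - C (f i) - C (f j) * C β)
      = (X ^ p - X) - C (f j) * C (β ^ p - β) := by
    intro j
    have h := aux_prod p (C.comp f) (X - C (f j) * C β)
    have hj : C (f j) ^ p = C (f j) := by
      rw [← C_pow, ← map_pow, ZMod.pow_card]
    rw [sub_pow_char, mul_pow, hj] at h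
    simp only [C_sub, C_pow]
    rw [Finset.prod_congr rfl (fun i _ => sub_right_comm _ _ _)]
    refine Eq.trans h ?_
    ring
  rw [Finset.prod_congr rfl (fun j _ => h1 j), aux_prod2 p f _ (sub_ne_zero.2 hβ), sub_pow_char]
  simp only [C_add, C_1]
  ring
end

section
/- Let q be a prime power, n ≥ 1, and let B(x) = a·x^{q^i} + b·x^{q^j} ∈ 𝔽_{q^n}[x], where a, b ∈ 𝔽_{q^n} are nonzero and i > j ≥ 0. Then for every integer m ≥ i there exist an integer s with 0 ≤ s < i, a nonzero element c ∈ 𝔽_{q^n}, and a q-linearized polynomial T ∈ 𝔽_{q^n}[x] such that x^{q^m} = B(T(x)) + c·x^{q^s} in 𝔽_{q^n}[x]. -/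
open Polynomial

theorem IsLinearized.add_monomial' {F : Type*} [Field F] {r : ℕ} {M : F[X]}
    (h : IsLinearized r M) (e : F) (k : ℕ) : IsLinearized r (C e * X ^ r ^ k + M) := by
  obtain ⟨s, a, rfl⟩ := h
  refine ⟨s + k, fun t => (if t = k then e else 0) + (if t < s + 1 then a t else 0), ?_⟩
  simp only [C_add, add_mul, Finset.sum_add_distrib]
  congr 1
  · rw [Finset.sum_eq_single k]
    · simp
    · intro t _ ht
      simp [ht]
    · intro hk
      exact absurd (Finset.mem_range.2 (by omega)) hk
  · rw [← Finset.sum_subset (s₁ := Finset.range (s + 1)) (s₂ := Finset.range (s + k + 1))]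
    · refine Finset.sum_congr rfl fun t ht => ?_
      rw [if_pos (Finset.mem_range.1 ht)]
    · intro t ht
      rw [Finset.mem_range] at *
      omega
    · intro t _ ht
      rw [Finset.mem_range] at ht
      simp [ht]

theorem stmt_12_aux (p l : ℕ) [Fact p.Prime]
    (K : Type) [Field K] [Fintype K] [CharP K p]
    (a b : K) (ha : a ≠ 0) (hb : b ≠ 0)
    (i j : ℕ) (hij : j < i) (m : ℕ) : ∀ d : K, d ≠ 0 →
    ∃ (s : ℕ) (c : K) (T : K[X]), s < i ∧ c ≠ 0 ∧ IsLinearized (p ^ l) T ∧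
      (C d * X ^ (p ^ l) ^ m : K[X]) =
        (C a * X ^ (p ^ l) ^ i + C b * X ^ (p ^ l) ^ j).comp T + C c * X ^ (p ^ l) ^ s := by
  have hp : p ≠ 0 := (Fact.out : p.Prime).ne_zero
  induction m using Nat.strong_induction_on with
  | _ m ih =>
    intro d hd
    by_cases hm : m < i
    · refine ⟨m, d, 0, hm, hd, ⟨0, fun _ => 0, by simp⟩, ?_⟩
      simp [hp]
    · push Not at hm
      obtain ⟨e, he⟩ : ∃ e : K, e ^ (p ^ l) ^ i = d / a := by
        have h := Finite.surjective_of_injective (iterateFrobenius_inj K p (l * i))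
        obtain ⟨e, he⟩ := h (d / a)
        refine ⟨e, ?_⟩
        rw [← he, iterateFrobenius_def, pow_mul]
      have he0 : e ≠ 0 := by
        rintro rfl
        rw [zero_pow (by positivity)] at he
        exact div_ne_zero hd ha he.symm
      obtain ⟨s, c, T, hs, hc, hT, h⟩ := ih (m - i + j) (by omega) (-(b * e ^ (p ^ l) ^ j))
        (neg_ne_zero.2 (mul_ne_zero hb (pow_ne_zero _ he0)))
      refine ⟨s, c, C e * X ^ (p ^ l) ^ (m - i) + T, hs, hc, hT.add_monomial' e _, ?_⟩
      have hadd : ∀ (x y : K[X]) (k : ℕ),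
          (x + y) ^ (p ^ l) ^ k = x ^ (p ^ l) ^ k + y ^ (p ^ l) ^ k := by
        intro x y k
        rw [← pow_mul]
        exact add_pow_char_pow x y p (l * k)
      have h1 : (X ^ (p ^ l) ^ (m - i) : K[X]) ^ (p ^ l) ^ i = X ^ (p ^ l) ^ m := by
        rw [← pow_mul, ← pow_add, Nat.sub_add_cancel hm]
      have h2 : (X ^ (p ^ l) ^ (m - i) : K[X]) ^ (p ^ l) ^ j = X ^ (p ^ l) ^ (m - i + j) := by
        rw [← pow_mul, ← pow_add]
      have h3 : (C a * C e ^ (p ^ l) ^ i : K[X]) = C d := by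
        rw [← C_pow, he, ← C_mul, mul_div_cancel₀ _ ha]
      simp only [add_comp, mul_comp, C_comp, pow_comp, X_comp, C_neg, C_mul, C_pow] at h ⊢
      rw [hadd, hadd, mul_pow, mul_pow, h1, h2]
      linear_combination h - X ^ (p ^ l) ^ m * h3

/-- for `B(x) = a x^{q^i} + b x^{q^j}` with `a, b ≠ 0` and `i > j ≥ 0`, and any
`m ≥ i`, there are `s < i`, `c ≠ 0`, and a `q`-linearized `T` with
`x^{q^m} = B(T(x)) + c x^{q^s}`. -/
theorem stmt_12 (q n : ℕ) (hq : ∃ p l : ℕ, p.Prime ∧ 0 < l ∧ q = p ^ l) (hn : 0 < n)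
    (K : Type) [Field K] [Fintype K] [DecidableEq K]
    (hcard : Fintype.card K = q ^ n)
    (a b : K) (ha : a ≠ 0) (hb : b ≠ 0)
    (i j : ℕ) (hij : j < i)
    (m : ℕ) (hm : i ≤ m) :
    ∃ (s : ℕ) (c : K) (T : K[X]), s < i ∧ c ≠ 0 ∧ IsLinearized q T ∧
      (X ^ q ^ m : K[X]) = (C a * X ^ q ^ i + C b * X ^ q ^ j).comp T + C c * X ^ q ^ s := by
  obtain ⟨p, l, hp, hl, rfl⟩ := hq
  haveI : Fact p.Prime := ⟨hp⟩
  haveI : CharP K p := charP_of_card_eq_prime_pow (f := l * n) (by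
    rw [← pow_mul] at hcard; simpa using hcard)
  obtain ⟨s, c, T, h1, h2, h3, h4⟩ :=
    stmt_12_aux p l K a b ha hb i j hij m 1 one_ne_zero
  exact ⟨s, c, T, h1, h2, h3, by simpa using h4⟩
end

section
/- Let p be a prime, n ≥ 1, q = p^n, and let F ∈ 𝔽_q[x] be an MVSP with #V_F > 2. Then there exist a divisor k of n, a positive divisor v of p^k − 1, an 𝔽_{p^k}-subspace U of 𝔽_q with 1 ∈ U, and elements a, b ∈ 𝔽_q with a ≠ 0 such that V_F = {a·u^v + b : u ∈ U}. -/
open Polynomial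

section MV
variable {K : Type*} [Field K]

lemma mv_root [Finite K] (p : ℕ) [Fact p.Prime] [CharP K p] (h : ℕ) (s : K) :
    ∃ u : K, u ^ p ^ h = s := by
  obtain ⟨u, hu⟩ := (bijective_iterateFrobenius K p h).2 s
  exact ⟨u, by simpa [iterateFrobenius_def] using hu⟩

lemma mv_pth [Finite K] (p : ℕ) [Fact p.Prime] [CharP K p] (f : K[X]) (hf : derivative f = 0) :
    ∃ g : K[X], f = g ^ p := by
  have hp : p ≠ 0 := (Fact.out : p.Prime).ne_zero
  refine ⟨(contract p f).map ((frobeniusEquiv K p).symm : K →+* K), ?_⟩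
  rw [← map_frobenius_expand, map_expand, map_map]
  have : (frobenius K p).comp ((frobeniusEquiv K p).symm : K →+* K) = RingHom.id K := by
    ext x; simp
  rw [this, Polynomial.map_id, expand_contract p hf hp]

lemma mv_pow_inj (p : ℕ) [Fact p.Prime] [CharP K p] (h : ℕ) {f g : K[X]}
    (hfg : f ^ p ^ h = g ^ p ^ h) : f = g := by
  have := iterateFrobenius_inj K[X] p h
  apply this
  simpa [iterateFrobenius_def] using hfg

lemma mv_dvd_deriv {f : K[X]} (h : f ∣ derivative f) : derivative f = 0 := by
  by_contra h0
  have hf : f ≠ 0 := by rintro rfl; simp at h0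
  exact absurd (degree_derivative_lt hf) (not_lt.mpr (degree_le_of_dvd h h0))

lemma mv_factor [Finite K] (p : ℕ) [Fact p.Prime] [CharP K p] (L : K[X])
    (hc : IsCoprime L (derivative L)) (hL : L ≠ 0) (w : ℕ) (hwp : w < p) : ∀ N : K[X],
    derivative N * L = (w : K[X]) * (derivative L * N) → ∃ g : K[X], N = L ^ w * g ^ p := by
  induction w with
  | zero =>
    intro N hN
    have : derivative N = 0 := by simpa [hL] using hN
    obtain ⟨g, hg⟩ := mv_pth p N this
    exact ⟨g, by simpa using hg⟩
  | succ w ih =>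
    intro N hN
    have hw : ((w + 1 : ℕ) : K) ≠ 0 := by
      intro hw
      have hp : p ∣ w + 1 := (CharP.cast_eq_zero_iff K p (w+1)).1 hw
      exact absurd (Nat.le_of_dvd (by omega) hp) (by omega)
    have hu : IsUnit ((w + 1 : ℕ) : K[X]) := by
      rw [← map_natCast (C : K →+* K[X])]
      exact isUnit_C.2 (isUnit_iff_ne_zero.2 hw)
    have hd : L ∣ N := by
      have h1 : L ∣ ((w + 1 : ℕ) : K[X]) * (derivative L * N) := ⟨derivative N, by rw [← hN]; ring⟩
      exact hc.dvd_of_dvd_mul_left ((hu.dvd_mul_left).1 h1)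
    obtain ⟨N1, rfl⟩ := hd
    obtain ⟨g, hg⟩ := ih (by omega) N1 (by
      apply mul_left_cancel₀ hL
      rw [derivative_mul] at hN
      push_cast at hN
      linear_combination hN)
    exact ⟨g, by rw [hg]; ring⟩

/-- coprime factors of a `p^h`-th power -/
lemma mv_split_pow [Finite K] (p : ℕ) [Fact p.Prime] [CharP K p] (h : ℕ) {a b c : K[X]}
    (hab : IsCoprime a b) (he : a * b = c ^ p ^ h) : ∃ d : K[X], a = d ^ p ^ h := by
  obtain ⟨d, hd⟩ := exists_associated_pow_of_mul_eq_pow' hab he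
  obtain ⟨u, hu⟩ := hd
  obtain ⟨x, hx, hx2⟩ := Polynomial.isUnit_iff.1 u.isUnit
  obtain ⟨y, hy⟩ := mv_root p h x
  exact ⟨d * C y, by rw [mul_pow, ← C_pow, hy, hx2, hu]⟩

lemma mv_exists_w (p : ℕ) (hp : p.Prime) (r ρ : ℕ) (hr : ¬ p ∣ r) : ∃ w < p, p ∣ ρ + w * r := by
  have := Fact.mk hp
  have hr' : (r : ZMod p) ≠ 0 := by rwa [Ne, ZMod.natCast_eq_zero_iff]
  refine ⟨(-(ρ : ZMod p) / r).val, ZMod.val_lt _, ?_⟩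
  rw [← ZMod.natCast_eq_zero_iff]
  push_cast
  rw [ZMod.natCast_zmod_val]
  field_simp
  ring

lemma mv_cop_comp (S F : K[X]) (h0 : S.coeff 0 ≠ 0) : IsCoprime F (S.comp F) := by
  have h1 : S = X * divX S + C (S.coeff 0) := (X_mul_divX_add S).symm
  have h2 : S.comp F = F * (divX S).comp F + C (S.coeff 0) := by
    have h3 := congrArg (fun g => g.comp F) h1
    simpa only [add_comp, mul_comp, X_comp, C_comp] using h3
  refine ⟨-(C (S.coeff 0)⁻¹ * (divX S).comp F), C (S.coeff 0)⁻¹, ?_⟩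
  rw [h2]
  have : (C (S.coeff 0)⁻¹ * C (S.coeff 0) : K[X]) = 1 := by rw [← C_mul, inv_mul_cancel₀ h0, C_1]
  linear_combination this
end MV

section MV
variable {K : Type*} [Field K]

structure MvSt (p n : ℕ) (S F L : K[X]) (h v : ℕ) (N B : K[X]) : Prop where
  hh : 1 ≤ h
  hv : 0 < v
  hF : F = L ^ v * N ^ p ^ h
  hL : derivative L = B ^ p ^ h
  cop : IsCoprime L (derivative L)
  Lpos : 0 < L.natDegree
  N0 : N ≠ 0
  eq : L * S.comp F = C (S.coeff 0) * (X - X ^ p ^ n) * derivative L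
  s0 : S.coeff 0 ≠ 0
  rdeg : 0 < S.natDegree
  supp : ∀ j ∈ S.support, (∃ i < h, 1 + v * j = p ^ i) ∨ p ^ h ∣ 1 + v * j
  inv1 : (∃ j ∈ S.support, 0 < j ∧ ∃ i < h, 1 + v * j = p ^ i) → N.natDegree < L.natDegree
  inv2 : (derivative L).natDegree + B.natDegree + N.natDegree < F.natDegree

lemma MvSt.L0 {p n : ℕ} {S F L : K[X]} {h v : ℕ} {N B : K[X]}
    (st : MvSt p n S F L h v N B) : L ≠ 0 := by
  rintro rfl; simpa using st.Lpos

lemma MvSt.L1 {p n : ℕ} {S F L : K[X]} {h v : ℕ} {N B : K[X]}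
    (st : MvSt p n S F L h v N B) : derivative L ≠ 0 := by
  intro h0
  have := st.cop
  rw [h0, isCoprime_zero_right] at this
  have := natDegree_eq_zero_of_isUnit this
  have := st.Lpos
  omega

lemma MvSt.B0 {p n : ℕ} {S F L : K[X]} {h v : ℕ} {N B : K[X]} (hp : p.Prime)
    (st : MvSt p n S F L h v N B) : B ≠ 0 := by
  rintro rfl
  apply st.L1
  rw [st.hL, zero_pow (pow_ne_zero _ hp.ne_zero)]

lemma MvSt.degF {p n : ℕ} {S F L : K[X]} {h v : ℕ} {N B : K[X]}
    (st : MvSt p n S F L h v N B) :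
    F.natDegree = v * L.natDegree + p ^ h * N.natDegree := by
  rw [st.hF, natDegree_mul (pow_ne_zero _ st.L0) (pow_ne_zero _ st.N0), natDegree_pow,
    natDegree_pow]

lemma MvSt.degL {p n : ℕ} {S F L : K[X]} {h v : ℕ} {N B : K[X]}
    (st : MvSt p n S F L h v N B) :
    (derivative L).natDegree = p ^ h * B.natDegree := by
  rw [st.hL, natDegree_pow]

lemma MvSt.copBL {p n : ℕ} {S F L : K[X]} {h v : ℕ} {N B : K[X]} (hp : p.Prime)
    (st : MvSt p n S F L h v N B) : IsCoprime B L := by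
  have := st.cop
  rw [st.hL] at this
  exact ((IsCoprime.pow_right_iff (pow_pos hp.pos _)).1 this).symm

lemma MvSt.copBN {p n : ℕ} {S F L : K[X]} {h v : ℕ} {N B : K[X]} (hp : p.Prime)
    (st : MvSt p n S F L h v N B) : IsCoprime B N := by
  have hpp : p ^ h ≠ 0 := pow_ne_zero _ hp.ne_zero
  have h1 : B ∣ L * S.comp F := by
    rw [st.eq, st.hL]
    exact Dvd.dvd.mul_left (dvd_pow_self _ hpp) _
  have h2 : B ∣ S.comp F := (st.copBL hp).dvd_of_dvd_mul_left h1
  have h3 := mv_cop_comp S F st.s0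
  have h4 : N ∣ F := by rw [st.hF]; exact Dvd.dvd.mul_left (dvd_pow_self _ hpp) _
  exact (h3.of_isCoprime_of_dvd_left h4).symm.of_isCoprime_of_dvd_left h2

lemma natDegree_X_sub_pow {q : ℕ} (hq : 1 < q) : (X - X ^ q : K[X]).natDegree = q := by
  rw [natDegree_sub_eq_right_of_natDegree_lt] <;> simp [hq]

lemma MvSt.degq {p n : ℕ} {S F L : K[X]} {h v : ℕ} {N B : K[X]} (hp : p.Prime) (hn : 0 < n)
    (st : MvSt p n S F L h v N B) :
    L.natDegree + S.natDegree * F.natDegree = p ^ n + (derivative L).natDegree := by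
  have hq : 1 < p ^ n := Nat.one_lt_pow hn.ne' hp.one_lt
  have hX : (X - X ^ p ^ n : K[X]) ≠ 0 := by
    intro h0
    have := natDegree_X_sub_pow (K := K) hq
    rw [h0] at this; simp at this; omega
  have hc : (C (S.coeff 0) : K[X]) ≠ 0 := by simpa using st.s0
  have h1 := congrArg natDegree st.eq
  have hS : S.comp F ≠ 0 := by
    intro h0
    have := st.eq
    rw [h0, mul_zero] at this
    exact mul_ne_zero (mul_ne_zero hc hX) st.L1 this.symm
  rw [natDegree_mul st.L0 hS, natDegree_mul (mul_ne_zero hc hX) st.L1, natDegree_mul hc hX,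
    natDegree_X_sub_pow hq, natDegree_comp, natDegree_C] at h1
  omega

lemma MvSt.h_lt {p n : ℕ} {S F L : K[X]} {h v : ℕ} {N B : K[X]} (hp : p.Prime) (hn : 0 < n)
    (st : MvSt p n S F L h v N B) (hr : p ^ h < 1 + v * S.natDegree) : h < n := by
  have h1 := st.degq hp hn
  have h2 := st.degF
  have h3 := natDegree_derivative_lt (p := L) st.Lpos.ne'
  have h4 : v ≤ F.natDegree := by
    rw [h2]; nlinarith [st.Lpos, Nat.zero_le (p ^ h * N.natDegree)]
  have h5 : v * S.natDegree ≤ S.natDegree * F.natDegree := by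
    rw [mul_comm]; exact Nat.mul_le_mul_left _ h4
  have : p ^ h < p ^ n := by omega
  exact (Nat.pow_lt_pow_iff_right hp.one_lt).1 this

/-- existence of `E`. -/
lemma MvSt.exE [Finite K] {p n : ℕ} {S F L : K[X]} {h v : ℕ} {N B : K[X]} (hp : p.Prime)
    [CharP K p]
    (st : MvSt p n S F L h v N B) (hn : h < n) (js : ℕ)
    (hjs : ∀ j ∈ S.support, ¬ p ^ h ∣ 1 + v * j → j ≤ js) :
    ∃ (c : ℕ → K) (E : K[X]), (∀ j ∈ S.support, c j ≠ 0) ∧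
      derivative E * B - derivative B * E =
        derivative (∑ j ∈ S.support with p ^ h ∣ 1 + v * j,
          C (c j) * (L ^ ((1 + v * j) / p ^ h) * N ^ j)) * B -
        derivative B * (∑ j ∈ S.support with p ^ h ∣ 1 + v * j,
          C (c j) * (L ^ ((1 + v * j) / p ^ h) * N ^ j)) ∧
      2 * E.natDegree ≤ L.natDegree + 2 * (js * N.natDegree) := by
  have : Fact p.Prime := ⟨hp⟩
  choose ψ hψ using fun s : K => mv_root p h s
  set M := ∑ j ∈ S.support with p ^ h ∣ 1 + v * j,
          C (ψ (S.coeff j)) * (L ^ ((1 + v * j) / p ^ h) * N ^ j) with hM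
  obtain ⟨m, rfl⟩ := Nat.exists_eq_add_of_lt hn
  set E := M + C (ψ (S.coeff 0)) * X ^ p ^ (m + 1) * B with hE
  have hpow : p ^ h * p ^ (m + 1) = p ^ (h + m + 1) := by rw [← pow_add]; ring_nf
  have hE1 : E ^ p ^ h = C (S.coeff 0) * X * derivative L -
      ∑ j ∈ S.support with ¬ p ^ h ∣ 1 + v * j, C (S.coeff j) * (L ^ (1 + v * j) * N ^ (p ^ h * j)) := by
    have h1 : L * S.comp F = ∑ j ∈ S.support, C (S.coeff j) * (L ^ (1 + v * j) * N ^ (p ^ h * j)) := by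
      rw [comp_eq_sum_left, Polynomial.sum_def, Finset.mul_sum]
      refine Finset.sum_congr rfl fun j _ => ?_
      rw [st.hF, mul_pow, ← pow_mul, ← pow_mul, pow_add]; ring
    have h2 : M ^ p ^ h = ∑ j ∈ S.support with p ^ h ∣ 1 + v * j,
        C (S.coeff j) * (L ^ (1 + v * j) * N ^ (p ^ h * j)) := by
      rw [hM, sum_pow_char_pow]
      refine Finset.sum_congr rfl fun j hj => ?_
      rw [mul_pow, ← C_pow, hψ, mul_pow, ← pow_mul, ← pow_mul,
        Nat.div_mul_cancel (Finset.mem_filter.1 hj).2, mul_comm j]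
    have h3 : (C (ψ (S.coeff 0)) * X ^ p ^ (m + 1) * B) ^ p ^ h =
        C (S.coeff 0) * X ^ p ^ (h + m + 1) * derivative L := by
      rw [mul_pow, mul_pow, ← C_pow, hψ, ← pow_mul, mul_comm (p ^ (m+1)), hpow, st.hL]
    have h4 := st.eq
    rw [h1, ← Finset.sum_filter_add_sum_filter_not _ (fun j => p ^ h ∣ 1 + v * j)] at h4
    rw [hE, add_pow_char_pow, h2, h3]
    linear_combination h4
  refine ⟨fun j => ψ (S.coeff j), E, ?_, ?_, ?_⟩
  · intro j hj h0
    have := hψ (S.coeff j)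
    simp only at h0
    rw [h0, zero_pow (pow_ne_zero _ hp.ne_zero)] at this
    exact (mem_support_iff.1 hj) this.symm
  · have hd : derivative (X ^ p ^ (m + 1) : K[X]) = 0 := by
      rw [derivative_X_pow, Nat.cast_pow, CharP.cast_eq_zero, zero_pow (by omega), C_0, zero_mul]
    rw [hE]
    simp only [derivative_add, derivative_mul, hd, derivative_C]
    ring
  · have hdeg : p ^ h * E.natDegree ≤ p ^ (h - 1) * L.natDegree + p ^ h * (js * N.natDegree) := by
      rw [← natDegree_pow, hE1]
      refine (natDegree_sub_le _ _).trans (max_le ?_ ?_)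
      · have h3 := natDegree_derivative_lt (p := L) st.Lpos.ne'
        have h4 : (C (S.coeff 0) * X * derivative L).natDegree ≤ L.natDegree := by
          refine natDegree_mul_le.trans ?_
          have : (C (S.coeff 0) * X : K[X]).natDegree ≤ 1 := (natDegree_C_mul_le _ _).trans (by simp)
          omega
        have : L.natDegree ≤ p ^ (h - 1) * L.natDegree := Nat.le_mul_of_pos_left _ (pow_pos hp.pos _)
        omega
      · apply natDegree_sum_le_of_forall_le
        intro j hj
        rw [Finset.mem_filter] at hj
        refine (natDegree_C_mul_le _ _).trans ?_
        refine natDegree_mul_le.trans ?_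
        rw [natDegree_pow, natDegree_pow]
        obtain ⟨i, hi, hij⟩ := (st.supp j hj.1).resolve_right hj.2
        rw [hij, mul_assoc]
        gcongr
        · exact hp.one_lt.le
        · omega
        · exact hjs j hj.1 hj.2
    have hph : p ^ h = p ^ (h - 1) * p := by
      rw [← pow_succ]; congr 1; have := st.hh; omega
    rw [hph, mul_assoc, mul_assoc, ← mul_add] at hdeg
    have h5 := Nat.le_of_mul_le_mul_left hdeg (pow_pos hp.pos _)
    by_contra hcon
    push Not at hcon
    obtain ⟨t, ht⟩ : ∃ t, E.natDegree = js * N.natDegree + t := Nat.exists_eq_add_of_le (by omega)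
    rw [ht, mul_add] at h5
    have h6 : 2 * t ≤ p * t := Nat.mul_le_mul_right _ hp.two_le
    omega

end MV

section MV
variable {K : Type*} [Field K]

lemma mv_gap {p : ℕ} (hp : p.Prime) {h v i j ei ej : ℕ} (hh : 1 ≤ h) (hv : 0 < v) (hij : i < j)
    (hi : p ^ h * ei = 1 + v * i) (hj : p ^ h * ej = 1 + v * j) :
    ∃ t, 1 ≤ t ∧ j = i + p ^ h * t ∧ ej = ei + v * t := by
  obtain ⟨m, rfl⟩ := Nat.exists_eq_add_of_lt hij
  have hcop : Nat.Coprime (p ^ h) v := by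
    apply Nat.Coprime.pow_left
    rw [hp.coprime_iff_not_dvd]
    intro hpv
    have h1 : p ∣ 1 + v * i := by
      rw [← hi]; exact Dvd.dvd.mul_right (dvd_pow_self _ (by omega)) _
    have h2 : p ∣ 1 := (Nat.dvd_add_left (Dvd.dvd.mul_right hpv i)).1 h1
    exact hp.one_lt.ne' (Nat.dvd_one.1 h2)
  have h3 : p ^ h * ej = p ^ h * ei + v * (m + 1) := by rw [hi, hj]; ring
  have h4 : p ^ h ∣ v * (m + 1) := (Nat.dvd_add_right (dvd_mul_right _ ei)).1 ⟨ej, h3.symm⟩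
  obtain ⟨t, ht⟩ := hcop.dvd_of_dvd_mul_left h4
  refine ⟨t, ?_, by omega, ?_⟩
  · rcases Nat.eq_zero_or_pos t with rfl | h'
    · simp at ht
    · exact h'
  · rw [ht] at h3
    apply Nat.eq_of_mul_eq_mul_left (pow_pos hp.pos h)
    rw [h3]; ring

/-- The derivative identity. -/
lemma mv_deriv_sum (J : Finset ℕ) (e : ℕ → ℕ) (c : ℕ → K) (r : K) (ρ : K) (L N B : K[X])
    (he : ∀ j ∈ J, 1 ≤ e j) (hj : ∀ j ∈ J, 1 ≤ j) (hr : ∀ j ∈ J, (j : K) = r) :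
    derivative (∑ j ∈ J, C (c j) * (L ^ e j * N ^ j)) * B -
      derivative B * ∑ j ∈ J, C (c j) * (L ^ e j * N ^ j) =
    ∑ j ∈ J, C (c j) * (L ^ (e j - 1) * N ^ (j - 1)) *
      ((C ρ * (derivative L * N * B) + C r * (derivative N * L * B) - derivative B * L * N)
        + C ((e j : K) - ρ) * (derivative L * N * B)) := by
  rw [derivative_sum, Finset.sum_mul, Finset.mul_sum, ← Finset.sum_sub_distrib]
  refine Finset.sum_congr rfl fun j hjJ => ?_
  have h1 := he j hjJ
  have h2 := hj j hjJ
  rw [← hr j hjJ]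
  obtain ⟨a, ha⟩ := Nat.exists_eq_add_of_le' h1
  obtain ⟨b, rfl⟩ := Nat.exists_eq_add_of_le' h2
  rw [ha]
  simp only [derivative_mul, derivative_C, derivative_pow, Nat.add_sub_cancel, C_sub]
  ring

/-- degree lemma 1 -/
lemma mv_degP (J : Finset ℕ) (r : ℕ) (hrJ : r ∈ J) (D : ℕ → K[X]) (z : ℕ → K) (P Y R : K[X])
    (d : ℕ) (hD : D r ≠ 0) (hz : z r = 0) (hY : Y.natDegree < d)
    (hR : R.natDegree < (D r).natDegree)
    (hgap : ∀ j ∈ J, j ≠ r → (D j).natDegree + d ≤ (D r).natDegree)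
    (heq : ∑ j ∈ J, D j * (P + C (z j) * Y) = R) : P = 0 := by
  by_contra hP
  rw [← Finset.add_sum_erase _ _ hrJ, hz, C_0, zero_mul, add_zero] at heq
  have h1 : D r * P = R - ∑ j ∈ J.erase r, D j * (P + C (z j) * Y) := by
    rw [← heq]; ring
  have h2 : (D r * P).natDegree = (D r).natDegree + P.natDegree := natDegree_mul hD hP
  have h3 : (D r * P).natDegree ≤ (D r).natDegree + P.natDegree - 1 := by
    rw [h1]
    refine (natDegree_sub_le _ _).trans (max_le (by omega) ?_)
    apply natDegree_sum_le_of_forall_le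
    intro j hj
    rw [Finset.mem_erase] at hj
    have h4 := hgap j hj.2 hj.1
    refine natDegree_mul_le.trans ?_
    have h5 : (P + C (z j) * Y).natDegree ≤ max P.natDegree Y.natDegree :=
      (natDegree_add_le _ _).trans (max_le_max le_rfl (natDegree_C_mul_le _ _))
    rcases max_choice P.natDegree Y.natDegree with h | h <;> rw [h] at h5 <;> omega
  omega

/-- degree lemma 2 -/
lemma mv_degTop (J : Finset ℕ) (D : ℕ → K[X]) (R : K[X]) (m : ℕ) (hm : m ∈ J)
    (hD : D m ≠ 0)
    (hgap : ∀ j ∈ J, j ≠ m → (D j).natDegree < (D m).natDegree)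
    (heq : ∑ j ∈ J, D j = R) : (D m).natDegree ≤ R.natDegree := by
  by_contra hcon
  push Not at hcon
  rw [← Finset.add_sum_erase _ _ hm] at heq
  have h1 : D m = R - ∑ j ∈ J.erase m, D j := by rw [← heq]; ring
  have h3 : (D m).natDegree ≤ (D m).natDegree - 1 := by
    conv_lhs => rw [h1]
    refine (natDegree_sub_le _ _).trans (max_le (by omega) ?_)
    apply natDegree_sum_le_of_forall_le
    intro j hj
    rw [Finset.mem_erase] at hj
    have := hgap j hj.2 hj.1
    omega
  omega

lemma MvSt.step [Finite K] {p n : ℕ} {S F L : K[X]} {h v : ℕ} {N B : K[X]} (hp : p.Prime)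
    [CharP K p] (hn : 0 < n)
    (st : MvSt p n S F L h v N B) (hr : p ^ h < 1 + v * S.natDegree) :
    ∃ v' N' B', MvSt p n S F L (h + 1) v' N' B' := by
  have : Fact p.Prime := ⟨hp⟩
  have hhn := st.h_lt hp hn hr
  have hh := st.hh
  have hv := st.hv
  set r := S.natDegree with hrdef
  have hS0 : S ≠ 0 := by rintro rfl; simpa using st.s0
  have hrS : r ∈ S.support := natDegree_mem_support_of_nonzero hS0
  have hle : ∀ j ∈ S.support, j ≤ r := fun j hj => le_natDegree_of_mem_supp j hj
  set J := S.support.filter (fun j => p ^ h ∣ 1 + v * j) with hJ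
  set e : ℕ → ℕ := fun j => (1 + v * j) / p ^ h with he
  have hpe : ∀ j ∈ J, p ^ h * e j = 1 + v * j := fun j hj =>
    Nat.mul_div_cancel' (Finset.mem_filter.1 hj).2
  have hrJ : r ∈ J := by
    rw [hJ, Finset.mem_filter]
    refine ⟨hrS, (st.supp r hrS).resolve_left ?_⟩
    rintro ⟨i, hi, hir⟩
    rw [hir] at hr
    exact absurd ((Nat.pow_lt_pow_iff_right hp.one_lt).1 hr) (by omega)
  have h0S : 0 ∈ S.support := mem_support_iff.2 st.s0
  have hph1 : 1 < p ^ h := Nat.one_lt_pow (by omega) hp.one_lt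
  have h0J : ¬ p ^ h ∣ 1 + v * 0 := by
    intro hd
    have := Nat.le_of_dvd (by omega) hd
    omega
  -- js
  set sm := S.support.filter (fun j => ¬ p ^ h ∣ 1 + v * j) with hsm
  have hsmne : sm.Nonempty := ⟨0, by rw [hsm, Finset.mem_filter]; exact ⟨h0S, h0J⟩⟩
  obtain ⟨js, hjsm, hjsmax⟩ := Finset.exists_max_image sm id hsmne
  simp only [id] at hjsmax
  have hjslt : ∀ j ∈ J, js < j := by
    intro j hj
    rw [hsm, Finset.mem_filter] at hjsm
    obtain ⟨i, hi, hij⟩ := (st.supp js hjsm.1).resolve_right hjsm.2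
    have h1 : p ^ i < p ^ h := (Nat.pow_lt_pow_iff_right hp.one_lt).2 hi
    have h2 := Nat.le_of_dvd (by omega) (Finset.mem_filter.1 hj).2
    have h3 : v * js < v * j := by omega
    exact Nat.lt_of_mul_lt_mul_left h3
  obtain ⟨c, E, hc, hE, hEdeg⟩ := st.exE hp hhn js (fun j hj hnd =>
    hjsmax j (by rw [hsm, Finset.mem_filter]; exact ⟨hj, hnd⟩))
  have hj1 : ∀ j ∈ J, 1 ≤ j := fun j hj => by have := hjslt j hj; omega
  have he1 : ∀ j ∈ J, 1 ≤ e j := fun j hj => by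
    have := hpe j hj
    rcases Nat.eq_zero_or_pos (e j) with h0 | h0
    · rw [h0] at this; omega
    · exact h0
  have hgap : ∀ i ∈ J, ∀ j ∈ J, i < j → ∃ t, 1 ≤ t ∧ j = i + p ^ h * t ∧ e j = e i + v * t :=
    fun i hi j hj hij => mv_gap hp hh hv hij (hpe i hi) (hpe j hj)
  have hcast0 : ((p ^ h : ℕ) : K) = 0 := by
    rw [Nat.cast_pow, CharP.cast_eq_zero, zero_pow (by omega)]
  have hjr : ∀ j ∈ J, (j : K) = (r : K) := by
    intro j hj
    rcases (hle j (Finset.mem_filter.1 hj).1).lt_or_eq with h1 | h1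
    · obtain ⟨t, _, h3, _⟩ := hgap j hj r hrJ h1
      rw [h3, Nat.cast_add, Nat.cast_mul, hcast0]; ring
    · rw [h1]
  rw [mv_deriv_sum J e c r (e r : K) L N B he1 hj1 hjr] at hE
  set Y := derivative L * N * B with hY
  set P := C (e r : K) * Y + C (r : K) * (derivative N * L * B) - derivative B * L * N with hP
  have hL0 := st.L0
  have hN0 := st.N0
  have hB0 := st.B0 hp
  have hL1 := st.L1
  have hdF := st.degF
  have hdL := st.degL
  have hlt := natDegree_derivative_lt (p := L) st.Lpos.ne'
  have hD0 : ∀ j ∈ J, C (c j) * (L ^ (e j - 1) * N ^ (j - 1)) ≠ 0 := fun j hj =>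
    mul_ne_zero (by simpa using hc j (Finset.mem_filter.1 hj).1)
      (mul_ne_zero (pow_ne_zero _ hL0) (pow_ne_zero _ hN0))
  have hDdeg : ∀ j ∈ J, (C (c j) * (L ^ (e j - 1) * N ^ (j - 1))).natDegree =
      (e j - 1) * L.natDegree + (j - 1) * N.natDegree := fun j hj => by
    rw [natDegree_C_mul (hc j (Finset.mem_filter.1 hj).1),
      natDegree_mul (pow_ne_zero _ hL0) (pow_ne_zero _ hN0), natDegree_pow, natDegree_pow]
  have her2 : 2 ≤ e r := by
    have h1 := hpe r hrJ
    rw [← h1] at hr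
    by_contra h2
    have h3 : e r = 1 := by have := he1 r hrJ; omega
    rw [h3] at hr; omega
  have h2b : 2 * B.natDegree < L.natDegree := by
    have : 2 * B.natDegree ≤ p ^ h * B.natDegree := Nat.mul_le_mul_right _ hph1
    omega
  have hP0 : P = 0 := by
    refine mv_degP J r hrJ (fun j => C (c j) * (L ^ (e j - 1) * N ^ (j - 1)))
      (fun j => (e j : K) - e r) P Y (derivative E * B - derivative B * E) F.natDegree
      (hD0 r hrJ) (by simp) ?_ ?_ ?_ hE.symm
    · refine lt_of_le_of_lt ?_ st.inv2
      refine natDegree_mul_le.trans ?_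
      have : (derivative L * N).natDegree ≤ _ := natDegree_mul_le
      omega
    · rw [hDdeg r hrJ]
      have h1 : (derivative E * B - derivative B * E).natDegree ≤ E.natDegree + B.natDegree := by
        refine (natDegree_sub_le _ _).trans (max_le ?_ ?_)
        · refine natDegree_mul_le.trans ?_
          have := natDegree_derivative_le E
          omega
        · refine natDegree_mul_le.trans ?_
          have := natDegree_derivative_le B
          omega
      have h2 : L.natDegree ≤ (e r - 1) * L.natDegree := Nat.le_mul_of_pos_left _ (by omega)
      have h3 : js * N.natDegree ≤ (r - 1) * N.natDegree :=
        Nat.mul_le_mul_right _ (by have := hjslt r hrJ; omega)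
      omega
    · intro j hj hne
      obtain ⟨t, ht, h3, h4⟩ := hgap j hj r hrJ
        (lt_of_le_of_ne (hle j (Finset.mem_filter.1 hj).1) hne)
      rw [hDdeg r hrJ, hDdeg j hj, hdF]
      have h5 : e r - 1 = (e j - 1) + v * t := by have := he1 j hj; omega
      have h6 : r - 1 = (j - 1) + p ^ h * t := by have := hj1 j hj; omega
      rw [h5, h6]
      have h7 : v * L.natDegree ≤ v * t * L.natDegree :=
        Nat.mul_le_mul_right _ (Nat.le_mul_of_pos_right _ ht)
      have h8 : p ^ h * N.natDegree ≤ p ^ h * t * N.natDegree :=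
        Nat.mul_le_mul_right _ (Nat.le_mul_of_pos_right _ ht)
      rw [add_mul, add_mul]
      omega
  -- B' = 0
  have hBd : derivative B = 0 := by
    apply mv_dvd_deriv
    have h1 : B ∣ derivative B * L * N :=
      ⟨C (e r : K) * (derivative L * N) + C (r : K) * (derivative N * L), by
        rw [hP, hY] at hP0; linear_combination -hP0⟩
    exact (st.copBL hp).dvd_of_dvd_mul_right ((st.copBN hp).dvd_of_dvd_mul_right h1)
  have hrel : C (e r : K) * (derivative L * N) + C (r : K) * (derivative N * L) = 0 := by
    apply mul_right_cancel₀ hB0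
    rw [hP, hY, hBd] at hP0
    linear_combination hP0
  have hE2 : ∑ j ∈ J, C ((e j : K) - e r) * (C (c j) * (L ^ (e j - 1) * N ^ j) * derivative L)
      = derivative E := by
    apply mul_right_cancel₀ hB0
    rw [hBd, hP0] at hE
    rw [zero_mul, sub_zero] at hE
    rw [hE, Finset.sum_mul]
    refine Finset.sum_congr rfl fun j hj => ?_
    obtain ⟨b, hb⟩ := Nat.exists_eq_add_of_le' (hj1 j hj)
    rw [hY, hb, Nat.add_sub_cancel]
    ring
  -- bad set
  have hbad : ∀ j ∈ J, (e j : K) ≠ (e r : K) → e j = 1 ∧ N.natDegree < L.natDegree := by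
    classical
    set bad := J.filter (fun j => (e j : K) ≠ (e r : K)) with hbaddef
    have key : ∀ m ∈ bad, (∀ j ∈ bad, j ≤ m) → e m = 1 ∧ N.natDegree < L.natDegree := by
      intro m hm hmax
      have hmJ : m ∈ J := (Finset.mem_filter.1 hm).1
      have hsum : ∑ j ∈ bad, C ((e j : K) - e r) *
          (C (c j) * (L ^ (e j - 1) * N ^ j) * derivative L) = derivative E := by
        rw [← hE2, hbaddef]
        apply Finset.sum_filter_of_ne
        intro j _ hne h0
        apply hne
        rw [h0, sub_self, C_0, zero_mul]
      have hdeg : ∀ j ∈ bad, (C ((e j : K) - e r) *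
          (C (c j) * (L ^ (e j - 1) * N ^ j) * derivative L)).natDegree =
          (e j - 1) * L.natDegree + j * N.natDegree + (derivative L).natDegree := by
        intro j hj
        obtain ⟨hjJ, hjne⟩ := Finset.mem_filter.1 hj
        have hcj := hc j (Finset.mem_filter.1 hjJ).1
        rw [natDegree_C_mul (sub_ne_zero.2 hjne), natDegree_mul _ hL1, natDegree_C_mul hcj,
          natDegree_mul (pow_ne_zero _ hL0) (pow_ne_zero _ hN0), natDegree_pow, natDegree_pow]
        exact mul_ne_zero (by simpa using hcj) (mul_ne_zero (pow_ne_zero _ hL0) (pow_ne_zero _ hN0))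
      have hcm := hc m (Finset.mem_filter.1 hmJ).1
      have h1 := mv_degTop bad _ (derivative E) m hm
        (mul_ne_zero (C_ne_zero.2 (sub_ne_zero.2 (Finset.mem_filter.1 hm).2))
          (mul_ne_zero (mul_ne_zero (by simpa using hcm)
            (mul_ne_zero (pow_ne_zero _ hL0) (pow_ne_zero _ hN0))) hL1)) (by
          intro j hj hne
          rw [hdeg j hj, hdeg m hm]
          obtain ⟨t, ht, h3, h4⟩ := hgap j (Finset.mem_filter.1 hj).1 m hmJ
            (lt_of_le_of_ne (hmax j hj) hne)
          have h5 : e m - 1 = (e j - 1) + v * t := by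
            have := he1 j (Finset.mem_filter.1 hj).1; omega
          rw [h5, add_mul]
          have h6 : 0 < v * t * L.natDegree := Nat.mul_pos (Nat.mul_pos hv ht) st.Lpos
          have h7 : j * N.natDegree ≤ m * N.natDegree := Nat.mul_le_mul_right _ (hmax j hj)
          omega) hsum
      rw [hdeg m hm] at h1
      have h2 := natDegree_derivative_le E
      have h3 : js * N.natDegree + N.natDegree ≤ m * N.natDegree := by
        rw [← Nat.succ_mul]; exact Nat.mul_le_mul_right _ (hjslt m hmJ)
      have hLp := st.Lpos
      constructor
      · by_contra h4
        have h5 : L.natDegree ≤ (e m - 1) * L.natDegree :=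
          Nat.le_mul_of_pos_left _ (by have := he1 m hmJ; omega)
        omega
      · omega
    intro j hj hne
    have hjb : j ∈ bad := Finset.mem_filter.2 ⟨hj, hne⟩
    obtain ⟨m, hm, hmax⟩ := Finset.exists_max_image bad id ⟨j, hjb⟩
    obtain ⟨h1, h2⟩ := key m hm hmax
    refine ⟨?_, h2⟩
    rcases (hmax j hjb).lt_or_eq with h3 | h3
    · obtain ⟨t, ht, h4, h5⟩ := hgap j hj m (Finset.mem_filter.1 hm).1 h3
      have := he1 j hj
      have := Nat.mul_pos hv ht
      omega
    · simp only [id] at h3; rw [h3]; exact h1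
  have hpr : ¬ p ∣ r := by
    intro hd
    have h1 : p ∣ 1 + v * r := by
      rw [← hpe r hrJ]; exact Dvd.dvd.mul_right (dvd_pow_self _ (by omega)) _
    have h2 : p ∣ 1 := (Nat.dvd_add_left (Dvd.dvd.mul_left hd v)).1 h1
    exact hp.one_lt.ne' (Nat.dvd_one.1 h2)
  have hrK : (r : K) ≠ 0 := by rwa [Ne, CharP.cast_eq_zero_iff K p]
  obtain ⟨B2, hB2⟩ := mv_pth p B hBd
  have hL2 : derivative L = B2 ^ p ^ (h + 1) := by
    rw [st.hL, hB2, ← pow_mul, pow_succ']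
  have hB2deg : B2.natDegree ≤ B.natDegree := by
    rw [hB2, natDegree_pow]; exact Nat.le_mul_of_pos_left _ hp.pos
  by_cases hNL : N.natDegree < L.natDegree
  · have her0 : (e r : K) = 0 := by
      by_contra hne
      have h1 : L ∣ C (e r : K) * (derivative L * N) :=
        ⟨-(C (r : K) * derivative N), by linear_combination hrel⟩
      have h2 : L ∣ derivative L * N :=
        ((isUnit_C.2 (isUnit_iff_ne_zero.2 hne)).dvd_mul_left).1 h1
      have h3 := natDegree_le_of_dvd (st.cop.dvd_of_dvd_mul_left h2) hN0
      omega
    have hN1 : derivative N = 0 := by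
      rw [her0, C_0, zero_mul, zero_add] at hrel
      have h1 : (C (r : K) : K[X]) ≠ 0 := C_ne_zero.2 hrK
      rcases mul_eq_zero.1 hrel with h2 | h2
      · exact absurd h2 h1
      · exact (mul_eq_zero.1 h2).resolve_right hL0
    obtain ⟨N2, hN2⟩ := mv_pth p N hN1
    have hN2deg : N2.natDegree ≤ N.natDegree := by
      rw [hN2, natDegree_pow]; exact Nat.le_mul_of_pos_left _ hp.pos
    refine ⟨v, N2, B2, ?_⟩
    exact {
      hh := by omega
      hv := hv
      hF := by rw [st.hF, hN2, ← pow_mul, pow_succ']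
      hL := hL2
      cop := st.cop
      Lpos := st.Lpos
      N0 := by rintro rfl; rw [zero_pow hp.ne_zero] at hN2; exact hN0 hN2
      eq := st.eq
      s0 := st.s0
      rdeg := st.rdeg
      supp := by
        intro j hj
        by_cases hjJ : p ^ h ∣ 1 + v * j
        · have hjJ' : j ∈ J := Finset.mem_filter.2 ⟨hj, hjJ⟩
          by_cases hjb : (e j : K) = (e r : K)
          · right
            rw [her0, CharP.cast_eq_zero_iff K p] at hjb
            rw [← hpe j hjJ', pow_succ]
            exact Nat.mul_dvd_mul_left _ hjb
          · left
            refine ⟨h, by omega, ?_⟩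
            rw [← hpe j hjJ', (hbad j hjJ' hjb).1, mul_one]
        · obtain ⟨i, hi, hij⟩ := (st.supp j hj).resolve_right hjJ
          exact Or.inl ⟨i, by omega, hij⟩
      inv1 := fun _ => by omega
      inv2 := by have := st.inv2; omega }
  · have hallbig : ∀ j ∈ S.support, 0 < j → j ∈ J := by
      intro j hj hj0
      rw [hJ, Finset.mem_filter]
      refine ⟨hj, (st.supp j hj).resolve_left fun hex => hNL (st.inv1 ⟨j, hj, hj0, hex⟩)⟩
    have hall : ∀ j ∈ J, (e j : K) = (e r : K) := by
      intro j hj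
      by_contra hne
      exact hNL (hbad j hj hne).2
    obtain ⟨w, hwp, hw⟩ := mv_exists_w p hp r (e r) hpr
    have hwK : (e r : K) + w * r = 0 := by
      have := (CharP.cast_eq_zero_iff K p _).2 hw
      exact_mod_cast this
    obtain ⟨N2, hN2⟩ := mv_factor p L st.cop hL0 w hwp N (by
      have h1 : (C (r : K) : K[X]) ≠ 0 := C_ne_zero.2 hrK
      apply mul_left_cancel₀ h1
      have h2 : (C (e r : K) + (w : K[X]) * C (r : K) : K[X]) = 0 := by
        rw [← C_0, ← hwK]; simp
      linear_combination hrel - derivative L * N * h2)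
    have hN20 : N2 ≠ 0 := by
      rintro rfl; rw [zero_pow hp.ne_zero, mul_zero] at hN2; exact hN0 hN2
    have hN2deg : N2.natDegree ≤ N.natDegree := by
      rw [hN2, natDegree_mul (pow_ne_zero _ hL0) (pow_ne_zero _ hN20), natDegree_pow,
        natDegree_pow]
      have : N2.natDegree ≤ p * N2.natDegree := Nat.le_mul_of_pos_left _ hp.pos
      omega
    have hbig' : ∀ j ∈ S.support, 0 < j → p ^ (h + 1) ∣ 1 + (v + p ^ h * w) * j := by
      intro j hj hj0
      have hjJ := hallbig j hj hj0
      have h1 : 1 + (v + p ^ h * w) * j = p ^ h * (e j + w * j) := by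
        rw [mul_add, hpe j hjJ]; ring
      rw [h1, pow_succ]
      apply Nat.mul_dvd_mul_left
      rw [← CharP.cast_eq_zero_iff K p]
      push_cast
      rw [hall j hjJ, hjr j hjJ, hwK]
    refine ⟨v + p ^ h * w, N2, B2, ?_⟩
    exact {
      hh := by omega
      hv := by omega
      hF := by
        rw [st.hF]
        conv_lhs => rw [hN2]
        rw [mul_pow, ← pow_mul, ← pow_mul, pow_succ', pow_add, mul_comm w]
        ring
      hL := hL2
      cop := st.cop
      Lpos := st.Lpos
      N0 := hN20
      eq := st.eq
      s0 := st.s0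
      rdeg := st.rdeg
      supp := by
        intro j hj
        rcases Nat.eq_zero_or_pos j with rfl | hj0
        · exact Or.inl ⟨0, by omega, by simp⟩
        · exact Or.inr (hbig' j hj hj0)
      inv1 := by
        rintro ⟨j, hj, hj0, i, hi, hij⟩
        have h1 := hbig' j hj hj0
        rw [hij] at h1
        exact absurd ((Nat.pow_dvd_pow_iff_le_right hp.one_lt).1 h1) (by omega)
      inv2 := by have := st.inv2; omega }

lemma MvSt.final [Finite K] {p n : ℕ} {S F L : K[X]} (hp : p.Prime)
    [CharP K p] (hn : 0 < n) (m : ℕ) : ∀ {h v : ℕ} {N B : K[X]},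
    MvSt p n S F L h v N B → n ≤ h + m →
    ∃ v, 0 < v ∧ ∀ j ∈ S.support, ∃ i, 1 + v * j = p ^ i := by
  have base : ∀ {h v : ℕ} {N B : K[X]}, MvSt p n S F L h v N B →
      1 + v * S.natDegree ≤ p ^ h → ∃ v, 0 < v ∧ ∀ j ∈ S.support, ∃ i, 1 + v * j = p ^ i := by
    intro h v N B st hle
    refine ⟨v, st.hv, fun j hj => ?_⟩
    rcases st.supp j hj with ⟨i, _, hi⟩ | hd
    · exact ⟨i, hi⟩
    · refine ⟨h, le_antisymm ?_ (Nat.le_of_dvd (by omega) hd)⟩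
      have := Nat.mul_le_mul_left v (le_natDegree_of_mem_supp j hj)
      omega
  induction m with
  | zero =>
    intro h v N B st hnm
    apply base st
    by_contra hcon
    have := st.h_lt hp hn (not_le.1 hcon)
    omega
  | succ m ih =>
    intro h v N B st hnm
    by_cases hc : 1 + v * S.natDegree ≤ p ^ h
    · exact base st hc
    · obtain ⟨v', N', B', st'⟩ := st.step hp hn (not_le.1 hc)
      exact ih st' (by omega)
end MV

section MV
variable {K : Type*} [Field K]

lemma mv_deriv_Xsub (p n : ℕ) [CharP K p] (hn : 0 < n) :
    derivative (X ^ p ^ n - X : K[X]) = -1 := by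
  rw [derivative_sub, derivative_X_pow, Nat.cast_pow, CharP.cast_eq_zero, zero_pow (by omega), C_0,
    zero_mul, derivative_X]; ring

lemma mv_base2 [Fintype K] (p n : ℕ) (hp : p.Prime) [CharP K p] (hn : 0 < n)
    (hcard : Fintype.card K = p ^ n) (S F : K[X]) (r : ℕ) (hr : (r : K) ≠ 0)
    (s0 : S.coeff 0 ≠ 0) (hF1 : derivative F ≠ 0) (a : K) (ha : F.eval a = 0)
    (hSF : F * S.comp F = C (r * S.coeff 0) * (X ^ p ^ n - X) * derivative F)
    (hS : X * derivative S = C (r : K) * S - C (r * S.coeff 0)) :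
    ∃ (L N : K[X]) (w : ℕ), 0 < w ∧ w < p ∧ p ∣ 1 + w * r ∧ F = L ^ w * N ^ p ∧
      IsCoprime L (derivative L) ∧ 0 < L.natDegree ∧ N ≠ 0 ∧
      L * S.comp F = C (S.coeff 0) * (X - X ^ p ^ n) * derivative L ∧
      derivative (derivative L) = 0 := by
  classical
  have := Fact.mk hp
  have hF0 : F ≠ 0 := by rintro rfl; simp at hF1
  set G : K[X] := X ^ p ^ n - X with hG
  have hGd : derivative G = -1 := mv_deriv_Xsub p n hn
  have hG0 : G ≠ 0 := by
    intro h0; rw [h0, derivative_zero] at hGd; simp at hGd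
  set c : K := r * S.coeff 0 with hc
  have hc0 : c ≠ 0 := mul_ne_zero hr s0
  have hC0 : (C c : K[X]) ≠ 0 := C_ne_zero.2 hc0
  obtain ⟨M, hM⟩ := EuclideanDomain.gcd_dvd_left F G
  obtain ⟨A, hA⟩ := EuclideanDomain.gcd_dvd_right F G
  have hbez := EuclideanDomain.gcd_eq_gcd_ab F G
  have hLa : (X - C a) ∣ EuclideanDomain.gcd F G := by
    apply EuclideanDomain.dvd_gcd
    · exact dvd_iff_isRoot.2 ha
    · apply dvd_iff_isRoot.2
      rw [IsRoot.def, hG, eval_sub, eval_pow, eval_X, ← hcard, FiniteField.pow_card, sub_self]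
  generalize EuclideanDomain.gcd F G = L at *
  generalize EuclideanDomain.gcdA F G = x at *
  generalize EuclideanDomain.gcdB F G = y at *
  have hL0 : L ≠ 0 := by rintro rfl; rw [zero_mul] at hM; exact hF0 hM
  have hA0 : A ≠ 0 := by rintro rfl; rw [mul_zero] at hA; exact hG0 hA
  have hLpos : 0 < L.natDegree := by
    have := natDegree_le_of_dvd hLa hL0
    rw [natDegree_X_sub_C] at this; omega
  have hAL : derivative A * L + A * derivative L = -1 := by
    rw [← hGd, hA, derivative_mul]; ring
  have hcLL : IsCoprime L (derivative L) := ⟨-derivative A, -A, by linear_combination -hAL⟩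
  have hcMA : IsCoprime M A := by
    refine ⟨x, y, mul_left_cancel₀ hL0 ?_⟩
    rw [hM, hA] at hbez
    linear_combination -hbez
  have h1 : M * S.comp F = C c * A * derivative F := by
    apply mul_left_cancel₀ hL0
    linear_combination hSF - S.comp F * hM + C c * derivative F * hA
  have h2 : M ∣ derivative F := by
    have h3 : M ∣ A * (C c * derivative F) := ⟨S.comp F, by linear_combination -h1⟩
    have h4 := hcMA.dvd_of_dvd_mul_left h3
    exact ((isUnit_C.2 (isUnit_iff_ne_zero.2 hc0)).dvd_mul_left).1 h4
  obtain ⟨Φ, hΦ⟩ := h2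
  have hM0 : M ≠ 0 := by rintro rfl; rw [mul_zero] at hM; exact hF0 hM
  have hΦ0 : Φ ≠ 0 := by rintro rfl; rw [mul_zero] at hΦ; exact hF1 hΦ
  have h3 : S.comp F = C c * A * Φ := by
    apply mul_left_cancel₀ hM0
    rw [h1, hΦ]; ring
  have h4 : L * derivative F = F * Φ := by rw [hΦ]; linear_combination -Φ * hM
  have h5 : F * (derivative S).comp F = C (r : K) * S.comp F - C c := by
    have := congrArg (fun g => g.comp F) hS
    simpa only [mul_comp, X_comp, sub_comp, C_comp] using this
  have h6 : L * derivative (S.comp F) = Φ * (C (r : K) * S.comp F - C c) := by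
    rw [derivative_comp]
    linear_combination (derivative S).comp F * h4 + Φ * h5
  have h7 : L * derivative Φ = Φ * (derivative L + C (r : K) * Φ) := by
    rw [h3] at h6
    simp only [derivative_mul, derivative_C] at h6
    apply mul_left_cancel₀ (mul_ne_zero hC0 hA0)
    linear_combination h6 - C c * Φ * hAL
  have hcop : IsCoprime Φ L := by
    have h8 := mv_cop_comp S F s0
    have h9 : L ∣ F := ⟨M, hM⟩
    have h10 : Φ ∣ S.comp F := ⟨C c * A, by rw [h3]; ring⟩
    exact (h8.of_isCoprime_of_dvd_left h9).symm.of_isCoprime_of_dvd_left h10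
  have hΦd : derivative Φ = 0 :=
    mv_dvd_deriv (hcop.dvd_of_dvd_mul_left ⟨_, h7⟩)
  have hLd : derivative L = - (C (r : K) * Φ) := by
    rw [hΦd, mul_zero] at h7
    have := (mul_eq_zero.1 h7.symm).resolve_left hΦ0
    linear_combination this
  have hpr : ¬ p ∣ r := by rwa [← CharP.cast_eq_zero_iff K p]
  obtain ⟨w, hwp, hw⟩ := mv_exists_w p hp r 1 hpr
  have hw0 : 0 < w := by
    rcases Nat.eq_zero_or_pos w with h0 | h0
    · rw [h0] at hw; simp at hw; exact absurd hw hp.one_lt.ne'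
    · exact h0
  have hwK : (1 : K) + w * r = 0 := by
    have := (CharP.cast_eq_zero_iff K p _).2 hw
    exact_mod_cast this
  have hwP : (1 + (w : K[X]) * C (r : K) : K[X]) = 0 := by
    rw [← C_0, ← hwK]; simp
  obtain ⟨N, hN⟩ := mv_factor p L hcLL hL0 w hwp F (by
    rw [hLd]
    linear_combination h4 + F * Φ * hwP)
  refine ⟨L, N, w, hw0, hwp, hw, hN, hcLL, hLpos, ?_, ?_, ?_⟩
  · rintro rfl
    rw [zero_pow hp.ne_zero, mul_zero] at hN
    exact hF0 hN
  · rw [h3, hLd]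
    have : (X - X ^ p ^ n : K[X]) = - G := by rw [hG]; ring
    rw [this, hA, hc, C_mul]; ring
  · rw [hLd]; simp [hΦd]

/-- Phase 0 step -/
lemma mv_phase0_step [Finite K] (p n : ℕ) (hp : p.Prime) [CharP K p] (hn : 0 < n)
    (T F : K[X]) (t : K) (ht : t ≠ 0) (hd : 0 < F.natDegree) (hF1 : derivative F ≠ 0)
    (hT1 : 1 < T.natDegree)
    (hTF : T.comp F = C t * (X - X ^ p ^ n) * derivative F)
    (h : ℕ) (Q B : K[X]) (hh : 1 ≤ h) (hT : T = C t * X + Q ^ p ^ h)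
    (hB : derivative F = B ^ p ^ h) :
    (Q.natDegree = 1 ∨ 2 * (derivative F).natDegree < F.natDegree ∨
        ∃ (c : K) (ρ : K), T.eval c = 0 ∧ ρ ≠ 0 ∧
          (F - C c) * derivative B = C ρ * B ^ (p ^ h + 1)) ∨
    (h < n ∧ ∃ Q' B' : K[X], T = C t * X + Q' ^ p ^ (h + 1) ∧ derivative F = B' ^ p ^ (h + 1)) := by
  have := Fact.mk hp
  have hq : 1 < p ^ n := Nat.one_lt_pow hn.ne' hp.one_lt
  have hX : (X - X ^ p ^ n : K[X]) ≠ 0 := by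
    intro h0
    have := natDegree_X_sub_pow (K := K) hq
    rw [h0] at this; simp at this; omega
  have hdeg : T.natDegree * F.natDegree = p ^ n + (derivative F).natDegree := by
    have h1 := congrArg natDegree hTF
    rw [natDegree_comp, natDegree_mul (mul_ne_zero (C_ne_zero.2 ht) hX) hF1,
      natDegree_mul (C_ne_zero.2 ht) hX, natDegree_X_sub_pow hq, natDegree_C] at h1
    omega
  have hF1d := natDegree_derivative_lt (p := F) hd.ne'
  have hph : 2 ≤ p ^ h := by
    calc 2 ≤ p := hp.two_le
      _ = p ^ 1 := (pow_one p).symm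
      _ ≤ p ^ h := Nat.pow_le_pow_right hp.pos hh
  have hphp : p ^ h ≠ 0 := by omega
  have hctX : (C t * X : K[X]).natDegree = 1 := natDegree_C_mul_X t ht
  by_cases hρ1 : Q.natDegree = 1
  · exact Or.inl (Or.inl hρ1)
  set ρ := Q.natDegree with hρdef
  have hρ0 : ρ ≠ 0 := by
    intro h0
    have : T.natDegree ≤ 1 := by
      rw [hT]
      refine (natDegree_add_le _ _).trans ?_
      rw [hctX, natDegree_pow, ← hρdef, h0, mul_zero]; simp
    omega
  have hρ : 2 ≤ ρ := by omega
  have hTd : T.natDegree = p ^ h * ρ := by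
    rw [hT, natDegree_add_eq_right_of_natDegree_lt, natDegree_pow]
    rw [hctX, natDegree_pow, ← hρdef]; nlinarith
  set d := F.natDegree with hddef
  set b := B.natDegree with hbdef
  have hF1b : (derivative F).natDegree = p ^ h * b := by rw [hB, natDegree_pow]
  have hB0 : B ≠ 0 := by
    rintro rfl; rw [zero_pow hphp] at hB; exact hF1 hB
  have h2b : 2 * b ≤ p ^ h * b := Nat.mul_le_mul_right _ hph
  have hhn : h < n := by
    have : p ^ h < p ^ n := by
      rw [hTd] at hdeg
      have h1 : p ^ h * 2 * d ≤ p ^ h * ρ * d :=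
        Nat.mul_le_mul_right _ (Nat.mul_le_mul_left _ hρ)
      have h2 : p ^ h ≤ p ^ h * d := Nat.le_mul_of_pos_right _ hd
      have h3 : d ≤ p ^ h * d := Nat.le_mul_of_pos_left _ (by omega)
      have h4 : p ^ h * 2 * d = 2 * (p ^ h * d) := by ring
      omega
    exact (Nat.pow_lt_pow_iff_right hp.one_lt).1 this
  obtain ⟨τ, hτ⟩ := mv_root p h t
  obtain ⟨m, hm⟩ : ∃ m, n = h + (m + 1) := ⟨n - h - 1, by omega⟩
  set E := Q.comp F + C τ * X ^ p ^ (m + 1) * B with hE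
  have hE1 : E ^ p ^ h = C t * (X * derivative F - F) := by
    have h1 : T.comp F = C t * F + Q.comp F ^ p ^ h := by
      rw [hT]; simp
    have h2 : E ^ p ^ h = Q.comp F ^ p ^ h + C t * X ^ p ^ n * B ^ p ^ h := by
      rw [hE, add_pow_char_pow, mul_pow, mul_pow, ← C_pow, hτ, ← pow_mul, ← pow_add]
      rw [hm, add_comm h (m + 1)]
    rw [h2, ← hB]
    linear_combination hTF - h1
  have hEd : 2 * E.natDegree ≤ d := by
    have h1 : p ^ h * E.natDegree ≤ d := by
      rw [← natDegree_pow, hE1]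
      refine (natDegree_C_mul_le _ _).trans ?_
      refine (natDegree_sub_le _ _).trans (max_le ?_ le_rfl)
      refine natDegree_mul_le.trans ?_
      rw [natDegree_X]; omega
    exact (Nat.mul_le_mul_right _ hph).trans h1
  have hEE : derivative E * B - derivative B * E =
      (derivative Q).comp F * derivative F * B - derivative B * Q.comp F := by
    have hd : derivative (X ^ p ^ (m + 1) : K[X]) = 0 := by
      rw [derivative_X_pow, Nat.cast_pow, CharP.cast_eq_zero, zero_pow (by omega), C_0, zero_mul]
    rw [hE]
    simp only [derivative_add, derivative_mul, derivative_comp, derivative_C, hd]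
    ring
  have hQ0 : Q ≠ 0 := by rintro rfl; simp at hρdef; omega
  have hlc : Q.coeff ρ ≠ 0 := by
    rw [hρdef, coeff_natDegree]; exact leadingCoeff_ne_zero.2 hQ0
  have hEd1 : (derivative E).natDegree ≤ E.natDegree :=
    (natDegree_derivative_le E).trans (by omega)
  have hBd1 : (derivative B).natDegree ≤ b := (natDegree_derivative_le B).trans (by omega)
  have hρd : 2 * d ≤ ρ * d := Nat.mul_le_mul_right _ hρ
  by_cases hρK : (ρ : K) = 0
  · have hQ'd : (derivative Q).natDegree ≤ ρ - 2 := by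
      rw [natDegree_le_iff_coeff_eq_zero]
      intro N hN
      rw [coeff_derivative]
      rcases Nat.lt_or_ge ρ (N + 1) with h1 | h1
      · rw [coeff_eq_zero_of_natDegree_lt h1, zero_mul]
      · have : N + 1 = ρ := by omega
        have h2 : (N : K) + 1 = ρ := by rw [← this]; push_cast; rfl
        rw [h2, hρK, mul_zero]
    have hBd : derivative B = 0 := by
      by_contra hne
      have h1 : derivative B * Q.comp F =
          (derivative Q).comp F * derivative F * B - derivative E * B + derivative B * E := by
        linear_combination hEE
      have h2 : (derivative B * Q.comp F).natDegree = (derivative B).natDegree + ρ * d := by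
        rw [natDegree_mul hne, natDegree_comp]
        intro h0
        have := natDegree_comp (p := Q) (q := F)
        rw [h0, natDegree_zero, ← hρdef, ← hddef] at this
        omega
      have h3 : ((derivative Q).comp F * derivative F * B).natDegree < ρ * d := by
        have h4 : ((derivative Q).comp F * derivative F * B).natDegree ≤
            (ρ - 2) * d + (derivative F).natDegree + b := by
          refine natDegree_mul_le.trans (Nat.add_le_add_right ?_ _)
          refine natDegree_mul_le.trans (Nat.add_le_add_right ?_ _)
          rw [natDegree_comp]
          exact Nat.mul_le_mul_right _ hQ'd
        have h5 : (ρ - 2) * d + 2 * d = ρ * d := by rw [← add_mul]; congr 1; omega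
        omega
      have h6 : (derivative E * B).natDegree < ρ * d := by
        have := natDegree_mul_le (p := derivative E) (q := B)
        omega
      have h7 : (derivative B * E).natDegree < (derivative B).natDegree + ρ * d := by
        have := natDegree_mul_le (p := derivative B) (q := E)
        omega
      have h8 := congrArg natDegree h1
      have h9 := natDegree_add_le ((derivative Q).comp F * derivative F * B - derivative E * B)
        (derivative B * E)
      have h10 := natDegree_sub_le ((derivative Q).comp F * derivative F * B) (derivative E * B)
      rw [← h8, h2] at h9
      rcases le_max_iff.1 h9 with h11 | h11
      · rcases le_max_iff.1 (h11.trans h10) with h12 | h12 <;> omega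
      · omega
    have hEQ : (derivative Q).comp F * derivative F = derivative E := by
      apply mul_right_cancel₀ hB0
      rw [hBd] at hEE
      linear_combination -hEE
    by_cases hQd : derivative Q = 0
    · right
      refine ⟨hhn, ?_⟩
      obtain ⟨Q', hQ'⟩ := mv_pth p Q hQd
      obtain ⟨B', hB'⟩ := mv_pth p B hBd
      refine ⟨Q', B', ?_, ?_⟩
      · rw [hT, hQ', ← pow_mul, pow_succ']
      · rw [hB, hB', ← pow_mul, pow_succ']
    · left; right; left
      have hc0 : (derivative Q).comp F ≠ 0 := by
        intro h0
        rcases comp_eq_zero_iff.1 h0 with h1 | ⟨_, h1⟩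
        · exact hQd h1
        · rw [h1, natDegree_C] at hddef; omega
      have h1 := congrArg natDegree hEQ
      rw [natDegree_mul hc0 hF1] at h1
      by_cases hE0 : E.natDegree = 0
      · exfalso
        rw [natDegree_eq_zero] at hE0
        obtain ⟨x, hx⟩ := hE0
        rw [← hx, derivative_C] at hEQ
        exact mul_ne_zero hc0 hF1 hEQ
      · have := natDegree_derivative_lt (p := E) hE0
        omega
  · left; right; right
    set c : K := - Q.coeff (ρ - 1) / (ρ * Q.coeff ρ) with hc
    set R2 := C (ρ : K) * Q - (X - C c) * derivative Q with hR2
    have hR2d : R2.natDegree ≤ ρ - 2 := by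
      rw [natDegree_le_iff_coeff_eq_zero]
      intro N hN
      obtain ⟨N, rfl⟩ : ∃ N', N = N' + 1 := ⟨N - 1, by omega⟩
      rw [hR2, sub_mul, coeff_sub, coeff_sub, coeff_C_mul, coeff_C_mul, coeff_X_mul,
        coeff_derivative, coeff_derivative]
      rcases Nat.lt_or_ge ρ (N + 1) with h1 | h1
      · rw [coeff_eq_zero_of_natDegree_lt h1, coeff_eq_zero_of_natDegree_lt (by omega)]; ring
      · rcases h1.lt_or_eq with h1 | h1
        · have h2 : N + 1 + 1 = ρ := by omega
          have h3 : ρ - 1 = N + 1 := by omega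
          have h4 : (ρ : K) = N + 1 + 1 := by rw [← h2]; push_cast; rfl
          rw [h2, hc, h3]
          push_cast
          rw [← h4]
          field_simp
          rw [h4]; ring
        · rw [h1, coeff_eq_zero_of_natDegree_lt (show Q.natDegree < ρ + 1 by omega), ← h1]
          push_cast; ring
    have hkey : (derivative Q).comp F * (C (ρ : K) * derivative F * B - derivative B * (F - C c)) =
        C (ρ : K) * (derivative E * B - derivative B * E) + derivative B * R2.comp F := by
      have h1 : R2.comp F = C (ρ : K) * Q.comp F - (F - C c) * (derivative Q).comp F := by
        rw [hR2]; simp only [sub_comp, mul_comp, C_comp, X_comp]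
      rw [h1, hEE]; ring
    have hQ'd : (derivative Q).natDegree = ρ - 1 := by
      apply natDegree_eq_of_le_of_coeff_ne_zero (natDegree_derivative_le Q)
      rw [coeff_derivative]
      have h2 : ρ - 1 + 1 = ρ := by omega
      have h4 : ((ρ - 1 : ℕ) : K) + 1 = ρ := by
        conv_rhs => rw [← h2]
        push_cast; rfl
      rw [h4, h2]
      exact mul_ne_zero hlc hρK
    have hbr : C (ρ : K) * derivative F * B - derivative B * (F - C c) = 0 := by
      by_contra hne
      have hc0 : (derivative Q).comp F ≠ 0 := by
        intro h0
        have := natDegree_comp (p := derivative Q) (q := F)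
        rw [h0, natDegree_zero, hQ'd, ← hddef] at this
        have : 0 < (ρ - 1) * d := Nat.mul_pos (by omega) hd
        omega
      have h1 := congrArg natDegree hkey
      rw [natDegree_mul hc0 hne, natDegree_comp, hQ'd, ← hddef] at h1
      have h5 : (ρ - 2) * d + d = (ρ - 1) * d := by
        rw [← Nat.succ_mul]; congr 1; omega
      have h2 := natDegree_add_le (C (ρ : K) * (derivative E * B - derivative B * E))
        (derivative B * R2.comp F)
      have h3 := natDegree_C_mul_le (ρ : K) (derivative E * B - derivative B * E)
      have h4 := natDegree_sub_le (derivative E * B) (derivative B * E)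
      have h6 := natDegree_mul_le (p := derivative E) (q := B)
      have h7 := natDegree_mul_le (p := derivative B) (q := E)
      have h8 : (derivative B * R2.comp F).natDegree ≤ b + (ρ - 2) * d := by
        refine natDegree_mul_le.trans (Nat.add_le_add hBd1 ?_)
        rw [natDegree_comp]
        exact Nat.mul_le_mul_right _ hR2d
      rw [← h1] at h2
      have h9 : d ≤ (ρ - 1) * d := Nat.le_mul_of_pos_left _ (by omega)
      rcases le_max_iff.1 h2 with h11 | h11
      · rcases le_max_iff.1 ((h11.trans h3).trans h4) with h12 | h12 <;> omega
      · omega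
    have hfin : (F - C c) * derivative B = C (ρ : K) * B ^ (p ^ h + 1) := by
      rw [pow_succ, ← hB]
      linear_combination -hbr
    refine ⟨c, ρ, ?_, hρK, hfin⟩
    by_contra hTc
    have h1 := mv_cop_comp (T.comp (X + C c)) (F - C c) (by
      rw [coeff_zero_eq_eval_zero, eval_comp]; simpa using hTc)
    have h2 : (T.comp (X + C c)).comp (F - C c) = T.comp F := by
      rw [comp_assoc]; simp
    rw [h2] at h1
    have h3 : B ∣ T.comp F := by
      rw [hTF, hB]; exact Dvd.dvd.mul_left (dvd_pow_self _ hphp) _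
    have h4 : IsCoprime (F - C c) (B ^ (p ^ h + 1)) :=
      (h1.of_isCoprime_of_dvd_right h3).pow_right
    have h5 : F - C c ∣ B ^ (p ^ h + 1) := by
      have : F - C c ∣ C (ρ : K) * B ^ (p ^ h + 1) := ⟨_, hfin.symm⟩
      exact ((isUnit_C.2 (isUnit_iff_ne_zero.2 hρK)).dvd_mul_left).1 this
    have h6 := natDegree_eq_zero_of_isUnit (h4.isUnit_of_dvd' dvd_rfl h5)
    rw [natDegree_sub_C] at h6
    omega

/-- Phase 0 loop -/
lemma mv_phase0 [Finite K] (p n : ℕ) (hp : p.Prime) [CharP K p] (hn : 0 < n)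
    (T F : K[X]) (t : K) (ht : t ≠ 0) (hd : 0 < F.natDegree) (hF1 : derivative F ≠ 0)
    (hT1 : 1 < T.natDegree)
    (hTF : T.comp F = C t * (X - X ^ p ^ n) * derivative F) (m : ℕ) :
    ∀ (h : ℕ) (Q B : K[X]), 1 ≤ h → T = C t * X + Q ^ p ^ h → derivative F = B ^ p ^ h →
      n ≤ h + m →
    ∃ (h : ℕ) (Q B : K[X]), 1 ≤ h ∧ T = C t * X + Q ^ p ^ h ∧ derivative F = B ^ p ^ h ∧
      (Q.natDegree = 1 ∨ 2 * (derivative F).natDegree < F.natDegree ∨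
        ∃ (c : K) (ρ : K), T.eval c = 0 ∧ ρ ≠ 0 ∧
          (F - C c) * derivative B = C ρ * B ^ (p ^ h + 1)) := by
  induction m with
  | zero =>
    intro h Q B hh hT hB hnm
    rcases mv_phase0_step p n hp hn T F t ht hd hF1 hT1 hTF h Q B hh hT hB with h1 | ⟨h1, _⟩
    · exact ⟨h, Q, B, hh, hT, hB, h1⟩
    · omega
  | succ m ih =>
    intro h Q B hh hT hB hnm
    rcases mv_phase0_step p n hp hn T F t ht hd hF1 hT1 hTF h Q B hh hT hB with
      h1 | ⟨h1, Q', B', h2, h3⟩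
    · exact ⟨h, Q, B, hh, hT, hB, h1⟩
    · exact ih (h + 1) Q' B' (by omega) h2 h3 (by omega)

end MV

section MV
variable {K : Type*} [Field K]

lemma mv_coeff_pow (p : ℕ) [Fact p.Prime] [CharP K p] (h : ℕ) (g : K[X]) (m : ℕ)
    (hm : (g ^ p ^ h).coeff m ≠ 0) : p ^ h ∣ m := by
  by_contra h1
  apply hm
  rw [← map_iterateFrobenius_expand, coeff_map, coeff_expand (pow_pos (Fact.out : p.Prime).pos _),
    if_neg h1, map_zero]

/-- Phase 0 conclusion. -/
lemma mv_phase0_end [Fintype K] (p n : ℕ) (hp : p.Prime) [CharP K p] (hn : 0 < n)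
    (hcard : Fintype.card K = p ^ n)
    (T f : K[X]) (t : K) (ht : t ≠ 0) (hf1 : derivative f ≠ 0)
    (hT1 : 1 < T.natDegree) (hT' : derivative T = C t)
    (hTf : T.comp f = C t * (X - X ^ p ^ n) * derivative f)
    (hroot : ∀ γ, T.eval γ = 0 → ∃ a, f.eval a = γ)
    (γ0 : K) (hγ0 : T.eval γ0 = 0) (r : ℕ) (hr : p ∣ 1 + r) :
    ∃ γ, T.eval γ = 0 ∧ ∃ S : K[X], X * S = T.comp (X + C γ) ∧
      ∃ v, 0 < v ∧ ∀ j ∈ S.support, ∃ i, 1 + v * j = p ^ i := by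
  have := Fact.mk hp
  have hd : 0 < f.natDegree := by
    rw [Nat.pos_iff_ne_zero]; intro h0
    rw [natDegree_eq_zero] at h0
    obtain ⟨x, rfl⟩ := h0
    simp at hf1
  have hq : 1 < p ^ n := Nat.one_lt_pow hn.ne' hp.one_lt
  have hX : (X - X ^ p ^ n : K[X]) ≠ 0 := by
    intro h0
    have := natDegree_X_sub_pow (K := K) hq
    rw [h0] at this; simp at this; omega
  have hCt : (C t : K[X]) ≠ 0 := C_ne_zero.2 ht
  obtain ⟨Q0, hQ0⟩ := mv_pth p (T - C t * X) (by simp [hT'])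
  have hf2 : derivative (derivative f) = 0 := by
    have h1 := congrArg derivative hTf
    rw [derivative_comp, hT', C_comp] at h1
    have h2 : derivative (X - X ^ p ^ n : K[X]) = 1 := by
      have h3 := mv_deriv_Xsub (K := K) p n hn
      have h4 : (X - X ^ p ^ n : K[X]) = -(X ^ p ^ n - X) := by ring
      rw [h4, derivative_neg, h3, neg_neg]
    simp only [derivative_mul, derivative_C, h2] at h1
    have h5 : C t * (X - X ^ p ^ n) * derivative (derivative f) = 0 := by
      linear_combination -h1
    exact (mul_eq_zero.1 h5).resolve_left (mul_ne_zero hCt hX)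
  obtain ⟨B0, hB0⟩ := mv_pth p _ hf2
  obtain ⟨h, Q, B, hh, hT, hB, hcase⟩ := mv_phase0 p n hp hn T f t ht hd hf1 hT1 hTf n 1 Q0 B0
    le_rfl (by rw [pow_one, ← hQ0]; ring) (by rw [pow_one, hB0]) (by omega)
  have hph : 2 ≤ p ^ h := by
    calc 2 ≤ p := hp.two_le
      _ = p ^ 1 := (pow_one p).symm
      _ ≤ p ^ h := Nat.pow_le_pow_right hp.pos hh
  have hphp : p ^ h ≠ 0 := by omega
  have hsupp : ∀ (γ : K) (S : K[X]), X * S = T.comp (X + C γ) → ∀ j ∈ S.support, 0 < j →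
      p ^ h ∣ 1 + j := by
    intro γ S hS j hj hj0
    have h1 : S.coeff j = ((Q.comp (X + C γ)) ^ p ^ h).coeff (j + 1) := by
      rw [← coeff_X_mul, hS, hT]
      simp only [add_comp, mul_comp, C_comp, X_comp, pow_comp, coeff_add, coeff_C_mul, coeff_X,
        coeff_C]
      rw [if_neg (by omega), if_neg (by omega)]; ring
    rw [mem_support_iff, h1] at hj
    rw [add_comm]
    exact mv_coeff_pow p h _ _ hj
  have hex : ∀ γ, T.eval γ = 0 → ∃ S : K[X], X * S = T.comp (X + C γ) := by
    intro γ hγ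
    refine ⟨divX (T.comp (X + C γ)), ?_⟩
    have h1 := X_mul_divX_add (T.comp (X + C γ))
    have h2 : (T.comp (X + C γ)).coeff 0 = 0 := by
      rw [coeff_zero_eq_eval_zero, eval_comp]; simpa using hγ
    rw [h2, C_0, add_zero] at h1
    exact h1
  have hSd : ∀ (γ : K) (S : K[X]), X * S = T.comp (X + C γ) → S.natDegree + 1 = T.natDegree := by
    intro γ S hS
    have h1 := congrArg natDegree hS
    have hS0 : S ≠ 0 := by
      rintro rfl
      rw [mul_zero, natDegree_zero, natDegree_comp, natDegree_X_add_C] at h1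
      omega
    rw [natDegree_X_mul hS0, natDegree_comp, natDegree_X_add_C] at h1
    omega
  by_cases hA : Q.natDegree = 1
  · obtain ⟨S, hS⟩ := hex γ0 hγ0
    refine ⟨γ0, hγ0, S, hS, 1, one_pos, fun j hj => ?_⟩
    rw [one_mul]
    rcases Nat.eq_zero_or_pos j with h0 | h0
    · exact ⟨0, by rw [h0]; simp⟩
    · refine ⟨h, le_antisymm ?_ (Nat.le_of_dvd (by omega) (hsupp γ0 S hS j hj h0))⟩
      have h1 := le_natDegree_of_mem_supp j hj
      have h2 := hSd γ0 S hS
      have h3 : T.natDegree ≤ p ^ h := by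
        rw [hT]
        refine (natDegree_add_le _ _).trans (max_le ?_ ?_)
        · refine (natDegree_C_mul_le _ _).trans ?_
          rw [natDegree_X]; omega
        · rw [natDegree_pow, hA, mul_one]
      omega
  replace hcase := hcase.resolve_left hA
  -- choice of γ
  have hcase2 : ∃ γ, T.eval γ = 0 ∧ (2 * (derivative f).natDegree < f.natDegree ∨
      ∃ ρ : K, ρ ≠ 0 ∧ (f - C γ) * derivative B = C ρ * B ^ (p ^ h + 1)) := by
    rcases hcase with h1 | ⟨c, ρ, h1, h2, h3⟩
    · exact ⟨γ0, hγ0, Or.inl h1⟩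
    · exact ⟨c, h1, Or.inr ⟨ρ, h2, h3⟩⟩
  obtain ⟨γ, hγ, hcs⟩ := hcase2
  obtain ⟨S, hS⟩ := hex γ hγ
  refine ⟨γ, hγ, S, hS, ?_⟩
  have hSder : S + X * derivative S = C t := by
    have h1 := congrArg derivative hS
    rw [derivative_mul, derivative_X, derivative_comp, hT', C_comp] at h1
    simp at h1
    linear_combination h1
  have hSc : S.coeff 0 = t := by
    have h1 := congrArg (fun g => g.coeff 0) hSder
    simpa using h1
  have hrK : (r : K) = -1 := by
    have := (CharP.cast_eq_zero_iff K p _).2 hr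
    push_cast at this
    linear_combination this
  have hpr : ¬ p ∣ r := by
    intro h1
    exact hp.one_lt.ne' (Nat.dvd_one.1 ((Nat.dvd_add_left h1).1 hr))
  obtain ⟨a, ha⟩ := hroot γ hγ
  set F := f - C γ with hF
  have hFd : derivative F = derivative f := by simp [hF]
  have hFdeg : F.natDegree = f.natDegree := natDegree_sub_C
  have hFS : F * S.comp F = T.comp f := by
    have h1 := congrArg (fun g => g.comp F) hS
    simp only [mul_comp, X_comp, comp_assoc, add_comp, C_comp] at h1
    rw [h1, hF, sub_add_cancel]
  obtain ⟨L, N1, w, hw0, hwp, hw, hFL, hcop, hLpos, hN1, heq, hL2⟩ :=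
    mv_base2 p n hp hn hcard S F r (by rw [hrK]; simp) (by rw [hSc]; exact ht)
      (by rw [hFd]; exact hf1) a (by simp [hF, ha])
      (by rw [hFS, hTf, hFd, hrK, hSc, C_mul, C_neg, C_1]; ring)
      (by rw [hrK, hSc, C_mul, C_neg, C_1]; linear_combination hSder)
  have hw1 : w = 1 := by
    have h1 : p ∣ (w - 1) * r := by
      have h2 : (w - 1) * r + (1 + r) = 1 + w * r := by
        obtain ⟨w', rfl⟩ : ∃ w', w = w' + 1 := ⟨w - 1, by omega⟩
        simp only [Nat.add_sub_cancel]; ring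
      exact (Nat.dvd_add_left hr).1 (h2 ▸ hw)
    have h3 := (hp.dvd_mul.1 h1).resolve_right hpr
    have := Nat.eq_zero_of_dvd_of_lt h3 (by omega)
    omega
  rw [hw1, pow_one] at hFL
  have hL'F : IsCoprime (derivative L) F := by
    have h1 : derivative L ∣ L * S.comp F := by rw [heq]; exact Dvd.intro_left _ rfl
    have h2 := hcop.symm.dvd_of_dvd_mul_left h1
    exact (mv_cop_comp S F (by rw [hSc]; exact ht)).symm.of_isCoprime_of_dvd_left h2
  have hcop2 : IsCoprime (derivative L) (N1 ^ p) :=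
    hL'F.of_isCoprime_of_dvd_right ⟨L, by rw [hFL]; ring⟩
  have hprod : derivative L * N1 ^ p = B ^ p ^ h := by
    rw [← hB, ← hFd, hFL, derivative_mul, derivative_pow, CharP.cast_eq_zero]; simp
  obtain ⟨B1, hB1⟩ := mv_split_pow p h hcop2 hprod
  obtain ⟨N, hN⟩ := mv_split_pow p h hcop2.symm (by rw [mul_comm]; exact hprod)
  have hN0 : N ≠ 0 := by
    rintro rfl
    rw [zero_pow hphp] at hN
    exact pow_ne_zero _ hN1 hN
  have hBB : B = B1 * N := by
    apply mv_pow_inj p h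
    rw [← hprod, hB1, hN, mul_pow]
  have hL0 : L ≠ 0 := by rintro rfl; simp at hLpos
  have hL'lt := natDegree_derivative_lt (p := L) hLpos.ne'
  have hL'd : (derivative L).natDegree = p ^ h * B1.natDegree := by rw [hB1, natDegree_pow]
  have hB10 : B1 ≠ 0 := by
    rintro rfl
    rw [zero_mul] at hBB
    rw [hBB, zero_pow hphp] at hB
    exact hf1 hB
  have hFdeg2 : F.natDegree = L.natDegree + p ^ h * N.natDegree := by
    rw [hFL, hN, natDegree_mul hL0 (pow_ne_zero _ hN0), natDegree_pow]
  have hb1 : B1.natDegree ≤ p ^ h * B1.natDegree := Nat.le_mul_of_pos_left _ (by omega)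
  have hn2 : 2 * N.natDegree ≤ p ^ h * N.natDegree := Nat.mul_le_mul_right _ hph
  have st : MvSt p n S F L h 1 N B1 := {
    hh := hh
    hv := one_pos
    hF := by rw [pow_one, ← hN]; exact hFL
    hL := hB1
    cop := hcop
    Lpos := hLpos
    N0 := hN0
    eq := heq
    s0 := by rw [hSc]; exact ht
    rdeg := by have := hSd γ S hS; omega
    supp := by
      intro j hj
      rw [one_mul]
      rcases Nat.eq_zero_or_pos j with h0 | h0
      · left; exact ⟨0, by omega, by rw [h0]; simp⟩
      · right; exact hsupp γ S hS j hj h0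
    inv1 := by
      rintro ⟨j, hj, hj0, i, hi, hij⟩
      exfalso
      have h1 := Nat.le_of_dvd (by omega) (hsupp γ S hS j hj hj0)
      have h2 := Nat.pow_lt_pow_right hp.one_lt hi
      omega
    inv2 := by
      rcases hcs with h1 | ⟨ρ, hρ, h1⟩
      · have h2 : (derivative f).natDegree = p ^ h * B1.natDegree + p ^ h * N.natDegree := by
          rw [hB, hBB, natDegree_pow, natDegree_mul hB10 hN0]; ring
        rw [hL'd, hFdeg]
        omega
      · have h2 : L * (derivative B1 * N + B1 * derivative N) = N * (C ρ * B1 ^ (p ^ h + 1)) := by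
          apply mul_left_cancel₀ (pow_ne_zero (p ^ h) hN0)
          have h3 : F = L * N ^ p ^ h := by rw [← hN]; exact hFL
          rw [hBB, derivative_mul, h3, mul_pow, pow_succ N] at h1
          linear_combination h1
        have h3 : IsCoprime L (C ρ * B1 ^ (p ^ h + 1)) := by
          have h4 : IsCoprime L B1 := by
            rw [hB1] at hcop
            exact (IsCoprime.pow_right_iff (by omega)).1 hcop
          have h5 : IsUnit (C ρ : K[X]) := isUnit_C.2 (isUnit_iff_ne_zero.2 hρ)
          exact (isCoprime_mul_unit_left_right h5 _ _).2 h4.pow_right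
        have h6 : L ∣ N := h3.dvd_of_dvd_mul_right ⟨_, h2.symm⟩
        have h7 := natDegree_le_of_dvd h6 hN0
        omega }
  exact MvSt.final hp hn n st (by omega)

lemma mv_core [Fintype K] [DecidableEq K] (p n : ℕ) (hp : p.Prime) [CharP K p] (hn : 0 < n)
    (hcard : Fintype.card K = p ^ n) (V : Finset K) (f : K[X]) (hV : 2 < V.card)
    (hatt : ∀ γ ∈ V, ∃ a, f.eval a = γ) (t : K) (ht : t ≠ 0) (hf1 : derivative f ≠ 0)
    (hTf : (∏ γ ∈ V, (X - C γ)).comp f = C t * (X - X ^ p ^ n) * derivative f)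
    (γ0 : K) (hγ0 : γ0 ∈ V)
    (htγ : ∀ γ ∈ V, γ ≠ γ0 → (derivative (∏ γ ∈ V, (X - C γ))).eval γ = t) :
    ∃ γ ∈ V, ∃ S : K[X], X * S = (∏ γ ∈ V, (X - C γ)).comp (X + C γ) ∧
      ∃ v, 0 < v ∧ ∀ j ∈ S.support, ∃ i, 1 + v * j = p ^ i := by
  have := Fact.mk hp
  set T : K[X] := ∏ γ ∈ V, (X - C γ) with hTdef
  have hTev : ∀ x, T.eval x = 0 ↔ x ∈ V := by
    intro x
    rw [hTdef, eval_prod, Finset.prod_eq_zero_iff]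
    constructor
    · rintro ⟨y, hy, h⟩
      simp [sub_eq_zero] at h; rwa [h]
    · intro h; exact ⟨x, h, by simp⟩
  have hTd : T.natDegree = V.card := by
    rw [hTdef, natDegree_prod_of_monic _ _ (fun i _ => monic_X_sub_C i)]; simp
  have hTm : T.Monic := monic_prod_of_monic _ _ fun i _ => monic_X_sub_C i
  have hTsep : T.Separable := separable_prod_X_sub_C_iff'.2 (fun _ _ _ _ h => h)
  obtain ⟨S, hS⟩ : ∃ S : K[X], X * S = T.comp (X + C γ0) := by
    refine ⟨divX (T.comp (X + C γ0)), ?_⟩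
    have h1 := X_mul_divX_add (T.comp (X + C γ0))
    have h2 : (T.comp (X + C γ0)).coeff 0 = 0 := by
      rw [coeff_zero_eq_eval_zero, eval_comp]; simpa using (hTev γ0).2 hγ0
    rw [h2, C_0, add_zero] at h1
    exact h1
  set r := V.card - 1 with hr
  have hT'm : (T.comp (X + C γ0)).Monic := hTm.comp_X_add_C γ0
  have hSm : S.Monic := by
    rw [← hS] at hT'm
    exact Monic.of_mul_monic_left monic_X hT'm
  have hSd : S.natDegree = r := by
    have h1 := congrArg natDegree hS
    rw [natDegree_X_mul hSm.ne_zero, natDegree_comp, natDegree_X_add_C, hTd] at h1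
    omega
  have hSder : S + X * derivative S = (derivative T).comp (X + C γ0) := by
    have h1 := congrArg derivative hS
    rw [derivative_mul, derivative_X, derivative_comp] at h1
    simp at h1
    linear_combination h1
  have hS0 : S.coeff 0 = (derivative T).eval γ0 := by
    have h1 := congrArg (fun g => g.eval 0) hSder
    simp [eval_comp] at h1
    rw [coeff_zero_eq_eval_zero, h1]
  have hs0 : S.coeff 0 ≠ 0 := by
    rw [hS0]
    have := hTsep.eval₂_derivative_ne_zero (RingHom.id K) (x := γ0) (by
      simpa [eval₂_id] using (hTev γ0).2 hγ0)
    simpa [eval₂_id] using this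
  have hXS : X * derivative S = C (r : K) * S + C t := by
    have h1 : X * derivative S - C (r : K) * S - C t = 0 := by
      by_contra hne
      apply hne
      apply eq_zero_of_natDegree_lt_card_of_eval_eq_zero' _ ((V.erase γ0).image (fun γ => γ - γ0))
      · intro x hx
        simp only [Finset.mem_image, Finset.mem_erase] at hx
        obtain ⟨γ, ⟨hne, hγ⟩, rfl⟩ := hx
        have h2 := congrArg (fun g => g.eval (γ - γ0)) hS
        have h3 := congrArg (fun g => g.eval (γ - γ0)) hSder
        simp only [eval_mul, eval_X, eval_comp, eval_add, eval_C, sub_add_cancel, (hTev γ).2 hγ,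
          htγ γ hγ hne] at h2 h3
        have h4 := (mul_eq_zero.1 h2).resolve_left (sub_ne_zero.2 hne)
        simp only [eval_sub, eval_mul, eval_X, eval_C, h4] at h3 ⊢
        linear_combination h3
      · rw [Finset.card_image_of_injective _ (sub_left_injective), Finset.card_erase_of_mem hγ0,
          ← hr]
        have hrpos : 0 < r := by omega
        rw [natDegree_lt_iff_degree_lt hne, degree_lt_iff_coeff_zero]
        intro m hm
        obtain ⟨m, rfl⟩ : ∃ m', m = m' + 1 := ⟨m - 1, by omega⟩
        rw [coeff_sub, coeff_sub, coeff_X_mul, coeff_C_mul, coeff_derivative, coeff_C,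
          if_neg (by omega)]
        rcases hm.lt_or_eq with h1 | h1
        · rw [coeff_eq_zero_of_natDegree_lt (by omega)]; ring
        · rw [h1]; push_cast; ring
    linear_combination h1
  have hrs : (r : K) * S.coeff 0 = -t := by
    have h1 := congrArg (fun g => g.coeff 0) hXS
    simp at h1
    linear_combination -h1
  have hrK : (r : K) ≠ 0 := by
    intro h0; rw [h0, zero_mul] at hrs
    exact ht (neg_eq_zero.1 hrs.symm)
  set F := f - C γ0 with hF
  have hFd : derivative F = derivative f := by simp [hF]
  have hFS : F * S.comp F = T.comp f := by
    have h1 := congrArg (fun g => g.comp F) hS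
    simp only [mul_comp, X_comp, comp_assoc, add_comp, C_comp] at h1
    rw [h1, hF, sub_add_cancel]
  obtain ⟨a, ha⟩ := hatt γ0 hγ0
  obtain ⟨L, N, w, hw0, hwp, hw, hFL, hcop, hLpos, hN, heq, hL2⟩ :=
    mv_base2 p n hp hn hcard S F r hrK hs0
      (by rw [hFd]; exact hf1) a (by simp [hF, ha])
      (by rw [hFS, hTf, hFd, hrs, C_neg]; ring)
      (by rw [hrs, C_neg, hXS]; ring)
  by_cases hw1 : w = 1
  · rw [hw1, one_mul] at hw
    have hrK1 : (r : K) = -1 := by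
      have := (CharP.cast_eq_zero_iff K p _).2 hw
      push_cast at this
      linear_combination this
    have hT' : derivative T = C t := by
      have h1 : (derivative T).comp (X + C γ0) = C t := by
        rw [← hSder, hXS, hrK1, C_neg, C_1]; ring
      have h2 := congrArg (fun g => g.comp (X - C γ0)) h1
      simpa [comp_assoc] using h2
    obtain ⟨γ, h1, h2⟩ := mv_phase0_end p n hp hn hcard T f t ht hf1 (by omega) hT' hTf
      (fun γ hγ => hatt γ ((hTev γ).1 hγ)) γ0 ((hTev γ0).2 hγ0) r hw
    exact ⟨γ, (hTev γ).1 h1, h2⟩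
  · obtain ⟨B, hB⟩ := mv_pth p _ hL2
    have hL'lt := natDegree_derivative_lt (p := L) hLpos.ne'
    have hL'd : (derivative L).natDegree = p * B.natDegree := by rw [hB, natDegree_pow]
    have hL0 : L ≠ 0 := by rintro rfl; simp at hLpos
    have st : MvSt p n S F L 1 w N B := {
      hh := le_rfl
      hv := hw0
      hF := by rw [pow_one]; exact hFL
      hL := by rw [pow_one]; exact hB
      cop := hcop
      Lpos := hLpos
      N0 := hN
      eq := heq
      s0 := hs0
      rdeg := by omega
      supp := by
        intro j hj
        rcases Nat.eq_zero_or_pos j with h0 | h0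
        · left; exact ⟨0, by omega, by rw [h0]; simp⟩
        · right
          rw [pow_one, ← CharP.cast_eq_zero_iff K p]
          have h1 := congrArg (fun g => g.coeff j) hXS
          obtain ⟨m, rfl⟩ : ∃ m', j = m' + 1 := ⟨j - 1, by omega⟩
          simp only [coeff_X_mul, coeff_derivative, coeff_add, coeff_C_mul, coeff_C] at h1
          rw [if_neg (by omega), add_zero, mul_comm] at h1
          have h2 := mul_right_cancel₀ (mem_support_iff.1 hj) h1
          push_cast
          rw [h2]
          have := (CharP.cast_eq_zero_iff K p _).2 hw
          exact_mod_cast this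
      inv1 := by
        rintro ⟨j, hj, hj0, i, hi, hij⟩
        exfalso
        have h1 : i = 0 := by omega
        rw [h1, pow_zero] at hij
        have := Nat.mul_pos hw0 hj0
        omega
      inv2 := by
        have h1 : F.natDegree = w * L.natDegree + p * N.natDegree := by
          rw [hFL, natDegree_mul (pow_ne_zero _ hL0) (pow_ne_zero _ hN), natDegree_pow,
            natDegree_pow]
        have h2 : 2 * L.natDegree ≤ w * L.natDegree := Nat.mul_le_mul_right _ (by omega)
        have h3 : N.natDegree ≤ p * N.natDegree := Nat.le_mul_of_pos_left _ hp.pos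
        have h4 : B.natDegree ≤ p * B.natDegree := Nat.le_mul_of_pos_left _ hp.pos
        omega }
    exact ⟨γ0, hγ0, S, hS, MvSt.final hp hn n st (by omega)⟩

end MV

section MV
variable {K : Type*} [Field K]

lemma mv_prod_dvd (s : Finset K) (g : K[X]) (h : ∀ a ∈ s, g.eval a = 0) :
    ∏ a ∈ s, (X - C a) ∣ g := by
  apply Finset.prod_dvd_of_coprime
  · intro a _ b _ hab
    exact pairwise_coprime_X_sub_C (s := fun x : K => x) Function.injective_id hab
  · intro a ha; exact dvd_iff_isRoot.2 (h a ha)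

lemma mv_prod_deg (s : Finset K) : (∏ a ∈ s, (X - C a)).natDegree = s.card := by
  rw [natDegree_prod_of_monic _ _ (fun i _ => monic_X_sub_C i)]; simp

lemma mv_prod_univ [Fintype K] : ∏ a : K, (X - C a) = X ^ Fintype.card K - X := by
  have hq : 1 < Fintype.card K := Fintype.one_lt_card
  symm
  apply eq_of_monic_of_dvd_of_natDegree_le
  · exact monic_prod_of_monic _ _ fun i _ => monic_X_sub_C i
  · apply monic_X_pow_sub; rw [degree_X]; exact_mod_cast hq
  · apply mv_prod_dvd
    intro a _
    simp [FiniteField.pow_card]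
  · rw [mv_prod_deg, Finset.card_univ]
    exact (FiniteField.X_pow_card_sub_X_natDegree_eq K hq).le

lemma mv_three {f M1 M2 M3 K1 K2 K3 : K[X]} {γ1 γ2 γ3 a1 a2 a3 : K}
    (h12 : IsCoprime M1 M2) (h13 : IsCoprime M1 M3) (ha1 : a1 ≠ 0)
    (hM1 : M1 ≠ 0) (hM2 : M2 ≠ 0) (hM3 : M3 ≠ 0)
    (hK1 : K1.degree < M1.degree) (hK2 : K2.degree < M2.degree) (hK3 : K3.degree < M3.degree)
    (hdeg : M1.natDegree + M2.natDegree + M3.natDegree < f.natDegree)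
    (hid : C a1 * ((f - C γ1) * K1 * (M2 * M3)) + C a2 * ((f - C γ2) * K2 * (M1 * M3)) +
      C a3 * ((f - C γ3) * K3 * (M1 * M2)) = 0) : K1 = 0 := by
  set X0 := C a1 * (K1 * (M2 * M3)) + C a2 * (K2 * (M1 * M3)) + C a3 * (K3 * (M1 * M2)) with hX0
  set Z := C (a1 * γ1) * (K1 * (M2 * M3)) + C (a2 * γ2) * (K2 * (M1 * M3)) +
    C (a3 * γ3) * (K3 * (M1 * M2)) with hZ
  have h1 : f * X0 = Z := by
    rw [hX0, hZ]; simp only [C_mul]; linear_combination hid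
  have hlt : ∀ {A B D : K[X]}, B ≠ 0 → D ≠ 0 → ∀ {A' : K[X]}, A'.degree < A.degree → A ≠ 0 →
      A.natDegree + (B.natDegree + D.natDegree) < f.natDegree → ∀ x : K,
      (C x * (A' * (B * D))).natDegree < f.natDegree := by
    intro A B D hB hD A' hA hA0 hl x
    refine (natDegree_C_mul_le _ _).trans_lt ?_
    refine natDegree_mul_le.trans_lt ?_
    rw [natDegree_mul hB hD]
    have := natDegree_le_natDegree hA.le
    omega
  have hZd : Z.natDegree < f.natDegree := by
    refine (natDegree_add_le _ _).trans_lt (max_lt ((natDegree_add_le _ _).trans_lt (max_lt ?_ ?_)) ?_)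
    · exact hlt hM2 hM3 hK1 hM1 (by omega) _
    · exact hlt hM1 hM3 hK2 hM2 (by omega) _
    · exact hlt hM1 hM2 hK3 hM3 (by omega) _
  have hX00 : X0 = 0 := by
    by_contra hne
    have hf0 : f ≠ 0 := by rintro rfl; simp at hdeg
    have := congrArg natDegree h1
    rw [natDegree_mul hf0 hne] at this
    omega
  have h2 : M1 ∣ C a1 * K1 * M2 * M3 :=
    ⟨-(C a2 * K2 * M3 + C a3 * K3 * M2), by linear_combination hX00⟩
  have h3 := h12.dvd_of_dvd_mul_right (h13.dvd_of_dvd_mul_right h2)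
  have h4 := ((isUnit_C.2 (isUnit_iff_ne_zero.2 ha1)).dvd_mul_left).1 h3
  by_contra hne
  exact absurd hK1 (not_lt.2 (degree_le_of_dvd h4 hne))

lemma mv_base1 [Fintype K] [DecidableEq K] (p n : ℕ) (hp : p.Prime) [CharP K p] (hn : 0 < n)
    (hcard : Fintype.card K = p ^ n) (V : Finset K) (f : K[X]) (hV : 2 < V.card)
    (hVf : V = Finset.univ.image (fun a => f.eval a)) (hd : 0 < f.natDegree)
    (hdV : V.card * f.natDegree < p ^ n + f.natDegree) :
    ∃ t : K, t ≠ 0 ∧ derivative f ≠ 0 ∧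
    (∏ γ ∈ V, (X - C γ)).comp f = C t * (X - X ^ p ^ n) * derivative f ∧
    ∃ γ0 ∈ V, ∀ γ ∈ V, γ ≠ γ0 → (derivative (∏ γ ∈ V, (X - C γ))).eval γ = t := by
  set T : K[X] := ∏ γ ∈ V, (X - C γ) with hTdef
  have hTev : ∀ x, T.eval x = 0 ↔ x ∈ V := by
    intro x
    rw [hTdef, eval_prod, Finset.prod_eq_zero_iff]
    constructor
    · rintro ⟨y, hy, h⟩
      simp [sub_eq_zero] at h; rwa [h]
    · intro h; exact ⟨x, h, by simp⟩
  have hTd : T.natDegree = V.card := mv_prod_deg V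
  have hTsep : T.Separable := separable_prod_X_sub_C_iff'.2 (fun _ _ _ _ h => h)
  have hT' : ∀ γ ∈ V, (derivative T).eval γ ≠ 0 := by
    intro γ hγ
    have := hTsep.eval₂_derivative_ne_zero (RingHom.id K) (x := γ) (by
      simpa [eval₂_id] using (hTev γ).2 hγ)
    simpa [eval₂_id] using this
  set G : K[X] := X ^ p ^ n - X with hG
  have hGd : derivative G = -1 := mv_deriv_Xsub p n hn
  have hGe : ∀ a, G.eval a = 0 := by
    intro a; rw [hG, ← hcard]; simp [FiniteField.pow_card]
  set L : K → K[X] := fun γ => ∏ a ∈ Finset.univ.filter (fun a => f.eval a = γ), (X - C a) with hL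
  have hLm : ∀ γ, (L γ).Monic := fun γ => monic_prod_of_monic _ _ fun i _ => monic_X_sub_C i
  have hLdvd : ∀ (γ : K) (g : K[X]), (∀ a, f.eval a = γ → g.eval a = 0) → L γ ∣ g := by
    intro γ g hg
    apply mv_prod_dvd
    intro a ha
    exact hg a (Finset.mem_filter.1 ha).2
  have hM : ∀ γ, ∃ M, f - C γ = L γ * M := fun γ =>
    hLdvd γ _ (fun a ha => by simp [ha])
  choose M hM using hM
  have hfγ : ∀ γ, (f - C γ).natDegree = f.natDegree := fun γ => natDegree_sub_C
  have hfγ0 : ∀ γ, f - C γ ≠ 0 := by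
    intro γ h0
    have := hfγ γ
    rw [h0, natDegree_zero] at this; omega
  have hM0 : ∀ γ, M γ ≠ 0 := by
    intro γ h0
    have := hM γ
    rw [h0, mul_zero] at this; exact hfγ0 γ this
  have hLM : ∀ γ, (L γ).natDegree + (M γ).natDegree = f.natDegree := by
    intro γ
    rw [← natDegree_mul (hLm γ).ne_zero (hM0 γ), ← hM, hfγ]
  have hLprod : ∏ γ ∈ V, L γ = G := by
    rw [hG, ← hcard, ← mv_prod_univ]
    apply Finset.prod_fiberwise_of_maps_to
    intro a _
    rw [hVf]; exact Finset.mem_image_of_mem _ (Finset.mem_univ a)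
  set θ := ∏ γ ∈ V, M γ with hθ
  have hTf : T.comp f = G * θ := by
    rw [hTdef, prod_comp, ← hLprod, hθ, ← Finset.prod_mul_distrib]
    apply Finset.prod_congr rfl
    intro γ _
    rw [← hM]; simp
  have hGdeg : G.natDegree = p ^ n := by
    rw [hG, ← hcard]; exact FiniteField.X_pow_card_sub_X_natDegree_eq K Fintype.one_lt_card
  have hG0 : G ≠ 0 := by
    intro h0; rw [h0, derivative_zero] at hGd; simp at hGd
  have hθ0 : θ ≠ 0 := Finset.prod_ne_zero_iff.2 fun γ _ => hM0 γ
  have hθd : θ.natDegree < f.natDegree := by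
    have h1 := congrArg natDegree hTf
    rw [natDegree_comp, hTd, natDegree_mul hG0 hθ0, hGdeg] at h1
    omega
  have hθs : ∑ γ ∈ V, (M γ).natDegree < f.natDegree := by
    rw [← natDegree_prod _ _ fun γ _ => hM0 γ]; exact hθd
  have hM2 : ∀ γ ∈ V, ∀ δ ∈ V, γ ≠ δ → (M γ).natDegree + (M δ).natDegree < f.natDegree := by
    intro γ hγ δ hδ hne
    rw [← Finset.sum_pair (f := fun γ => (M γ).natDegree) hne]
    refine lt_of_le_of_lt (Finset.sum_le_sum_of_subset ?_) hθs
    intro x hx; simp at hx; rcases hx with rfl | rfl <;> assumption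
  have hcop : ∀ γ δ, γ ≠ δ → IsCoprime (f - C γ) (f - C δ) := by
    intro γ δ hne
    have h1 : (C (δ - γ) : K[X]) * C (δ - γ)⁻¹ = 1 := by
      rw [← C_mul, mul_inv_cancel₀ (sub_ne_zero.2 hne.symm), C_1]
    refine ⟨C (δ - γ)⁻¹, - C (δ - γ)⁻¹, ?_⟩
    rw [C_sub] at h1
    linear_combination h1
  have hLL : ∀ γ ∈ V, ∀ δ ∈ V, γ ≠ δ → ∀ g : K[X], g.natDegree < f.natDegree → L γ ∣ g → L δ ∣ g →
      g = 0 := by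
    intro γ hγ δ hδ hne g hg h1 h2
    by_contra h0
    have h3 : IsCoprime (L γ) (L δ) :=
      ((hcop γ δ hne).of_isCoprime_of_dvd_left ⟨_, hM γ⟩).of_isCoprime_of_dvd_right ⟨_, hM δ⟩
    have h4 := natDegree_le_of_dvd (h3.mul_dvd h1 h2) h0
    rw [natDegree_mul (hLm γ).ne_zero (hLm δ).ne_zero] at h4
    have := hM2 γ hγ δ hδ hne
    have := hLM γ
    have := hLM δ
    omega
  have hf1d := natDegree_derivative_lt (p := f) hd.ne'
  set A : K → K[X] := fun γ => C ((derivative T).eval γ) * derivative f + θ with hA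
  have hLA : ∀ γ, L γ ∣ A γ := by
    intro γ
    apply hLdvd
    intro a ha
    have h1 := congrArg (fun g => (derivative g).eval a) hTf
    simp only [derivative_comp, derivative_mul, hGd, eval_add, eval_mul, hGe, eval_comp, ha,
      eval_neg, eval_one] at h1
    simp only [hA, eval_add, eval_mul, eval_C]
    linear_combination h1
  have hAd : ∀ γ, (A γ).natDegree < f.natDegree := by
    intro γ
    refine (natDegree_add_le _ _).trans_lt (max_lt ?_ hθd)
    exact (natDegree_C_mul_le _ _).trans_lt hf1d
  have hex : ∃ γ ∈ V, A γ = 0 := by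
    obtain ⟨γ1, h1, γ2, h2, γ3, h3, h12, h13, h23⟩ := Finset.two_lt_card.1 hV
    have heq : ∀ γ ∈ V, ∀ δ ∈ V, γ ≠ δ → (derivative T).eval γ = (derivative T).eval δ →
        ∃ γ ∈ V, A γ = 0 := by
      intro γ hγ δ hδ hne ht
      refine ⟨γ, hγ, hLL γ hγ δ hδ hne _ (hAd γ) (hLA γ) ?_⟩
      have : A γ = A δ := by simp only [hA, ht]
      rw [this]; exact hLA δ
    by_cases e12 : (derivative T).eval γ1 = (derivative T).eval γ2
    · exact heq _ h1 _ h2 h12 e12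
    by_cases e13 : (derivative T).eval γ1 = (derivative T).eval γ3
    · exact heq _ h1 _ h3 h13 e13
    by_cases e23 : (derivative T).eval γ2 = (derivative T).eval γ3
    · exact heq _ h2 _ h3 h23 e23
    choose k hk using hLA
    have hkM : ∀ γ, (k γ).degree < (M γ).degree := by
      intro γ
      by_cases h0 : k γ = 0
      · rw [h0, degree_zero]; exact bot_lt_iff_ne_bot.2 (degree_ne_bot.2 (hM0 γ))
      · rw [← natDegree_lt_natDegree_iff h0]
        have h5 := hAd γ
        rw [hk γ, natDegree_mul (hLm γ).ne_zero h0, ← hLM γ] at h5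
        omega
    have hMc : ∀ γ δ, γ ≠ δ → IsCoprime (M γ) (M δ) := fun γ δ hne =>
      ((hcop γ δ hne).of_isCoprime_of_dvd_left ⟨L γ, by rw [hM γ]; ring⟩).of_isCoprime_of_dvd_right
        ⟨L δ, by rw [hM δ]; ring⟩
    refine ⟨γ1, h1, ?_⟩
    have hz : k γ1 = 0 := by
      refine mv_three (f := f) (γ1 := γ1) (γ2 := γ2) (γ3 := γ3)
        (a1 := (derivative T).eval γ2 - (derivative T).eval γ3)
        (a2 := (derivative T).eval γ3 - (derivative T).eval γ1)
        (a3 := (derivative T).eval γ1 - (derivative T).eval γ2)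
        (hMc γ1 γ2 h12) (hMc γ1 γ3 h13) (sub_ne_zero.2 e23) (hM0 _) (hM0 _) (hM0 _)
        (hkM γ1) (hkM γ2) (hkM γ3) ?_ ?_
      · have h6 : ∑ γ ∈ ({γ1, γ2, γ3} : Finset K), (M γ).natDegree < f.natDegree := by
          refine lt_of_le_of_lt (Finset.sum_le_sum_of_subset ?_) hθs
          intro x hx; simp at hx; rcases hx with rfl | rfl | rfl <;> assumption
        rw [Finset.sum_insert (by simp [h12, h13]), Finset.sum_pair h23] at h6
        omega
      · rw [hM γ1, hM γ2, hM γ3]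
        have k1 := hk γ1
        have k2 := hk γ2
        have k3 := hk γ3
        simp only [hA] at k1 k2 k3
        simp only [C_sub]
        generalize (C (eval γ1 (derivative T)) : K[X]) = t1 at *
        generalize (C (eval γ2 (derivative T)) : K[X]) = t2 at *
        generalize (C (eval γ3 (derivative T)) : K[X]) = t3 at *
        linear_combination -(M γ1 * M γ2 * M γ3) * ((t2 - t3) * k1 + (t3 - t1) * k2 + (t1 - t2) * k3)
    rw [hk γ1, hz, mul_zero]
  obtain ⟨γ, hγ, hAγ⟩ := hex
  set t := (derivative T).eval γ with ht
  have hθt : θ = - (C t * derivative f) := by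
    simp only [hA] at hAγ
    linear_combination hAγ
  have hTfin : T.comp f = C t * (X - X ^ p ^ n) * derivative f := by
    rw [hTf, hθt, hG]; ring
  have hf1 : derivative f ≠ 0 := by
    intro h0
    rw [h0, mul_zero, neg_zero] at hθt
    exact hθ0 hθt
  refine ⟨t, hT' γ hγ, hf1, hTfin, ?_⟩
  have hbad : ∀ δ ∈ V, (derivative T).eval δ ≠ t → L δ ∣ derivative f := by
    intro δ hδ hne
    have h1 : A δ = C ((derivative T).eval δ - t) * derivative f := by
      simp only [hA]; rw [hθt, C_sub]; ring
    have h2 := hLA δ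
    rw [h1] at h2
    exact ((isUnit_C.2 (isUnit_iff_ne_zero.2 (sub_ne_zero.2 hne))).dvd_mul_left).1 h2
  by_cases hb : ∃ δ ∈ V, (derivative T).eval δ ≠ t
  · obtain ⟨δ, hδ, hδt⟩ := hb
    refine ⟨δ, hδ, fun ε hε hne => ?_⟩
    by_contra hεt
    exact hf1 (hLL ε hε δ hδ hne _ hf1d (hbad ε hε hεt) (hbad δ hδ hδt))
  · push Not at hb
    exact ⟨γ, hγ, fun δ hδ _ => hb δ hδ⟩

end MV

section MV
variable {K : Type*} [Field K]

lemma mv_iter {Ω : Type*} [Monoid Ω] {p k : ℕ} {c : Ω} (hc : c ^ p ^ k = c) {i : ℕ} (h : k ∣ i) :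
    c ^ p ^ i = c := by
  obtain ⟨m, rfl⟩ := h
  induction m with
  | zero => simp
  | succ m ih => rw [mul_add, mul_one, pow_add, pow_mul, ih, hc]

lemma mv_ord {p e m : ℕ} (hp : p.Prime) (h : e ∣ p ^ m - 1) : orderOf (p : ZMod e) ∣ m := by
  apply orderOf_dvd_of_pow_eq_one
  have h1 : ((p ^ m - 1 : ℕ) : ZMod e) = 0 := (ZMod.natCast_eq_zero_iff _ _).2 h
  rw [Nat.cast_sub (Nat.one_le_pow _ _ hp.pos)] at h1
  push_cast at h1
  exact sub_eq_zero.1 h1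

lemma mv_ord' {p e : ℕ} (hp : p.Prime) : e ∣ p ^ orderOf (p : ZMod e) - 1 := by
  rw [← ZMod.natCast_eq_zero_iff, Nat.cast_sub (Nat.one_le_pow _ _ hp.pos)]
  push_cast
  rw [pow_orderOf_eq_one, sub_self]

lemma mv_mem {Ω : Type*} [Field Ω] [Algebra K Ω] [Fintype K] (x : Ω)
    (hx : x ^ Fintype.card K = x) : ∃ y : K, algebraMap K Ω y = x := by
  have h := congrArg (fun g => aeval x g) (mv_prod_univ (K := K))
  simp only [map_prod, map_sub, aeval_X, aeval_C, map_pow, hx, sub_self] at h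
  obtain ⟨y, _, hy⟩ := Finset.prod_eq_zero_iff.1 h
  exact ⟨y, (sub_eq_zero.1 hy).symm⟩

lemma mv_field [Fintype K] [DecidableEq K] (p n : ℕ) (hp : p.Prime) [CharP K p] (hn : 0 < n)
    (hcard : Fintype.card K = p ^ n) (V : Finset K) (hV : 2 < V.card) (γ : K) (hγ : γ ∈ V)
    (S : K[X]) (hS : X * S = (∏ γ ∈ V, (X - C γ)).comp (X + C γ)) (v : ℕ) (hv : 0 < v)
    (hsupp : ∀ j ∈ S.support, ∃ i, 1 + v * j = p ^ i) :
    ∃ k : ℕ, k ∣ n ∧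
      ∃ v : ℕ, 0 < v ∧ v ∣ p ^ k - 1 ∧
        ∃ U : Finset K, IsSubspaceOver (p ^ k) (↑U : Set K) ∧ (1 : K) ∈ U ∧
          ∃ a b : K, a ≠ 0 ∧ V = U.image (fun u => a * u ^ v + b) := by
  have := Fact.mk hp
  let Ω := AlgebraicClosure K
  have : CharP Ω p := charP_of_injective_algebraMap (algebraMap K Ω).injective p
  set ι := algebraMap K Ω with hι
  have hinj : Function.Injective ι := ι.injective
  set P : Ω → Ω := fun u => ∑ j ∈ S.support, ι (S.coeff j) * u ^ (1 + v * j) with hP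
  have hPu : ∀ u, P u = u * aeval (u ^ v) S := by
    intro u
    rw [aeval_def, eval₂_eq_sum, Polynomial.sum_def, Finset.mul_sum]
    refine Finset.sum_congr rfl fun j _ => ?_
    rw [pow_add, pow_mul]; ring
  have hW : ∀ u, P u = 0 ↔ ∃ x : K, x + γ ∈ V ∧ u ^ v = ι x := by
    intro u
    have h1 := congrArg (fun g => aeval (u ^ v) g) hS
    simp only [map_mul, aeval_X, aeval_comp, map_add, aeval_C, map_prod, map_sub] at h1
    have h2 : P u = 0 ↔ u ^ v * aeval (u ^ v) S = 0 := by
      rw [hPu, mul_eq_zero, mul_eq_zero, pow_eq_zero_iff hv.ne']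
    rw [h2, h1, Finset.prod_eq_zero_iff]
    constructor
    · rintro ⟨δ, hδ, h⟩
      refine ⟨δ - γ, by simpa using hδ, ?_⟩
      rw [map_sub]; linear_combination h
    · rintro ⟨x, hx, h⟩
      refine ⟨_, hx, ?_⟩
      rw [h, map_add]; ring
  have hPadd : ∀ u w, P (u + w) = P u + P w := by
    intro u w
    simp only [hP]
    rw [← Finset.sum_add_distrib]
    refine Finset.sum_congr rfl fun j hj => ?_
    obtain ⟨i, hi⟩ := hsupp j hj
    rw [hi, add_pow_char_pow]; ring
  have hP0 : P 0 = 0 := by rw [hPu, zero_mul]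
  -- degree of S
  have hSd : 2 ≤ S.natDegree := by
    have h1 := congrArg natDegree hS
    rw [natDegree_comp, natDegree_X_add_C, mv_prod_deg] at h1
    by_cases h0 : S = 0
    · rw [h0] at h1; simp at h1; omega
    · rw [natDegree_X_mul h0] at h1; omega
  have hS0 : S ≠ 0 := by rintro rfl; simp at hSd
  have hcopv : Nat.Coprime p v := by
    obtain ⟨i, hi⟩ := hsupp _ (natDegree_mem_support_of_nonzero hS0)
    have hi0 : i ≠ 0 := by
      rintro rfl
      have : 0 < v * S.natDegree := Nat.mul_pos hv (by omega)
      simp at hi; omega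
    rw [Nat.Prime.coprime_iff_not_dvd hp]
    intro h1
    have h2 : p ∣ 1 + v * S.natDegree := hi ▸ dvd_pow_self p hi0
    exact hp.one_lt.ne' (Nat.dvd_one.1 ((Nat.dvd_add_left (h1.mul_right _)).1 h2))
  set k0 := orderOf (p : ZMod v) with hk0
  have hk0v : v ∣ p ^ k0 - 1 := mv_ord' hp
  have hk0i : ∀ j ∈ S.support, ∃ i, 1 + v * j = p ^ i ∧ k0 ∣ i := by
    intro j hj
    obtain ⟨i, hi⟩ := hsupp j hj
    exact ⟨i, hi, mv_ord hp ⟨j, by omega⟩⟩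
  have hk0pos : 0 < k0 := by
    obtain ⟨i, hi, hki⟩ := hk0i _ (natDegree_mem_support_of_nonzero hS0)
    have hi0 : i ≠ 0 := by
      rintro rfl
      have : 0 < v * S.natDegree := Nat.mul_pos hv (by omega)
      simp at hi; omega
    exact Nat.pos_of_dvd_of_pos hki (by omega)
  have hpk : 1 < p ^ k0 := Nat.one_lt_pow hk0pos.ne' hp.one_lt
  have hPmul : ∀ c u, c ^ p ^ k0 = c → P (c * u) = c * P u := by
    intro c u hc
    simp only [hP]
    rw [Finset.mul_sum]
    refine Finset.sum_congr rfl fun j hj => ?_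
    obtain ⟨i, hi, hki⟩ := hk0i j hj
    rw [hi, mul_pow, mv_iter hc hki]; ring
  -- pick w1
  obtain ⟨δ, hδ, hδγ⟩ : ∃ δ ∈ V, δ ≠ γ := by
    by_contra hcon
    push Not at hcon
    have : V ⊆ {γ} := fun x hx => Finset.mem_singleton.2 (hcon x hx)
    have := Finset.card_le_card this
    simp at this; omega
  set a := δ - γ with ha
  have ha0 : a ≠ 0 := sub_ne_zero.2 hδγ
  obtain ⟨w1, hw1⟩ := IsAlgClosed.exists_pow_nat_eq (ι a) hv
  have hιa : ι a ≠ 0 := by rwa [Ne, map_eq_zero]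
  have hw10 : w1 ≠ 0 := by
    rintro rfl
    rw [zero_pow hv.ne'] at hw1; exact hιa hw1.symm
  have hw1P : P w1 = 0 := (hW w1).2 ⟨a, by simpa [ha] using hδ, hw1⟩
  -- the key characterisation
  have hW1 : ∀ u, P (u * w1) = 0 ↔ ∃ x : K, a * x + γ ∈ V ∧ u ^ v = ι x := by
    intro u
    rw [hW]
    constructor
    · rintro ⟨x, hx, h⟩
      refine ⟨x / a, by rwa [mul_div_cancel₀ _ ha0], ?_⟩
      rw [mul_pow, hw1] at h
      rw [map_div₀, ← h]; exact (mul_div_cancel_right₀ _ hιa).symm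
    · rintro ⟨x, hx, h⟩
      exact ⟨a * x, hx, by rw [mul_pow, hw1, h, map_mul]; ring⟩
  have hqfix : ∀ x : Ω, x ^ p ^ n = x → ∃ y : K, ι y = x := fun x hx =>
    mv_mem x (by rw [hcard]; exact hx)
  have hKfix : ∀ y : K, ι y ^ p ^ n = ι y := by
    intro y; rw [← map_pow, ← hcard, FiniteField.pow_card]
  have hone : ∀ c, c ^ p ^ k0 = c → P (c * w1) = 0 := by
    intro c hc; rw [hPmul c w1 hc, hw1P, mul_zero]
  have hprim : ∀ e, Nat.Coprime p e → 0 < e → ∃ ζ : Ω, IsPrimitiveRoot ζ e := by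
    intro e he he0
    have : NeZero (e : Ω) := ⟨by
      rw [Ne, CharP.cast_eq_zero_iff Ω p]
      exact (Nat.Prime.coprime_iff_not_dvd hp).1 he⟩
    have : NeZero e := ⟨he0.ne'⟩
    exact HasEnoughRootsOfUnity.exists_primitiveRoot Ω e
  have hqm : ∀ x : Ω, x ≠ 0 → ∀ m, (x ^ p ^ m = x ↔ x ^ (p ^ m - 1) = 1) := by
    intro x hx m
    have h1 : p ^ m = (p ^ m - 1) + 1 := by have := Nat.one_le_pow m p hp.pos; omega
    conv_lhs => rw [h1, pow_succ]
    constructor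
    · intro h; exact mul_right_cancel₀ hx (by rw [h, one_mul])
    · intro h; rw [h, one_mul]
  by_cases hcase : ∀ u, P (u * w1) = 0 → u ^ p ^ k0 = u
  · -- case A
    obtain ⟨e, he⟩ := hk0v
    have he0 : 0 < e := by
      rcases Nat.eq_zero_or_pos e with h0 | h0
      · rw [h0] at he; omega
      · exact h0
    have hcope : Nat.Coprime p e := by
      rw [Nat.Prime.coprime_iff_not_dvd hp]
      intro h1
      have h2 : p ∣ p ^ k0 - 1 := he ▸ h1.mul_left v
      have h3 : p ∣ p ^ k0 := dvd_pow_self p hk0pos.ne'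
      have h4 := (Nat.dvd_sub h3 h2)
      rw [Nat.sub_sub_self hpk.le] at h4
      exact hp.one_lt.ne' (Nat.dvd_one.1 h4)
    -- y ^ e = 1 gives membership
    have hye : ∀ y : Ω, y ^ e = 1 → ∃ x : K, a * x + γ ∈ V ∧ y = ι x := by
      intro y hy
      obtain ⟨u, hu⟩ := IsAlgClosed.exists_pow_nat_eq y hv
      have hy0 : y ≠ 0 := by rintro rfl; rw [zero_pow he0.ne'] at hy; exact zero_ne_one hy
      have hu0 : u ≠ 0 := by rintro rfl; rw [zero_pow hv.ne'] at hu; exact hy0 hu.symm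
      have h1 : u ^ p ^ k0 = u := by rw [hqm u hu0, he, pow_mul, hu, hy]
      obtain ⟨x, hx, h⟩ := (hW1 u).1 (hone u h1)
      exact ⟨x, hx, by rw [← hu, h]⟩
    have hyV : ∀ x : K, a * x + γ ∈ V → x ≠ 0 → x ^ e = 1 := by
      intro x hx hx0
      obtain ⟨u, hu⟩ := IsAlgClosed.exists_pow_nat_eq (ι x) hv
      have h1 := hcase u ((hW1 u).2 ⟨x, hx, hu⟩)
      have hu0 : u ≠ 0 := by
        rintro rfl; rw [zero_pow hv.ne'] at hu
        exact hx0 ((map_eq_zero ι).1 hu.symm)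
      rw [hqm u hu0, he, pow_mul, hu] at h1
      apply hinj
      rw [map_pow, h1, map_one]
    obtain ⟨ζ, hζ⟩ := hprim e hcope he0
    have heq : e ∣ p ^ n - 1 := by
      obtain ⟨x, _, hx⟩ := hye ζ hζ.pow_eq_one
      apply hζ.dvd_of_pow_eq_one
      rw [← hqm ζ (hζ.ne_zero he0.ne'), hx, hKfix]
    have hkn : orderOf (p : ZMod e) ∣ n := mv_ord hp heq
    set k := orderOf (p : ZMod e) with hk
    have hkpos : 0 < k := Nat.pos_of_dvd_of_pos hkn hn
    obtain ⟨v', hv'⟩ : e ∣ p ^ k - 1 := mv_ord' hp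
    have hpk' : 1 < p ^ k := Nat.one_lt_pow hkpos.ne' hp.one_lt
    have hv'0 : 0 < v' := by
      rcases Nat.eq_zero_or_pos v' with h0 | h0
      · rw [h0] at hv'; omega
      · exact h0
    refine ⟨k, hkn, v', hv'0, ⟨e, by rw [hv']; ring⟩, Finset.univ.filter (fun c => c ^ p ^ k = c),
      ?_, ?_, a, γ, ha0, ?_⟩
    · refine ⟨?_, ?_, ?_, ?_⟩
      · simp [hp.ne_zero]
      · intro x hx y hy
        simp only [Finset.coe_filter, Finset.mem_univ, true_and, Set.mem_ofPred_eq] at hx hy ⊢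
        rw [add_pow_char_pow, hx, hy]
      · intro x hx
        simp only [Finset.coe_filter, Finset.mem_univ, true_and, Set.mem_ofPred_eq] at hx ⊢
        have := map_neg (iterateFrobenius K p k) x
        rw [iterateFrobenius_def, iterateFrobenius_def, hx] at this
        exact this
      · intro c hc x hx
        simp only [Finset.coe_filter, Finset.mem_univ, true_and, Set.mem_ofPred_eq] at hx ⊢
        rw [mul_pow, hc, hx]
    · simp
    · ext δ'
      simp only [Finset.mem_image, Finset.mem_filter, Finset.mem_univ, true_and]
      constructor
      · intro hδ'
        set x := (δ' - γ) / a with hx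
        have hax : a * x + γ = δ' := by rw [hx, mul_div_cancel₀ _ ha0]; ring
        by_cases hx0 : x = 0
        · refine ⟨0, by simp [hp.ne_zero], ?_⟩
          rw [zero_pow hv'0.ne', ← hx0, hax]
        · have h1 := hyV x (by rwa [hax]) hx0
          obtain ⟨u, hu⟩ := IsAlgClosed.exists_pow_nat_eq (ι x) hv'0
          have hu0 : u ≠ 0 := by
            rintro rfl; rw [zero_pow hv'0.ne'] at hu
            exact hx0 ((map_eq_zero ι).1 hu.symm)
          have h2 : u ^ p ^ k = u := by
            rw [hqm u hu0, hv', mul_comm, pow_mul, hu, ← map_pow, h1, map_one]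
          obtain ⟨y, hy⟩ := hqfix u (mv_iter h2 hkn)
          refine ⟨y, hinj (by rw [map_pow, hy, h2]), ?_⟩
          have h3 : y ^ v' = x := hinj (by rw [map_pow, hy, hu])
          rw [h3, hax]
      · rintro ⟨u, hu, rfl⟩
        by_cases hu0 : u = 0
        · rw [hu0, zero_pow hv'0.ne', mul_zero, zero_add]; exact hγ
        · have hιu : ι u ≠ 0 := by rwa [Ne, map_eq_zero]
          have h1 : (ι u ^ v') ^ e = 1 := by
            rw [← pow_mul, mul_comm, ← hv', ← hqm _ hιu, ← map_pow, hu]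
          obtain ⟨x, hx, h⟩ := hye _ h1
          rw [← map_pow] at h
          rw [hinj h]; exact hx
  · -- case B
    push Not at hcase
    obtain ⟨w0, hw0, hw0K⟩ := hcase
    have hαu : ∀ u, P (u * w1) = 0 → ∃ ζ : Ω, ζ ^ p ^ k0 = ζ ∧ u ^ p ^ n = ζ * u := by
      intro u hu
      by_cases hu0 : u = 0
      · exact ⟨1, one_pow _, by rw [hu0, zero_pow (pow_ne_zero _ hp.ne_zero), mul_zero]⟩
      · obtain ⟨x, _, hx⟩ := (hW1 u).1 hu
        refine ⟨u ^ p ^ n / u, ?_, (div_mul_cancel₀ _ hu0).symm⟩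
        have h1 : (u ^ p ^ n / u) ^ v = 1 := by
          rw [div_pow, ← pow_mul, mul_comm, pow_mul, hx, hKfix]
          exact div_self (by rw [← hx]; exact pow_ne_zero _ hu0)
        rw [hqm _ (div_ne_zero (pow_ne_zero _ hu0) hu0)]
        obtain ⟨e, he⟩ := hk0v
        rw [he, pow_mul, h1, one_pow]
    -- K0 closed under operations
    have hsub : ∀ x y : Ω, x ^ p ^ k0 = x → y ^ p ^ k0 = y → (x - y) ^ p ^ k0 = x - y := by
      intro x y hx hy; rw [sub_pow_char_pow, hx, hy]
    have hmul : ∀ x y : Ω, x ^ p ^ k0 = x → y ^ p ^ k0 = y → (x * y) ^ p ^ k0 = x * y := by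
      intro x y hx hy; rw [mul_pow, hx, hy]
    have hdiv : ∀ x y : Ω, x ^ p ^ k0 = x → y ^ p ^ k0 = y → (x / y) ^ p ^ k0 = x / y := by
      intro x y hx hy; rw [div_pow, hx, hy]
    have hfr : ∀ c : Ω, c ^ p ^ k0 = c → (c ^ p ^ n) ^ p ^ k0 = c ^ p ^ n := by
      intro c hc; rw [← pow_mul, mul_comm, pow_mul, hc]
    have hkey : ∀ w, P (w * w1) = 0 → w ^ p ^ k0 ≠ w → ∀ c : Ω, c ^ p ^ k0 = c →
        ∃ ζ, w ^ p ^ n = ζ * w ∧ c ^ p ^ n * ζ = c := by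
      intro w hw hwK c hc
      obtain ⟨ζ, hζ, hζw⟩ := hαu w hw
      obtain ⟨η, hη, hηw⟩ := hαu (1 + c * w) (by
        rw [add_mul, hPadd, one_mul, hw1P, mul_assoc, hPmul _ _ hc, hw]; simp)
      refine ⟨ζ, hζw, ?_⟩
      rw [add_pow_char_pow, one_pow, mul_pow, hζw] at hηw
      have h1 : 1 - η = (η * c - c ^ p ^ n * ζ) * w := by linear_combination hηw
      have h2 : η * c - c ^ p ^ n * ζ = 0 := by
        by_contra hne
        apply hwK
        have h3 : w = (1 - η) / (η * c - c ^ p ^ n * ζ) := by rw [h1]; exact (mul_div_cancel_left₀ _ hne).symm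
        rw [h3]
        exact hdiv _ _ (hsub _ _ (one_pow _) hη)
          (hsub _ _ (hmul _ _ hη hc) (hmul _ _ (hfr c hc) hζ))
      rw [h2, zero_mul] at h1
      linear_combination -h2 - c * h1
    have hfixw : ∀ w, P (w * w1) = 0 → w ^ p ^ k0 ≠ w → w ^ p ^ n = w := by
      intro w hw hwK
      obtain ⟨ζ, h1, h2⟩ := hkey w hw hwK 1 (one_pow _)
      rw [one_pow, one_mul] at h2
      rw [h1, h2, one_mul]
    have hfixc : ∀ c : Ω, c ^ p ^ k0 = c → c ^ p ^ n = c := by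
      intro c hc
      obtain ⟨ζ, h1, h2⟩ := hkey w0 hw0 hw0K c hc
      rw [hfixw w0 hw0 hw0K] at h1
      have hw00 : w0 ≠ 0 := by
        rintro rfl; exact hw0K (zero_pow (pow_ne_zero _ hp.ne_zero))
      have : ζ = 1 := mul_right_cancel₀ hw00 (by rw [← h1, one_mul])
      rw [this, mul_one] at h2; exact h2
    have hfix : ∀ w, P (w * w1) = 0 → ∃ y : K, ι y = w := by
      intro w hw
      apply hqfix
      by_cases hwK : w ^ p ^ k0 = w
      · exact hfixc w hwK
      · exact hfixw w hw hwK
    obtain ⟨ζ, hζ⟩ := hprim v hcopv hv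
    have hvq : v ∣ p ^ n - 1 := by
      have hζ0 := hζ.ne_zero hv.ne'
      apply hζ.dvd_of_pow_eq_one
      rw [← hqm ζ hζ0]
      apply hfixc
      rw [hqm ζ hζ0]
      obtain ⟨e, he⟩ := hk0v
      rw [he, pow_mul, hζ.pow_eq_one, one_pow]
    classical
    refine ⟨k0, mv_ord hp hvq, v, hv, hk0v, Finset.univ.filter (fun c => P (ι c * w1) = 0),
      ?_, ?_, a, γ, ha0, ?_⟩
    · have hsm : ∀ c : K, c ^ p ^ k0 = c → ∀ x, P (ι x * w1) = 0 → P (ι (c * x) * w1) = 0 := by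
        intro c hc x hx
        rw [map_mul, mul_assoc, hPmul _ _ (by rw [← map_pow, hc]), hx, mul_zero]
      refine ⟨?_, ?_, ?_, ?_⟩
      · simp [hP0]
      · intro x hx y hy
        simp only [Finset.coe_filter, Finset.mem_univ, true_and, Set.mem_ofPred_eq] at hx hy ⊢
        rw [map_add, add_mul, hPadd, hx, hy, add_zero]
      · intro x hx
        simp only [Finset.coe_filter, Finset.mem_univ, true_and, Set.mem_ofPred_eq] at hx ⊢
        have h1 := map_neg (iterateFrobenius K p k0) 1
        rw [iterateFrobenius_def, iterateFrobenius_def, one_pow] at h1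
        have := hsm (-1) h1 x hx
        rwa [neg_one_mul] at this
      · intro c hc x hx
        simp only [Finset.coe_filter, Finset.mem_univ, true_and, Set.mem_ofPred_eq] at hx ⊢
        exact hsm c hc x hx
    · simp [hw1P]
    · ext δ'
      simp only [Finset.mem_image, Finset.mem_filter, Finset.mem_univ, true_and]
      constructor
      · intro hδ'
        set x := (δ' - γ) / a with hx
        have hax : a * x + γ = δ' := by rw [hx, mul_div_cancel₀ _ ha0]; ring
        obtain ⟨u, hu⟩ := IsAlgClosed.exists_pow_nat_eq (ι x) hv
        have h1 := (hW1 u).2 ⟨x, by rwa [hax], hu⟩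
        obtain ⟨y, hy⟩ := hfix u h1
        refine ⟨y, by rw [hy]; exact h1, ?_⟩
        have h3 : y ^ v = x := hinj (by rw [map_pow, hy, hu])
        rw [h3, hax]
      · rintro ⟨u, hu, rfl⟩
        obtain ⟨x, hx, h⟩ := (hW1 _).1 hu
        rw [← map_pow] at h
        rw [hinj h]; exact hx

end MV

/-- the value set of any MVSP with `#V_F > 2` is of the form `a · U^v + b` for
an `𝔽_{p^k}`-subspace `U ⊆ 𝔽_q` with `1 ∈ U` and a positive divisor `v` of `p^k - 1`. -/
theorem stmt_13 (p n : ℕ) (hp : p.Prime) (hn : 0 < n)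
    (F : Type) [Field F] [Fintype F] [DecidableEq F]
    (hcard : Fintype.card F = p ^ n)
    (f : F[X]) (hf : IsMVSP f) (hV : 2 < (valueSet f).card) :
    ∃ k : ℕ, k ∣ n ∧
      ∃ v : ℕ, 0 < v ∧ v ∣ p ^ k - 1 ∧
        ∃ U : Finset F, IsSubspaceOver (p ^ k) (↑U : Set F) ∧ (1 : F) ∈ U ∧
          ∃ a b : F, a ≠ 0 ∧ valueSet f = U.image (fun u => a * u ^ v + b) := by
  have := Fact.mk hp
  have hchar : CharP F p := by
    obtain ⟨q, hq⟩ := CharP.exists F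
    obtain ⟨m, hq', hm⟩ := FiniteField.card F q
    rw [hcard] at hm
    have h1 : p ∣ q ^ (m : ℕ) := hm ▸ dvd_pow_self p hn.ne'
    have h2 := (Nat.prime_dvd_prime_iff_eq hp hq').1 (hp.dvd_of_dvd_pow h1)
    rw [h2]; exact hq
  obtain ⟨hd, hc⟩ := hf
  have hdV : (valueSet f).card * f.natDegree < p ^ n + f.natDegree := by
    have h1 := Nat.div_mul_le_self (Fintype.card F - 1) f.natDegree
    have h2 : 0 < p ^ n := pow_pos hp.pos n
    rw [hc, add_mul, one_mul]
    rw [hcard] at h1 ⊢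
    omega
  obtain ⟨t, ht, hf1, hTf, γ0, hγ0, htγ⟩ :=
    mv_base1 p n hp hn hcard (valueSet f) f hV rfl hd hdV
  obtain ⟨γ, hγ, S, hS, v, hv, hsupp⟩ := mv_core p n hp hn hcard (valueSet f) f hV (by
    intro γ hγ
    obtain ⟨a, _, ha⟩ := Finset.mem_image.1 hγ
    exact ⟨a, ha⟩) t ht hf1 hTf γ0 hγ0 htγ
  exact mv_field p n hp hn hcard (valueSet f) hV γ hγ S hS v hv hsupp
end

section
/- Let p be a prime, n ≥ 1, q = p^n, k a divisor of n, v a positive divisor of p^k − 1, and let U be an 𝔽_{p^k}-subspace of 𝔽_q with #U^v > 2. Then for every F ∈ 𝔽_q[x]: F ∈ 𝒫(U, q) if and only if F^v ∈ 𝒫(U^v, q). -/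
open Polynomial

theorem card_image_pow_aux {F : Type} [Field F] [Fintype F] [DecidableEq F] (v : ℕ) (hv : 0 < v)
    (hvq : v ∣ Fintype.card F - 1) (U : Finset F) (h0 : (0 : F) ∈ U)
    (hz : ∀ z : F, z ^ v = 1 → ∀ x ∈ U, z * x ∈ U) :
    U.card = v * ((U.image (fun u => u ^ v)).card - 1) + 1 := by
  obtain ⟨w, hw⟩ : ∃ w : F, IsPrimitiveRoot w v := by
    obtain ⟨g, hg⟩ := IsCyclic.exists_ofOrder_eq_natCard (α := Fˣ)
    have h1 : IsPrimitiveRoot g (Nat.card Fˣ) := hg ▸ IsPrimitiveRoot.orderOf g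
    have h2 : Nat.card Fˣ = Fintype.card F - 1 := by
      rw [Nat.card_eq_fintype_card, Fintype.card_units]
    obtain ⟨c, hc⟩ := hvq
    rw [h2] at h1
    have hpos : 0 < Fintype.card F - 1 := by
      have := Fintype.one_lt_card (α := F)
      omega
    have h3 := h1.pow hpos (b := v) (a := c) (by rw [hc, mul_comm])
    exact ⟨_, (IsPrimitiveRoot.coe_units_iff).2 h3⟩
  have hfib : ∀ b ∈ (U.erase 0).image (fun u => u ^ v),
      ((U.erase 0).filter (fun u => u ^ v = b)).card = v := by
    intro b hb
    obtain ⟨u, hu, rfl⟩ := Finset.mem_image.1 hb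
    obtain ⟨hu0, huU⟩ := Finset.mem_erase.1 hu
    have : (U.erase 0).filter (fun x => x ^ v = u ^ v)
        = (nthRootsFinset v (1 : F)).image (fun z => z * u) := by
      ext x
      simp only [Finset.mem_filter, Finset.mem_erase, Finset.mem_image, mem_nthRootsFinset hv]
      constructor
      · rintro ⟨⟨hx0, hxU⟩, hx⟩
        refine ⟨x / u, ?_, div_mul_cancel₀ _ hu0⟩
        rw [div_pow, hx, div_self (pow_ne_zero _ hu0)]
      · rintro ⟨z, hz1, rfl⟩
        refine ⟨⟨mul_ne_zero ?_ hu0, hz z hz1 u huU⟩, by rw [mul_pow, hz1, one_mul]⟩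
        rintro rfl
        rw [zero_pow hv.ne'] at hz1
        exact zero_ne_one hz1
    rw [this, Finset.card_image_of_injective _ (mul_left_injective₀ hu0), hw.card_nthRootsFinset]
  have hcount : (U.erase 0).card = v * ((U.erase 0).image (fun u => u ^ v)).card := by
    rw [Finset.card_eq_sum_card_image (fun u : F => u ^ v) (U.erase 0),
      Finset.sum_congr rfl hfib, Finset.sum_const, smul_eq_mul, mul_comm]
  have himg : (U.image (fun u => u ^ v)).card = ((U.erase 0).image (fun u => u ^ v)).card + 1 := by
    conv_lhs => rw [← Finset.insert_erase h0, Finset.image_insert]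
    rw [Finset.card_insert_of_notMem]
    intro h
    obtain ⟨u, hu, h⟩ := Finset.mem_image.1 h
    rw [zero_pow hv.ne'] at h
    exact (Finset.mem_erase.1 hu).1 (eq_zero_of_pow_eq_zero h)
  rw [himg, Nat.add_sub_cancel, ← hcount, Finset.card_erase_add_one h0]

/-- `F ∈ 𝒫(U, q)` if and only if `F^v ∈ 𝒫(U^v, q)`. -/
theorem stmt_14 (p n k v : ℕ) (hp : p.Prime) (hn : 0 < n) (hk : k ∣ n)
    (hv : 0 < v) (hvd : v ∣ p ^ k - 1)
    (F : Type) [Field F] [Fintype F] [DecidableEq F]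
    (hcard : Fintype.card F = p ^ n)
    (U : Finset F) (hU : IsSubspaceOver (p ^ k) (↑U : Set F))
    (hUv : 2 < (U.image (fun u => u ^ v)).card) :
    ∀ f : F[X], f ∈ MVSPset U ↔ f ^ v ∈ MVSPset (U.image (fun u => u ^ v)) := by
  intro f
  obtain ⟨hU0, -, -, hUm⟩ := hU
  have hz : ∀ z : F, z ^ v = 1 → ∀ x ∈ U, z * x ∈ U := by
    intro z hz1 x hx
    refine hUm z ?_ x hx
    obtain ⟨c, hc⟩ := hvd
    have hpk : p ^ k = v * c + 1 := by
      have := pow_pos hp.pos k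
      omega
    rw [hpk, pow_succ, pow_mul, hz1, one_pow, one_mul]
  have hvq : v ∣ Fintype.card F - 1 := by
    refine hvd.trans ?_
    obtain ⟨m, rfl⟩ := hk
    rw [hcard, pow_mul]
    simpa using Nat.sub_dvd_pow_sub_pow (p ^ k) 1 m
  have hc := card_image_pow_aux v hv hvq U hU0 hz
  have hvs : valueSet (f ^ v) = (valueSet f).image (fun u => u ^ v) := by
    simp only [valueSet, Finset.image_image, eval_pow]
    rfl
  have hdeg : (f ^ v).natDegree = f.natDegree * v := by rw [natDegree_pow, mul_comm]
  set N := (U.image (fun u => u ^ v)).card with hN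
  constructor
  · rintro ⟨⟨hd, hcf⟩, hval⟩
    have hval' : valueSet (f ^ v) = U.image (fun u => u ^ v) := by rw [hvs, hval]
    refine ⟨⟨?_, ?_⟩, hval'⟩
    · rw [hdeg]
      exact Nat.mul_pos hd hv
    · rw [hval', ← hN, hdeg, ← Nat.div_div_eq_div_mul]
      rw [hval, hc] at hcf
      rw [← Nat.add_right_cancel hcf, Nat.mul_div_cancel_left _ hv]
      omega
  · rintro ⟨⟨hd, hcf⟩, hval⟩
    rw [hdeg] at hd hcf
    rw [hval, ← hN, ← Nat.div_div_eq_div_mul] at hcf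
    have hd' : 0 < f.natDegree := Nat.pos_of_mul_pos_right hd
    have hsub : valueSet f ⊆ U := by
      intro y hy
      have h1 : y ^ v ∈ U.image (fun u => u ^ v) := by
        rw [← hval, hvs]
        exact Finset.mem_image_of_mem _ hy
      obtain ⟨u, hu, huy⟩ := Finset.mem_image.1 h1
      by_cases hu0 : u = 0
      · subst hu0
        rw [zero_pow hv.ne'] at huy
        rwa [eq_zero_of_pow_eq_zero huy.symm]
      · have := hz (y / u) (by rw [div_pow, huy, div_self]; rw [← huy]; exact pow_ne_zero _ hu0) u hu
        rwa [div_mul_cancel₀ _ hu0] at this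
    have hle := Finset.card_le_card hsub
    have hq : Fintype.card F ≤ f.natDegree * (valueSet f).card :=
      FiniteField.card_image_polynomial_eval (natDegree_pos_iff_degree_pos.1 hd')
    have hq1 := Fintype.card_pos (α := F)
    have h1 : (Fintype.card F - 1) / f.natDegree < (valueSet f).card := by
      rw [Nat.div_lt_iff_lt_mul hd', mul_comm]
      omega
    have h2 : U.card ≤ (Fintype.card F - 1) / f.natDegree + 1 := by
      rw [hc, hcf, Nat.add_sub_cancel]
      exact Nat.add_le_add_right (Nat.mul_div_le _ _) 1
    have heq : valueSet f = U := Finset.eq_of_subset_of_card_le hsub (by omega)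
    exact ⟨⟨hd', by omega⟩, heq⟩
end

section
/- Let p be a prime, n ≥ 1, q = p^n, k a divisor of n, v a positive divisor of p^k − 1, and let U be an 𝔽_{p^k}-subspace of 𝔽_q with #U^v > 2. Then for all a, b ∈ 𝔽_q with a ≠ 0, the set S = {a·u^v + b : u ∈ U} satisfies 𝒫(S, q) ≠ ∅, i.e., there exists an MVSP F ∈ 𝔽_q[x] with V_F = S. -/
open Polynomial

theorem sub_add_aux {R : Type*} [CommRing R] [IsDomain R] (U : Finset R)
    (h0 : (0 : R) ∈ U) (hadd : ∀ x ∈ U, ∀ y ∈ U, x + y ∈ U) (hneg : ∀ x ∈ U, -x ∈ U) (a b : R) :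
    ∏ u ∈ U, (a + b - u) = ∏ u ∈ U, (a - u) + ∏ u ∈ U, (b - u) := by
  classical
  set G : R[X] := ∏ u ∈ U, (X - C u) with hG
  have hGm : G.Monic := monic_prod_of_monic _ _ (fun u _ => monic_X_sub_C u)
  have hGe : ∀ x, G.eval x = ∏ u ∈ U, (x - u) := fun x => by simp [hG, eval_prod]
  have hGd : G.natDegree = U.card := by
    rw [hG, natDegree_prod_of_monic _ _ (fun u _ => monic_X_sub_C u)]; simp
  have hGd' : G.degree = (U.card : ℕ) := by rw [degree_eq_natDegree hGm.ne_zero, hGd]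
  have hpos : 0 < U.card := Finset.card_pos.mpr ⟨0, h0⟩
  have hcm : (G.comp (X + C b)).Monic := hGm.comp_X_add_C b
  have hcd : (G.comp (X + C b)).degree = (U.card : ℕ) := by
    rw [degree_eq_natDegree hcm.ne_zero, natDegree_comp, natDegree_X_add_C, mul_one, hGd]
  have hz : G.comp (X + C b) - G - C (G.eval b) = 0 := by
    apply eq_zero_of_degree_lt_of_eval_finset_eq_zero U
    · refine lt_of_le_of_lt (degree_sub_le _ _) (max_lt ?_ ?_)
      · rw [← hcd]
        apply degree_sub_lt (by rw [hcd, hGd']) hcm.ne_zero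
        rw [hcm.leadingCoeff, hGm.leadingCoeff]
      · exact lt_of_le_of_lt degree_C_le (by exact_mod_cast hpos)
    · intro w hw
      have h1 : G.eval w = 0 := by
        rw [hGe]; exact Finset.prod_eq_zero hw (sub_self w)
      have h2 : G.eval (w + b) = G.eval b := by
        rw [hGe, hGe]
        refine Finset.prod_bij' (fun u _ => u + -w) (fun u _ => u + w) ?_ ?_ ?_ ?_ ?_
        · intro u hu; exact hadd _ hu _ (hneg _ hw)
        · intro u hu; exact hadd _ hu _ hw
        · intro u _; ring
        · intro u _; ring
        · intro u _; ring
      simp [eval_comp, h1, h2]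
  have := congrArg (eval a) hz
  simp only [eval_sub, eval_comp, eval_add, eval_X, eval_C, eval_zero, hGe] at this
  linear_combination this

theorem exists_lin {F : Type*} [Field F] [Fintype F] [DecidableEq F] (U : Finset F)
    (h0 : (0 : F) ∈ U) (hadd : ∀ x ∈ U, ∀ y ∈ U, x + y ∈ U) (hneg : ∀ x ∈ U, -x ∈ U) :
    ∃ P : F[X], P.Monic ∧ P.natDegree * U.card = Fintype.card F ∧ valueSet P = U := by
  set M : F[X] := ∏ u ∈ U, (X - C u) with hM
  have hMm : M.Monic := monic_prod_of_monic _ _ (fun u _ => monic_X_sub_C u)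
  have hMe : ∀ x, M.eval x = ∏ u ∈ U, (x - u) := fun x => by simp [hM, eval_prod]
  have hMd : M.natDegree = U.card := by
    rw [hM, natDegree_prod_of_monic _ _ (fun u _ => monic_X_sub_C u)]; simp
  have hpos : 0 < U.card := Finset.card_pos.mpr ⟨0, h0⟩
  have hM0 : ∀ x, M.eval x = 0 ↔ x ∈ U := by
    intro x
    rw [hMe, Finset.prod_eq_zero_iff]
    constructor
    · rintro ⟨u, hu, h⟩; rw [sub_eq_zero.mp h]; exact hu
    · intro h; exact ⟨x, h, sub_self x⟩
  have hMadd : ∀ x y, M.eval (x + y) = M.eval x + M.eval y := by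
    intro x y; rw [hMe, hMe, hMe]; exact sub_add_aux U h0 hadd hneg x y
  have hMc : ∀ A : F[X], M.comp A = ∏ u ∈ U.image C, (A - u) := by
    intro A
    rw [Finset.prod_image (fun x _ y _ h => C_injective h), hM, prod_comp]
    simp
  have hMcadd : ∀ A B : F[X], M.comp (A + B) = M.comp A + M.comp B := by
    intro A B
    rw [hMc, hMc, hMc]
    apply sub_add_aux
    · exact Finset.mem_image.mpr ⟨0, h0, C_0⟩
    · simp only [Finset.mem_image]
      rintro _ ⟨x, hx, rfl⟩ _ ⟨y, hy, rfl⟩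
      exact ⟨x + y, hadd _ hx _ hy, C_add⟩
    · simp only [Finset.mem_image]
      rintro _ ⟨x, hx, rfl⟩
      exact ⟨-x, hneg _ hx, C_neg⟩
  set q := Fintype.card F with hq
  have hq1 : 1 < q := Fintype.one_lt_card
  set φ : F →+ F := AddMonoidHom.mk' (fun x => M.eval x) hMadd with hφ
  set W := valueSet M with hW
  have hWc : W.card * U.card = q := by
    have h1 := AddSubgroup.card_mul_index φ.ker
    rw [AddSubgroup.index_ker] at h1
    have h2 : Nat.card φ.ker = U.card := by
      rw [← Nat.card_eq_finsetCard U]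
      apply Nat.card_congr
      apply Equiv.subtypeEquivRight
      intro x
      rw [AddMonoidHom.mem_ker]
      simpa [hφ] using hM0 x
    have h3 : Nat.card φ.range = W.card := by
      rw [← Nat.card_eq_finsetCard W]
      apply Nat.card_congr
      apply Equiv.subtypeEquivRight
      intro x
      rw [AddMonoidHom.mem_range]
      simp [hφ, hW, valueSet]
    rw [h2, h3, Nat.card_eq_fintype_card] at h1
    rw [mul_comm]; exact h1
  set P : F[X] := ∏ w ∈ W, (X - C w) with hP
  have hPm : P.Monic := monic_prod_of_monic _ _ (fun u _ => monic_X_sub_C u)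
  have hPd : P.natDegree = W.card := by
    rw [hP, natDegree_prod_of_monic _ _ (fun u _ => monic_X_sub_C u)]; simp
  have hPe : ∀ x, P.eval x = ∏ u ∈ W, (x - u) := fun x => by simp [hP, eval_prod]
  have hQm : (X ^ q - X : F[X]).Monic := monic_X_pow_sub (by simpa using hq1)
  have hQd : (X ^ q - X : F[X]).natDegree = q := FiniteField.X_pow_card_sub_X_natDegree_eq F hq1
  have hPMm : (P.comp M).Monic := hPm.comp hMm (by omega)
  have hPMd : (P.comp M).natDegree = q := by rw [natDegree_comp, hPd, hMd, hWc]
  have hPM : P.comp M = X ^ q - X := by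
    rw [← sub_eq_zero]
    apply eq_zero_of_degree_lt_of_eval_finset_eq_zero Finset.univ
    · have : ((Finset.univ : Finset F).card : WithBot ℕ) = (P.comp M).degree := by
        rw [degree_eq_natDegree hPMm.ne_zero, hPMd, hq]; rfl
      rw [this]
      apply degree_sub_lt _ hPMm.ne_zero
      · rw [hPMm.leadingCoeff, hQm.leadingCoeff]
      · rw [degree_eq_natDegree hPMm.ne_zero, degree_eq_natDegree hQm.ne_zero, hPMd, hQd]
    · intro x _
      have : P.eval (M.eval x) = 0 := by
        rw [hPe]
        refine Finset.prod_eq_zero (i := M.eval x) ?_ (sub_self _)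
        simp [hW, valueSet]
      simp [eval_comp, this, hq, FiniteField.pow_card]
  have hMQ : M.comp (X ^ q - X) = M ^ q - M := by
    have h1 := hMcadd (X ^ q - X) X
    rw [sub_add_cancel, comp_X] at h1
    have h2 : M.comp (X ^ q) = M ^ q := by
      rw [← expand_eq_comp_X_pow, hq, FiniteField.expand_card]
    rw [← h2, h1]; ring
  have hMP : M.comp P = X ^ q - X := by
    have : (M.comp P - (X ^ q - X)).comp M = 0 := by
      rw [sub_comp, comp_assoc, hPM, hMQ]; simp
    rcases comp_eq_zero_iff.mp this with h | ⟨_, h⟩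
    · exact sub_eq_zero.mp h
    · exfalso
      have := congrArg natDegree h
      rw [natDegree_C] at this; omega
  refine ⟨P, hPm, by rw [hPd, hWc], ?_⟩
  have hsub : valueSet P ⊆ U := by
    intro y hy
    simp only [valueSet, Finset.mem_image, Finset.mem_univ, true_and] at hy
    obtain ⟨x, rfl⟩ := hy
    rw [← hM0, ← eval_comp, hMP]
    simp [hq, FiniteField.pow_card]
  apply Finset.eq_of_subset_of_card_le hsub
  have hWpos : 0 < W.card := Nat.pos_of_ne_zero (by rintro h; rw [h] at hWc; omega)
  have hle : q ≤ W.card * (valueSet P).card := by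
    rw [hq, ← Finset.card_univ]
    apply Finset.card_le_mul_card_image
    intro y _
    have hne : P - C y ≠ 0 := by
      intro h
      have := congrArg natDegree h
      rw [natDegree_sub_C, natDegree_zero] at this; omega
    calc _ ≤ (P - C y).roots.toFinset.card := by
          apply Finset.card_le_card
          intro x hx
          simp only [Finset.mem_filter] at hx
          simp [hne, hx.2]
      _ ≤ (P - C y).roots.card := Multiset.toFinset_card_le _
      _ ≤ (P - C y).natDegree := card_roots' _
      _ = W.card := by rw [natDegree_sub_C, hPd]
  rw [← hWc] at hle
  exact Nat.le_of_mul_le_mul_left hle hWpos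

theorem card_pow_image {F : Type*} [Field F] [Fintype F] [DecidableEq F] (U : Finset F) (v : ℕ)
    (hv : 0 < v) (hvq : v ∣ Fintype.card F - 1) (h0 : (0 : F) ∈ U)
    (hmul : ∀ c : F, c ^ v = 1 → ∀ x ∈ U, c * x ∈ U) :
    v * ((U.image (fun u => u ^ v)).card - 1) = U.card - 1 := by
  have hcn : (nthRootsFinset v (1 : F)).card = v := by
    obtain ⟨g, hg⟩ := IsCyclic.exists_generator (α := Fˣ)
    have ho : orderOf g = Fintype.card F - 1 := by
      rw [orderOf_eq_card_of_forall_mem_zpowers hg, Nat.card_eq_fintype_card, Fintype.card_units]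
    have hF : 1 < Fintype.card F := Fintype.one_lt_card
    obtain ⟨m, hm⟩ := hvq
    have hg' : IsPrimitiveRoot g (Fintype.card F - 1) := ho ▸ IsPrimitiveRoot.orderOf g
    have h2 := (hg'.pow (by omega) (hm.trans (mul_comm _ _)))
    exact (IsPrimitiveRoot.coe_units_iff.mpr h2).card_nthRootsFinset
  have himg : (U.image (fun u => u ^ v)).erase 0 = (U.erase 0).image (fun u => u ^ v) := by
    ext y
    simp only [Finset.mem_erase, Finset.mem_image]
    constructor
    · rintro ⟨hy, u, hu, rfl⟩
      exact ⟨u, ⟨fun h => hy (by rw [h, zero_pow hv.ne']), hu⟩, rfl⟩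
    · rintro ⟨u, ⟨hu0, hu⟩, rfl⟩
      exact ⟨pow_ne_zero _ hu0, u, hu, rfl⟩
  have hm0 : (0 : F) ∈ U.image (fun u => u ^ v) :=
    Finset.mem_image.mpr ⟨0, h0, zero_pow hv.ne'⟩
  rw [← Finset.card_erase_of_mem h0, ← Finset.card_erase_of_mem hm0, himg]
  rw [Finset.card_eq_sum_card_image (fun u => u ^ v) (U.erase 0)]
  rw [Finset.sum_const_nat (m := v), mul_comm]
  intro y hy
  obtain ⟨w, hw, rfl⟩ := Finset.mem_image.mp hy
  obtain ⟨hw0, hw⟩ := Finset.mem_erase.mp hw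
  rw [← hcn]
  symm
  apply Finset.card_bij' (fun c _ => c * w) (fun u _ => u / w)
  · intro c hc
    rw [mem_nthRootsFinset hv] at hc
    have hc0 : c ≠ 0 := by rintro rfl; simp [hv.ne'] at hc
    rw [hcn]
    simp only [Finset.mem_filter, Finset.mem_erase]
    exact ⟨⟨mul_ne_zero hc0 hw0, hmul c hc w hw⟩, by rw [mul_pow, hc, one_mul]⟩
  · intro u hu
    rw [hcn] at hu
    simp only [Finset.mem_filter, Finset.mem_erase] at hu
    rw [mem_nthRootsFinset hv, div_pow, hu.2, div_self (pow_ne_zero _ hw0)]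
  · intro c _; field_simp
  · intro u _; field_simp

/-- for any `a ≠ 0` and `b`, the set `S = a · U^v + b` satisfies
`𝒫(S, q) ≠ ∅`. -/
theorem stmt_15 (p n k v : ℕ) (hp : p.Prime) (hn : 0 < n) (hk : k ∣ n)
    (hv : 0 < v) (hvd : v ∣ p ^ k - 1)
    (F : Type) [Field F] [Fintype F] [DecidableEq F]
    (hcard : Fintype.card F = p ^ n)
    (U : Finset F) (hU : IsSubspaceOver (p ^ k) (↑U : Set F))
    (hUv : 2 < (U.image (fun u => u ^ v)).card) :
    ∀ a b : F, a ≠ 0 → ∃ f : F[X], f ∈ MVSPset (U.image (fun u => a * u ^ v + b)) := by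
  intro a b ha
  obtain ⟨h0, hadd, hneg, hsm⟩ := hU
  simp only [Finset.mem_coe] at h0 hadd hneg hsm
  obtain ⟨P, hPm, hPd, hPv⟩ := exists_lin U h0 hadd hneg
  have hvq : v ∣ Fintype.card F - 1 := by
    rw [hcard]
    obtain ⟨m, rfl⟩ := hk
    rw [pow_mul]
    refine hvd.trans ?_
    simpa using Nat.sub_dvd_pow_sub_pow (p ^ k) 1 m
  have hc := card_pow_image U v hv hvq h0 (by
    intro c hc x hx
    apply hsm c _ x hx
    obtain ⟨m, hm⟩ := hvd
    have : p ^ k = v * m + 1 := by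
      have := Nat.pos_of_ne_zero (pow_ne_zero k hp.ne_zero)
      omega
    rw [this, pow_succ, pow_mul, hc, one_pow, one_mul])
  set f : F[X] := C a * P ^ v + C b with hf
  have hfd : f.natDegree = v * P.natDegree := by
    rw [hf, natDegree_add_C, natDegree_C_mul ha, natDegree_pow]
  have hfv : valueSet f = U.image (fun u => a * u ^ v + b) := by
    conv_rhs => rw [← hPv]
    rw [valueSet, valueSet, Finset.image_image]
    congr 1
    ext x
    simp [hf]
  have hfc : (valueSet f).card = (U.image (fun u => u ^ v)).card := by
    rw [hfv]
    have : U.image (fun u => a * u ^ v + b)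
        = (U.image (fun u => u ^ v)).image (fun y => a * y + b) := by
      rw [Finset.image_image]; rfl
    rw [this]
    apply Finset.card_image_of_injective
    intro x y h
    exact mul_left_cancel₀ ha (add_right_cancel h)
  have hF : 1 < Fintype.card F := Fintype.one_lt_card
  have hdpos : 0 < P.natDegree := Nat.pos_of_ne_zero (by intro h; rw [h] at hPd; omega)
  have hUpos : 0 < U.card := Finset.card_pos.mpr ⟨0, h0⟩
  refine ⟨f, ⟨by rw [hfd]; positivity, ?_⟩, hfv⟩
  rw [hfc, hfd, ← hPd]
  generalize (U.image (fun u => u ^ v)).card = s at *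
  obtain ⟨t, rfl⟩ : ∃ t, s = t + 1 := ⟨s - 1, by omega⟩
  have hUt : U.card = v * t + 1 := by simp at hc; omega
  rw [hUt]
  generalize P.natDegree = d at *
  congr 1
  symm
  have e : d * (v * t + 1) - 1 = (d - 1) + v * d * t := by
    have : d * (v * t + 1) = d + v * d * t := by ring
    omega
  rw [e, Nat.add_mul_div_left _ _ (by positivity), Nat.div_eq_of_lt, zero_add]
  have : 1 * d ≤ v * d := Nat.mul_le_mul_right d hv
  omega
end

section
/- Let p be a prime, n ≥ 1, q = p^n, k a divisor of n, and let U be an 𝔽_{p^k}-subspace of 𝔽_q with #U = p^{mk}, and let v be a positive divisor of p^k − 1. Suppose there exist a subfield K of 𝔽_q, of order Q, and a positive divisor s of Q − 1 such that U^v = {y^s : y ∈ K}. Then U = {c ∈ 𝔽_q : c^{p^{mk}} = c}, i.e., U is the subfield of 𝔽_q of order p^{mk}. -/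
open Polynomial

/-- if `U^v = K^s` for a subfield `K` of order `Q` and a positive divisor `s` of
`Q - 1`, then `U` is the subfield of `𝔽_q` of order `p^{mk}`. -/
theorem stmt_16 (p n k m v : ℕ) (hp : p.Prime) (hn : 0 < n) (hk : k ∣ n)
    (hv : 0 < v) (hvd : v ∣ p ^ k - 1)
    (F : Type) [Field F] [Fintype F] [DecidableEq F]
    (hcard : Fintype.card F = p ^ n)
    (U : Finset F) (hU : IsSubspaceOver (p ^ k) (↑U : Set F))
    (hUcard : U.card = p ^ (m * k))
    (K : Subfield F) (s : ℕ) (hs : 0 < s) (hsd : s ∣ Nat.card K - 1)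
    (hUv : (↑(U.image (fun u => u ^ v)) : Set F) = (fun y => y ^ s) '' (K : Set F)) :
    U = Finset.univ.filter (fun c : F => c ^ p ^ (m * k) = c) := by
  have hk0 : 0 < k := Nat.pos_of_dvd_of_pos hk hn
  obtain ⟨h0, hadd, hneg, hsm⟩ := hU
  have hpk : 1 ≤ p ^ k := Nat.one_le_pow _ _ hp.pos
  have key : ∀ x : F, x ∈ (U : Set F) ↔ ∃ y ∈ K, y ^ s = x ^ v := by
    intro x
    have hx : ∀ z : F, z ∈ (↑(U.image (fun u => u ^ v)) : Set F) ↔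
        z ∈ (fun y => y ^ s) '' (K : Set F) := fun z => by rw [hUv]
    constructor
    · intro h
      obtain ⟨y, hy, e⟩ := (hx (x ^ v)).1
        (Finset.mem_coe.2 (Finset.mem_image_of_mem _ (Finset.mem_coe.1 h)))
      exact ⟨y, hy, e⟩
    · rintro ⟨y, hy, e⟩
      have h1 := (hx (x ^ v)).2 ⟨y, hy, e⟩
      obtain ⟨u, hu, e2⟩ := Finset.mem_image.1 (Finset.mem_coe.1 h1)
      by_cases hu0 : u = 0
      · rw [hu0, zero_pow hv.ne'] at e2
        have : x = 0 := by
          by_contra hne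
          exact pow_ne_zero v hne e2.symm
        rw [this]; exact h0
      · have hc : (x / u) ^ v = 1 := by
          rw [div_pow, e2, div_self]
          rw [← e2]; exact pow_ne_zero v hu0
        have hc2 : (x / u) ^ (p ^ k - 1) = 1 := by
          obtain ⟨d, hd⟩ := hvd
          rw [hd, pow_mul, hc, one_pow]
        have hc3 : (x / u) ^ (p ^ k) = x / u := by
          rw [← Nat.sub_add_cancel hpk, pow_succ, hc2, one_mul]
        have := hsm _ hc3 u (Finset.mem_coe.2 hu)
        rwa [div_mul_cancel₀ _ hu0] at this
  let L : Subfield F :=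
    { carrier := (U : Set F)
      mul_mem' := by
        intro a b ha hb
        obtain ⟨y, hy, e⟩ := (key a).1 ha
        obtain ⟨z, hz, e'⟩ := (key b).1 hb
        exact (key _).2 ⟨y * z, K.mul_mem hy hz, by rw [mul_pow, mul_pow, e, e']⟩
      one_mem' := (key 1).2 ⟨1, K.one_mem, by simp⟩
      add_mem' := fun {a b} ha hb => hadd a ha b hb
      zero_mem' := h0
      neg_mem' := fun {a} ha => hneg a ha
      inv_mem' := by
        intro a ha
        obtain ⟨y, hy, e⟩ := (key a).1 ha
        exact (key _).2 ⟨y⁻¹, K.inv_mem hy, by rw [inv_pow, inv_pow, e]⟩ }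
  have hLU : ∀ x, x ∈ L ↔ x ∈ U := fun x => Iff.rfl
  have : Fintype L := Fintype.ofFinite L
  have hLc : Fintype.card L = p ^ (m * k) := by
    rw [← hUcard]
    exact Fintype.card_of_subtype U (fun x => (hLU x).symm)
  have hlt : 1 < p ^ (m * k) := by
    rw [← hLc]; exact Fintype.one_lt_card
  apply Finset.eq_of_subset_of_card_le
  · intro x hx
    rw [Finset.mem_filter]
    refine ⟨Finset.mem_univ _, ?_⟩
    have := FiniteField.pow_card (⟨x, hx⟩ : L)
    rw [hLc] at this
    exact congrArg Subtype.val this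
  · rw [hUcard]
    have hne : (X ^ (p ^ (m * k)) - X : F[X]) ≠ 0 := FiniteField.X_pow_card_sub_X_ne_zero F hlt
    have hd := FiniteField.X_pow_card_sub_X_natDegree_eq F hlt
    calc _ ≤ (X ^ (p ^ (m * k)) - X : F[X]).roots.toFinset.card := by
          apply Finset.card_le_card
          intro c hc
          rw [Multiset.mem_toFinset, mem_roots hne]
          simp [(Finset.mem_filter.1 hc).2]
      _ ≤ _ := Multiset.toFinset_card_le _
      _ ≤ _ := card_roots' _
      _ = _ := hd
end

section
/- Let q be a power of a prime p, let n, k ≥ 1, and let A(x) = Σ_{i=0}^k a_i x^{q^i} ∈ 𝔽_{q^n}[x] be a monic q-linearized polynomial (a_k = 1) that divides x^{q^n} − x (so a_0 ≠ 0), and assume A has at least three nonzero coefficients (A is not a binomial). Let F ∈ 𝔽_{q^n}[x] be a nonconstant polynomial with F(0) = 0 satisfying A(F(x)) = −a_0·(x^{q^n} − x)·F'(x). Then: (1) there exists an exponent e with nonzero coefficient in F such that p does not divide e; (2) every exponent e occurring in F with p ∤ e satisfies e ≡ 1 (mod q^k); and (3) every exponent of F that is divisible by p has the form e·q^l, where l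 ≥ 1 and e is an exponent occurring in F with p ∤ e. -/
open Polynomial

theorem aux_coeff_pow (p r q : ℕ) (hp : p.Prime) (hq : q = p ^ r)
    (K : Type) [Field K] [CharP K p] (f : K[X]) (i m : ℕ) :
    (f ^ q ^ i).coeff m = if q ^ i ∣ m then (f.coeff (m / q ^ i)) ^ q ^ i else 0 := by
  have : Fact p.Prime := ⟨hp⟩
  have h : q ^ i = p ^ (r * i) := by rw [hq, pow_mul]
  have hpos : 0 < p ^ (r * i) := pow_pos hp.pos _
  rw [h, ← Polynomial.map_iterateFrobenius_expand, coeff_map, coeff_expand hpos]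
  split_ifs
  · rw [iterateFrobenius_def]
  · simp

theorem aux_H (p r q n k : ℕ) (hp : p.Prime) (hq : q = p ^ r)
    (K : Type) [Field K] [CharP K p] (a : ℕ → K) (f : K[X])
    (heq : (∑ i ∈ Finset.range (k + 1), C (a i) * X ^ q ^ i).comp f
      = -C (a 0) * (X ^ q ^ n - X) * f.derivative) (m : ℕ) :
    ∑ i ∈ Finset.range (k + 1),
      a i * (if q ^ i ∣ m then (f.coeff (m / q ^ i)) ^ q ^ i else 0)
    = a 0 * (f.coeff m * m) -
      a 0 * (if q ^ n ≤ m then f.coeff (m - q ^ n + 1) * ((m - q ^ n + 1 : ℕ) : K) else 0) := by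
  have h1 : -C (a 0) * (X ^ q ^ n - X) * f.derivative
      = C (a 0) * (X * f.derivative) - C (a 0) * (X ^ q ^ n * f.derivative) := by ring
  have h2 := congrArg (fun g => g.coeff m) heq
  simp only [h1, coeff_sub, coeff_C_mul, coeff_X_pow_mul', coeff_derivative] at h2
  rw [Polynomial.sum_comp, finset_sum_coeff] at h2
  simp only [mul_comp, C_comp, pow_comp, X_comp, coeff_C_mul,
    aux_coeff_pow p r q hp hq K f] at h2
  rw [h2]
  have h3 : (X * f.derivative).coeff m = f.coeff m * m := by
    cases m with
    | zero => simp
    | succ m => rw [coeff_X_mul, coeff_derivative]; push_cast; rfl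
  rw [h3]
  push_cast
  rfl

theorem aux_main (p r q n k : ℕ) (hp : p.Prime) (hr : 0 < r) (hq : q = p ^ r) (hk : 0 < k)
    (K : Type) [Field K] [CharP K p]
    (a : ℕ → K) (hak : a k = 1)
    (f : K[X]) (hf : 0 < f.natDegree) (hf0 : f.eval 0 = 0)
    (heq : (∑ i ∈ Finset.range (k + 1), C (a i) * X ^ q ^ i).comp f
      = -C (a 0) * (X ^ q ^ n - X) * f.derivative) :
    (∃ e : ℕ, f.coeff e ≠ 0 ∧ ¬ p ∣ e) ∧
    (∀ e : ℕ, f.coeff e ≠ 0 → ¬ p ∣ e → e % q ^ k = 1) ∧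
    (∀ e : ℕ, f.coeff e ≠ 0 → p ∣ e →
      ∃ e₀ l : ℕ, f.coeff e₀ ≠ 0 ∧ ¬ p ∣ e₀ ∧ 1 ≤ l ∧ e = e₀ * q ^ l) := by
  have H := aux_H p r q n k hp hq K a f heq
  have hq2 : 2 ≤ q := by
    rw [hq]; exact hp.two_le.trans (Nat.le_self_pow hr.ne' p)
  have hqpos : ∀ i, 0 < q ^ i := fun i => pow_pos (by omega) _
  set d := f.natDegree with hd
  have hcd : f.coeff d ≠ 0 := by
    rw [hd]; exact leadingCoeff_ne_zero.mpr (by rintro rfl; simp at hd; omega)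
  have hle : ∀ e, f.coeff e ≠ 0 → e ≤ d := fun e he => le_natDegree_of_ne_zero he
  have hzero : ∀ e, d < e → f.coeff e = 0 := fun e he => coeff_eq_zero_of_natDegree_lt he
  have hQk : 2 ≤ q ^ k := hq2.trans (Nat.le_self_pow hk.ne' q)
  -- top coefficient
  have hLHS : ∑ i ∈ Finset.range (k + 1), a i *
      (if q ^ i ∣ q ^ k * d then (f.coeff (q ^ k * d / q ^ i)) ^ q ^ i else 0)
      = f.coeff d ^ q ^ k := by
    rw [Finset.sum_eq_single k]
    · rw [if_pos (Dvd.intro _ rfl), Nat.mul_div_cancel_left _ (hqpos k), hak, one_mul]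
    · intro i hi hik
      have hi' : i < k := by have := Finset.mem_range.mp hi; omega
      split_ifs with hdv
      · rw [hzero, zero_pow (hqpos i).ne', mul_zero]
        rw [Nat.lt_div_iff_mul_lt' hdv]
        have := Nat.pow_lt_pow_right (a := q) (by omega) hi'
        nlinarith
      · simp
    · intro h; simp at h
  have htop := H (q ^ k * d)
  rw [hLHS, hzero (q ^ k * d) (by nlinarith)] at htop
  have hne : f.coeff d ^ q ^ k ≠ 0 := pow_ne_zero _ hcd
  rw [htop] at hne
  have ha0 : a 0 ≠ 0 := by intro h; simp [h] at hne
  have hQ : q ^ n ≤ q ^ k * d := by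
    by_contra h; simp [h] at hne
  rw [if_pos hQ] at hne
  have hce : f.coeff (q ^ k * d - q ^ n + 1) ≠ 0 := by intro h; simp [h] at hne
  have hpe : ((q ^ k * d - q ^ n + 1 : ℕ) : K) ≠ 0 := by intro h; rw [h] at hne; simp at hne
  have hdb : q ^ k * d + 1 ≤ q ^ n + d := by have := hle _ hce; omega
  have hdQ : d < q ^ n := by nlinarith
  have hkn : k ≤ n := by
    by_contra h
    have := Nat.pow_lt_pow_right (a := q) (by omega) (show n < k by omega)
    nlinarith
  refine ⟨⟨_, hce, fun h => hpe ((CharP.cast_eq_zero_iff K p _).mpr h)⟩, ?_, ?_⟩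
  · intro e he hpd
    have he1 : 1 ≤ e := by
      rcases Nat.eq_zero_or_pos e with h | h
      · subst h; simp at hpd
      · exact h
    have h := H (q ^ n + (e - 1))
    have h4 : q ^ n + (e - 1) - q ^ n + 1 = e := by omega
    by_cases hex : ∃ i ∈ Finset.range (k + 1), q ^ i ∣ q ^ n + (e - 1) ∧
        f.coeff ((q ^ n + (e - 1)) / q ^ i) ≠ 0
    · obtain ⟨i, hi, ⟨s, hs⟩, hc⟩ := hex
      rw [hs, Nat.mul_div_cancel_left _ (hqpos i)] at hc
      have hsd := hle _ hc
      have hik : i = k := by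
        by_contra hik
        have hi' : i < k := by have := Finset.mem_range.mp hi; omega
        have h5 := Nat.pow_lt_pow_right (a := q) (by omega) hi'
        have h6 : q ^ i * s ≤ q ^ i * d := Nat.mul_le_mul_left _ hsd
        have h7 : (q ^ i + 1) * d ≤ q ^ k * d := Nat.mul_le_mul_right _ h5
        nlinarith
      rw [hik] at hs
      have h8 : q ^ k ∣ e - 1 :=
        (Nat.dvd_add_right (pow_dvd_pow q hkn)).mp ⟨s, hs⟩
      obtain ⟨t, ht⟩ := h8
      have : e = 1 + q ^ k * t := by omega
      rw [this, Nat.add_mul_mod_self_left, Nat.mod_eq_of_lt (by omega)]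
    · exfalso
      push Not at hex
      rw [Finset.sum_eq_zero, hzero _ (by omega), if_pos (by omega), h4] at h
      · have h9 : (e : K) ≠ 0 := fun h => hpd ((CharP.cast_eq_zero_iff K p _).mp h)
        have : a 0 * (f.coeff e * e) ≠ 0 := mul_ne_zero ha0 (mul_ne_zero he h9)
        apply this
        simpa using h
      · intro i hi
        split_ifs with hdv
        · rw [hex i hi hdv, zero_pow (hqpos i).ne', mul_zero]
        · simp
  · intro e
    induction e using Nat.strong_induction_on with
    | _ e ih =>
    intro he hpd
    have he0 : e ≠ 0 := by
      rintro rfl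
      exact he (by rw [coeff_zero_eq_eval_zero, hf0])
    have h := H e
    have hed := hle e he
    rw [if_neg (by omega), (CharP.cast_eq_zero_iff K p e).mpr hpd] at h
    by_cases hex : ∃ i, 1 ≤ i ∧ q ^ i ∣ e ∧ f.coeff (e / q ^ i) ≠ 0
    · obtain ⟨i, hi, ⟨s, hs⟩, hc⟩ := hex
      rw [hs, Nat.mul_div_cancel_left _ (hqpos i)] at hc
      by_cases hps : p ∣ s
      · have hqi : 2 ≤ q ^ i := hq2.trans (Nat.le_self_pow (by omega) q)
        have hs0 : 0 < s := by
          rcases Nat.eq_zero_or_pos s with h | h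
          · subst h; simp at hs; omega
          · exact h
        obtain ⟨e₀, l, h1, h2, h3, h4⟩ := ih s (by nlinarith) hc hps
        exact ⟨e₀, l + i, h1, h2, by omega, by rw [hs, h4, pow_add]; ring⟩
      · exact ⟨s, i, hc, hps, hi, by rw [hs, mul_comm]⟩
    · exfalso
      push Not at hex
      rw [Finset.sum_eq_single 0] at h
      · simp at h
        tauto
      · intro i hi hi0
        split_ifs with hdv
        · rw [hex i (by omega) hdv, zero_pow (hqpos i).ne', mul_zero]
        · simp
      · intro h; simp at h

/-- structure of the exponents of a nonconstant `F` with `F(0) = 0` satisfying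
`A(F(x)) = -a₀(x^{q^n} - x)F'(x)` for a monic `q`-linearized non-binomial `A` dividing
`x^{q^n} - x`. -/
theorem stmt_17 (p r q n k : ℕ) (hp : p.Prime) (hr : 0 < r) (hq : q = p ^ r) (hn : 0 < n)
    (K : Type) [Field K] [Fintype K] [DecidableEq K]
    (hcard : Fintype.card K = q ^ n)
    (a : ℕ → K) (hak : a k = 1)
    (hdvd : (∑ i ∈ Finset.range (k + 1), C (a i) * X ^ q ^ i) ∣ (X ^ q ^ n - X : K[X]))
    (h3 : ∃ i₁ i₂ i₃ : ℕ, i₁ < i₂ ∧ i₂ < i₃ ∧ i₃ ≤ k ∧ a i₁ ≠ 0 ∧ a i₂ ≠ 0 ∧ a i₃ ≠ 0)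
    (f : K[X]) (hf : 0 < f.natDegree) (hf0 : f.eval 0 = 0)
    (heq : (∑ i ∈ Finset.range (k + 1), C (a i) * X ^ q ^ i).comp f
      = -C (a 0) * (X ^ q ^ n - X) * f.derivative) :
    (∃ e : ℕ, f.coeff e ≠ 0 ∧ ¬ p ∣ e) ∧
    (∀ e : ℕ, f.coeff e ≠ 0 → ¬ p ∣ e → e % q ^ k = 1) ∧
    (∀ e : ℕ, f.coeff e ≠ 0 → p ∣ e →
      ∃ e₀ l : ℕ, f.coeff e₀ ≠ 0 ∧ ¬ p ∣ e₀ ∧ 1 ≤ l ∧ e = e₀ * q ^ l) := by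
  obtain ⟨i₁, i₂, i₃, h1, h2, h3', -⟩ := h3
  have : Fact p.Prime := ⟨hp⟩
  have : CharP K p := by
    refine charP_of_card_eq_prime_pow (f := r * n) ?_
    rw [hcard, hq, pow_mul]
  exact aux_main p r q n k hp hr hq (by omega) K a hak f hf hf0 heq
end
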